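/- arXiv:1907.12578 — 14 statements merged into one kernel-verified Lean document; each statement's English description precedes it below -/
import Mathlib

section
/- Let u,v ∈ ℝ⁴ with v0 ≠ 0 and Q^tilt(v) = v1² − 2v0v2 ≥ 0, and fix s > 0. Then the numerical λ-wall Υ_{u,v,s} = {(α,β) ∈ ℝ² : α > 0, f_{u,v,s}(α,β) = 0} is a bounded subset of ℝ² if and only if δ_{10}(u,v) = u1v0 − u0v1 ≠ 0. -/
noncomputable section

/-- `ρ_v(α,β) = v2 − βv1 + (β²−α²)v0/2`. -/
def rho (v : Fin 4 → ℝ) (α β : ℝ) : ℝ :=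
  v 2 - β * v 1 + (β ^ 2 - α ^ 2) * v 0 / 2

/-- `τ_{v,s}(α,β)`. -/
def tau (v : Fin 4 → ℝ) (s α β : ℝ) : ℝ :=
  v 3 - β * v 2 + β ^ 2 / 2 * v 1 - β ^ 3 / 6 * v 0 - (s + 1 / 6) * (v 1 - β * v 0) * α ^ 2

/-- `f_{u,v,s}(α,β) = τ_{u,s}ρ_v − τ_{v,s}ρ_u`. -/
def fwall (u v : Fin 4 → ℝ) (s α β : ℝ) : ℝ :=
  tau u s α β * rho v α β - tau v s α β * rho u α β

/-- After subtracting a multiple of `v` from `u` and translating `β` by `v 1 / v 0`, the wall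
function becomes a combination of a quartic, a cubic and a quadratic polynomial. -/
theorem fwall_normal_form (u v : Fin 4 → ℝ) (hv0 : v 0 ≠ 0) (s : ℝ) :
    ∃ D E q r : ℝ, ∀ α b : ℝ, fwall u v s α (b + v 1 / v 0) =
      (u 1 * v 0 - u 0 * v 1) * ((b ^ 2 - α ^ 2) ^ 2 / 12 + s / 2 * α ^ 2 * (α ^ 2 + b ^ 2)
        - D / 2 * b ^ 2 - (s + 1 / 6) * D * α ^ 2 + E * b)
      + q * (-(b ^ 3) / 3 + (1 / 3 - s) * α ^ 2 * b - E)
      + r * (D + (b ^ 2 - α ^ 2) / 2) := by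
  obtain ⟨m, hm⟩ : ∃ m, m = v 1 / v 0 := ⟨_, rfl⟩
  obtain ⟨c, hc⟩ : ∃ c, c = u 0 / v 0 := ⟨_, rfl⟩
  have hv1 : v 1 = m * v 0 := by rw [hm]; field_simp
  have hu0 : u 0 = c * v 0 := by rw [hc]; field_simp
  obtain ⟨d, hd⟩ : ∃ d, v 2 = d * v 0 := ⟨v 2 / v 0, by field_simp⟩
  obtain ⟨e, he⟩ : ∃ e, v 3 = e * v 0 := ⟨v 3 / v 0, by field_simp⟩
  refine ⟨d - m ^ 2 / 2, e - m * d + m ^ 3 / 3,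
    (u 2 - c * v 2 - m * (u 1 - c * v 1)) * v 0,
    (u 3 - c * v 3 - m * (u 2 - c * v 2) + m ^ 2 / 2 * (u 1 - c * v 1)) * v 0, ?_⟩
  intro α b
  rw [← hm]
  simp only [fwall, tau, rho, hv1, hu0, hd, he]
  ring

/-- A real monic cubic has a real root. -/
theorem exists_root_monic_cubic (a c d : ℝ) : ∃ x : ℝ, x ^ 3 + a * x ^ 2 + c * x + d = 0 := by
  obtain ⟨B, hB⟩ : ∃ B, B = 1 + |a| + |c| + |d| := ⟨_, rfl⟩
  have ha := abs_nonneg a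
  have hc := abs_nonneg c
  have hd := abs_nonneg d
  have hB1 : 1 ≤ B := by linarith
  have hBB : B ≤ B ^ 2 := by nlinarith
  have hcube : B ^ 3 = B ^ 2 + |a| * B ^ 2 + |c| * B ^ 2 + |d| * B ^ 2 := by
    rw [show B ^ 3 = B * B ^ 2 by ring]
    nth_rewrite 1 [hB]
    ring
  have h1 := mul_le_mul_of_nonneg_right (abs_le.1 (le_refl |a|)).1 (sq_nonneg B)
  have h2 := mul_le_mul_of_nonneg_right (abs_le.1 (le_refl |a|)).2 (sq_nonneg B)
  have h3 := mul_le_mul_of_nonneg_right (abs_le.1 (le_refl |c|)).1 (by linarith : 0 ≤ B)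
  have h4 := mul_le_mul_of_nonneg_right (abs_le.1 (le_refl |c|)).2 (by linarith : 0 ≤ B)
  have h5 := mul_le_mul_of_nonneg_left hBB hc
  have h6 : |d| ≤ |d| * B ^ 2 := le_mul_of_one_le_right hd (by linarith)
  have h7 := neg_abs_le d
  have h8 := le_abs_self d
  have hcont : ContinuousOn (fun x : ℝ => x ^ 3 + a * x ^ 2 + c * x + d) (Set.Icc (-B) B) := by
    fun_prop
  obtain ⟨x, -, hx⟩ := intermediate_value_Icc (by linarith : -B ≤ B) hcont
    (show (0 : ℝ) ∈ Set.Icc _ _ from ⟨by nlinarith, by nlinarith⟩)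
  exact ⟨x, hx⟩

/-- The leading form of the wall function is positive definite. -/
theorem leading_form_lower_bound {s : ℝ} (hs : 0 < s) (α b : ℝ) :
    min (1 / 12) (s / 8) * (α ^ 2 + b ^ 2) ^ 2 ≤
      (b ^ 2 - α ^ 2) ^ 2 / 12 + s / 2 * α ^ 2 * (α ^ 2 + b ^ 2) := by
  have h1 := mul_le_mul_of_nonneg_right (min_le_left (1 / 12) (s / 8))
    (sq_nonneg (b ^ 2 - α ^ 2))
  have h2 := mul_le_mul_of_nonneg_right (min_le_right (1 / 12) (s / 8))
    (by positivity : 0 ≤ 4 * α ^ 2 * (α ^ 2 + b ^ 2))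
  have h3 : 0 ≤ min (1 / 12) (s / 8) * (α ^ 2) ^ 2 := by positivity
  linarith

/-- A quartic equation whose leading form dominates `(α² + b²)²` bounds its solutions. -/
theorem max_abs_le_of_quartic_le {c a₁ a₂ a₃ a₄ a₅ a₆ α b : ℝ} (hc : 0 < c)
    (h : c * (α ^ 2 + b ^ 2) ^ 2 ≤
      a₁ * b ^ 2 + a₂ * α ^ 2 + a₃ * b + a₄ * b ^ 3 + a₅ * (α ^ 2 * b) + a₆) :
    max |α| |b| ≤ max 1 ((|a₁| + |a₂| + |a₃| + |a₄| + |a₅| + |a₆|) / c) := by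
  obtain ⟨N, hN⟩ : ∃ N, N = max |α| |b| := ⟨_, rfl⟩
  rw [← hN]
  rcases le_total N 1 with h1 | h1
  · exact le_max_of_le_left h1
  refine le_max_of_le_right ((le_div_iff₀ hc).2 ?_)
  have hα : |α| ≤ N := hN ▸ le_max_left _ _
  have hb : |b| ≤ N := hN ▸ le_max_right _ _
  have hN0 : 0 ≤ N := by linarith
  have bound (a t : ℝ) (ht : |t| ≤ N ^ 3) : a * t ≤ |a| * N ^ 3 :=
    (le_abs_self _).trans (by rw [abs_mul]; gcongr)
  have e1 := bound a₁ (b ^ 2) (by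
    rw [abs_pow]; exact (pow_le_pow_left₀ (abs_nonneg b) hb 2).trans
      (pow_le_pow_right₀ h1 (by norm_num)))
  have e2 := bound a₂ (α ^ 2) (by
    rw [abs_pow]; exact (pow_le_pow_left₀ (abs_nonneg α) hα 2).trans
      (pow_le_pow_right₀ h1 (by norm_num)))
  have e3 := bound a₃ b (hb.trans (le_self_pow₀ h1 (by norm_num)))
  have e4 := bound a₄ (b ^ 3) (by rw [abs_pow]; gcongr)
  have e5 := bound a₅ (α ^ 2 * b) (by
    rw [abs_mul, abs_pow, pow_succ N 2]; gcongr)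
  have e6 := bound a₆ 1 (by rw [abs_one]; exact one_le_pow₀ h1)
  have hsq : N ^ 2 ≤ α ^ 2 + b ^ 2 := by
    rcases max_choice |α| |b| with hm | hm <;> rw [hN, hm, sq_abs] <;>
      nlinarith [sq_nonneg α, sq_nonneg b]
  have hquart : c * N ^ 4 ≤ c * (α ^ 2 + b ^ 2) ^ 2 := by
    rw [show N ^ 4 = (N ^ 2) ^ 2 by ring]; gcongr
  have hN3 : 0 < N ^ 3 := by positivity
  refine le_of_mul_le_mul_right ?_ hN3
  linarith [show N * c * N ^ 3 = c * N ^ 4 by ring]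

/-- When the quartic part vanishes, the wall meets every vertical line far enough from the
origin. -/
theorem exists_root_cubic_add_quadratic (s D E q r α : ℝ) (hα : 2 * D ≤ α ^ 2) :
    ∃ b : ℝ, q * (-(b ^ 3) / 3 + (1 / 3 - s) * α ^ 2 * b - E)
      + r * (D + (b ^ 2 - α ^ 2) / 2) = 0 := by
  by_cases hq : q = 0
  · refine ⟨√(α ^ 2 - 2 * D), ?_⟩
    rw [hq, Real.sq_sqrt (by linarith)]
    ring
  · obtain ⟨b, hb⟩ := exists_root_monic_cubic (-(3 * r / (2 * q))) (-(3 * (1 / 3 - s) * α ^ 2))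
      (3 * E - 3 * r / q * (D - α ^ 2 / 2))
    refine ⟨b, ?_⟩
    have : q * (-(b ^ 3) / 3 + (1 / 3 - s) * α ^ 2 * b - E)
        + r * (D + (b ^ 2 - α ^ 2) / 2) = -(q / 3) * (b ^ 3 + -(3 * r / (2 * q)) * b ^ 2
          + -(3 * (1 / 3 - s) * α ^ 2) * b + (3 * E - 3 * r / q * (D - α ^ 2 / 2))) := by
      field_simp
      ring
    rw [this, hb, mul_zero]

/-- The numerical λ-wall `Υ_{u,v,s}` is bounded iff `δ_{10}(u,v) = u1v0 − u0v1 ≠ 0`. -/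
theorem numerical_lambda_wall_bounded_iff (u v : Fin 4 → ℝ) (hv0 : v 0 ≠ 0)
    (hbog : v 1 ^ 2 - 2 * v 0 * v 2 ≥ 0) (s : ℝ) (hs : 0 < s) :
    Bornology.IsBounded {p : ℝ × ℝ | 0 < p.1 ∧ fwall u v s p.1 p.2 = 0} ↔
      u 1 * v 0 - u 0 * v 1 ≠ 0 := by
  obtain ⟨D, E, q, r, hf⟩ := fwall_normal_form u v hv0 s
  constructor
  · intro hbdd hδ
    obtain ⟨M, hM⟩ := hbdd.exists_norm_le
    have hM0 := abs_nonneg M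
    have hD0 := abs_nonneg D
    obtain ⟨α, hα⟩ : ∃ α, α = |M| + 1 + 2 * |D| := ⟨_, rfl⟩
    obtain ⟨b, hb⟩ := exists_root_cubic_add_quadratic s D E q r α (by
      nlinarith [le_abs_self D])
    have hle := hM (α, b + v 1 / v 0) ⟨show 0 < α by linarith, show fwall _ _ _ _ _ = 0 by
      rw [hf, hδ, zero_mul, zero_add, hb]⟩
    have hα_le : |α| ≤ M := (norm_fst_le (α, b + v 1 / v 0)).trans hle
    linarith [le_abs_self α, le_abs_self M]
  · intro hδ
    obtain ⟨δ, hδ_def⟩ : ∃ δ, δ = u 1 * v 0 - u 0 * v 1 := ⟨_, rfl⟩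
    rw [← hδ_def] at hδ hf
    have hc : 0 < min (1 / 12) (s / 8) := by positivity
    have hbound (α b : ℝ) (h : fwall u v s α (b + v 1 / v 0) = 0) :=
      max_abs_le_of_quartic_le (a₁ := D / 2 - r / (2 * δ))
        (a₂ := (s + 1 / 6) * D + r / (2 * δ)) (a₃ := -E) (a₄ := q / (3 * δ))
        (a₅ := -(q / δ * (1 / 3 - s))) (a₆ := q / δ * E - r / δ * D) hc
        ((leading_form_lower_bound hs α b).trans_eq (by
          rw [hf] at h
          field_simp
          linear_combination 432 * h))
    obtain ⟨K, hK⟩ : ∃ K : ℝ, ∀ α b : ℝ, fwall u v s α (b + v 1 / v 0) = 0 →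
      max |α| |b| ≤ K := ⟨_, hbound⟩
    refine isBounded_iff_forall_norm_le.2 ⟨K + |v 1 / v 0|, ?_⟩
    rintro ⟨α, β⟩ ⟨-, hp⟩
    have h := hK α (β - v 1 / v 0) (by rwa [sub_add_cancel])
    rw [max_le_iff] at h
    rw [Prod.norm_mk, max_le_iff, Real.norm_eq_abs, Real.norm_eq_abs]
    refine ⟨by linarith [h.1, abs_nonneg (v 1 / v 0)], ?_⟩
    have := abs_sub_abs_le_abs_sub β (v 1 / v 0)
    linarith [h.2]
end
end

section
/- Let u,u',v ∈ ℝ⁴ with v0 ≠ 0 and fix s > 0. Assume δ_{01}(u,v) = 0, δ_{02}(u,v) ≠ 0, δ_{01}(u',v) = 0, δ_{02}(u',v) ≠ 0, and that u is not v-equivalent to u'. Then every point (α,β) with α > 0 satisfying f_{u,v,s}(α,β) = 0 and f_{u',v,s}(α,β) = 0 also satisfies ρ_v(α,β) = 0 and τ_{v,s}(α,β) = 0. In particular, if Θ_v ∩ Γ_{v,s} = ∅ then the numerical λ-walls Υ_{u,v,s} and Υ_{u',v,s} are disjoint. -/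
noncomputable section

/-- Subtracting a multiple of `v` from a class proportional to `v` in its first two coordinates
leaves a class concentrated in the last two coordinates. -/
theorem exists_eq_smul_add_vec (u v : Fin 4 → ℝ) (hv0 : v 0 ≠ 0)
    (h01 : u 0 * v 1 - u 1 * v 0 = 0) (h02 : u 0 * v 2 - u 2 * v 0 ≠ 0) :
    ∃ c a b : ℝ, a ≠ 0 ∧ u = c • v + ![0, 0, a, b] := by
  refine ⟨u 0 / v 0, u 2 - u 0 / v 0 * v 2, u 3 - u 0 / v 0 * v 3, ?_, ?_⟩
  · contrapose! h02
    field_simp at h02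
    linarith
  · ext i
    fin_cases i
    · simp [hv0]
    · simp
      field_simp
      linarith
    · simp
    · simp

/-- The wall equation only depends on the part of the class not proportional to `v`. -/
theorem fwall_smul_add_vec (v : Fin 4 → ℝ) (c a b s α β : ℝ) :
    fwall (c • v + ![0, 0, a, b]) v s α β = (b - β * a) * rho v α β - a * tau v s α β := by
  simp [fwall, rho, tau]
  ring

/-- Unbounded numerical λ-walls for `v` corresponding to non `v`-equivalent classes can only
meet on `Θ_v ∩ Γ_{v,s}`; in particular if `Θ_v ∩ Γ_{v,s} = ∅` they are disjoint. -/
theorem unbounded_lambda_walls_meet_only_on_theta_inter_gamma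
    (u u' v : Fin 4 → ℝ) (hv0 : v 0 ≠ 0) (s : ℝ) (hs : 0 < s)
    (h01 : u 0 * v 1 - u 1 * v 0 = 0) (h02 : u 0 * v 2 - u 2 * v 0 ≠ 0)
    (h01' : u' 0 * v 1 - u' 1 * v 0 = 0) (h02' : u' 0 * v 2 - u' 2 * v 0 ≠ 0)
    (hne : ¬ ∃ φ ψ : ℝ, ψ ≠ 0 ∧ u' = φ • v + ψ • u) :
    (∀ α β : ℝ, 0 < α → fwall u v s α β = 0 → fwall u' v s α β = 0 →
        rho v α β = 0 ∧ tau v s α β = 0) ∧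
      ({p : ℝ × ℝ | 0 < p.1 ∧ rho v p.1 p.2 = 0} ∩
          {p : ℝ × ℝ | 0 < p.1 ∧ tau v s p.1 p.2 = 0} = ∅ →
        {p : ℝ × ℝ | 0 < p.1 ∧ fwall u v s p.1 p.2 = 0} ∩
          {p : ℝ × ℝ | 0 < p.1 ∧ fwall u' v s p.1 p.2 = 0} = ∅) := by
  obtain ⟨c, a, b, ha, rfl⟩ := exists_eq_smul_add_vec u v hv0 h01 h02
  obtain ⟨c', a', b', ha', rfl⟩ := exists_eq_smul_add_vec u' v hv0 h01' h02'
  have hdet : a * b' - a' * b ≠ 0 := by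
    intro h
    refine hne ⟨c' - a' / a * c, a' / a, div_ne_zero ha' ha, ?_⟩
    have hb : b' = a' / a * b := by
      field_simp
      linarith
    have hvec : ![0, 0, a', b'] = (a' / a) • ![0, 0, a, b] := by
      simp [hb, ha]
    rw [hvec]
    module
  have key : ∀ α β : ℝ, fwall (c • v + ![0, 0, a, b]) v s α β = 0 →
      fwall (c' • v + ![0, 0, a', b']) v s α β = 0 → rho v α β = 0 ∧ tau v s α β = 0 := by
    intro α β h h'
    rw [fwall_smul_add_vec] at h h'
    have hrho : rho v α β = 0 :=
      (mul_eq_zero.mp (by linear_combination a * h' - a' * h :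
        (a * b' - a' * b) * rho v α β = 0)).resolve_left hdet
    refine ⟨hrho, ?_⟩
    simpa [hrho, ha] using h
  refine ⟨fun α β _ => key α β, fun hempty => ?_⟩
  rw [Set.eq_empty_iff_forall_notMem] at hempty ⊢
  rintro p ⟨⟨hp, h⟩, -, h'⟩
  obtain ⟨hrho, htau⟩ := key p.1 p.2 h h'
  exact hempty p ⟨⟨hp, hrho⟩, hp, htau⟩
end
end

section
/- Let u,u',v ∈ ℝ⁴ with δ_{01}(u,v) ≠ 0, (u0,u1,u2) = (u'0,u'1,u'2) and u3 ≠ u'3, and fix s > 0. Then every point (α,β) with α > 0 satisfying f_{u,v,s}(α,β) = 0 and f_{u',v,s}(α,β) = 0 also satisfies ρ_v(α,β) = 0; that is, the numerical λ-walls Υ_{u,v,s} and Υ_{u',v,s} can only intersect on Θ_v. -/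
noncomputable section

/-- Two bounded numerical λ-walls for `v` with the same truncated Chern character
`ch_{≤2}` (but different `ch₃`) can only intersect on `Θ_v`. -/
theorem bounded_lambda_walls_same_ch_le_two_meet_only_on_theta
    (u u' v : Fin 4 → ℝ) (hδ : u 0 * v 1 - u 1 * v 0 ≠ 0)
    (h0 : u 0 = u' 0) (h1 : u 1 = u' 1) (h2 : u 2 = u' 2) (h3 : u 3 ≠ u' 3)
    (s : ℝ) (hs : 0 < s) :
    ∀ α β : ℝ, 0 < α → fwall u v s α β = 0 → fwall u' v s α β = 0 →
      rho v α β = 0 := by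
  intro α β _ hf hf'
  have hdiff : (u 3 - u' 3) * rho v α β = 0 := by
    simp only [fwall, tau, rho, h0, h1, h2] at hf hf' ⊢
    linear_combination hf - hf'
  exact (mul_eq_zero.mp hdiff).resolve_left (sub_ne_zero.mpr h3)
end
end

section
/- Let u,v ∈ ℝ⁴ with v0 ≠ 0, Q^tilt(v) = v1² − 2v0v2 ≥ 0, u not proportional to v (there is no c ∈ ℝ with u = c·v or v = c·u), and fix s ≥ 1/3. Let C be a connected component of the numerical λ-wall Υ_{u,v,s} ⊆ {(α,β) : α > 0}. If C is bounded and contained in the region R⁻_v = {(α,β) : α > 0, ρ_v(α,β) > 0 and β < v1/v0}, then C contains a point (α,β) with τ_{v,s}(α,β) = 0, i.e. C intersects Γ_{v,s} ∩ R⁻_v. -/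
noncomputable section

/-- The numerical λ-wall `Υ_{u,v,s} ⊆ {α > 0}`. -/
def Upsilon (u v : Fin 4 → ℝ) (s : ℝ) : Set (ℝ × ℝ) :=
  {p | 0 < p.1 ∧ fwall u v s p.1 p.2 = 0}

/-- The region `R⁻_v = {α > 0, ρ_v > 0, β < v1/v0}`. -/
def Rminus (v : Fin 4 → ℝ) : Set (ℝ × ℝ) :=
  {p | 0 < p.1 ∧ 0 < rho v p.1 p.2 ∧ p.2 < v 1 / v 0}

open Filter Topology

/-- If `f` and `g` have independent derivatives at a common zero `q`, then the zero set of `f`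
contains an arc from `q` along which `g` becomes positive. -/
lemma exists_preconnected_zero_set_pos {f g : ℝ × ℝ → ℝ} {A B A' B' : ℝ} {q : ℝ × ℝ}
    (hf : HasStrictFDerivAt f
      (A • ContinuousLinearMap.fst ℝ ℝ ℝ + B • ContinuousLinearMap.snd ℝ ℝ ℝ) q)
    (hg : HasStrictFDerivAt g
      (A' • ContinuousLinearMap.fst ℝ ℝ ℝ + B' • ContinuousLinearMap.snd ℝ ℝ ℝ) q)
    (hdet : A * B' - A' * B ≠ 0) (hfq : f q = 0) (hgq : g q = 0)
    {U : Set (ℝ × ℝ)} (hU : IsOpen U) (hq : q ∈ U) :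
    ∃ T : Set (ℝ × ℝ), IsPreconnected T ∧ q ∈ T ∧ T ⊆ U ∧ (∀ x ∈ T, f x = 0) ∧
      ∃ x ∈ T, 0 < g x := by
  set L : ℝ × ℝ →L[ℝ] ℝ × ℝ :=
    (A • ContinuousLinearMap.fst ℝ ℝ ℝ + B • ContinuousLinearMap.snd ℝ ℝ ℝ).prod
    (A' • ContinuousLinearMap.fst ℝ ℝ ℝ + B' • ContinuousLinearMap.snd ℝ ℝ ℝ) with hL
  have hinj : Function.Injective (L : ℝ × ℝ →ₗ[ℝ] ℝ × ℝ) := by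
    rw [← LinearMap.ker_eq_bot, LinearMap.ker_eq_bot']
    rintro ⟨x, y⟩ hxy
    simp only [hL, ContinuousLinearMap.coe_coe, ContinuousLinearMap.prod_apply, add_apply,
      smul_apply, ContinuousLinearMap.coe_fst', ContinuousLinearMap.coe_snd', smul_eq_mul,
      Prod.mk_eq_zero] at hxy
    obtain ⟨h1, h2⟩ := hxy
    have hx : (A * B' - A' * B) * x = 0 := by linear_combination B' * h1 - B * h2
    have hy : (A * B' - A' * B) * y = 0 := by linear_combination A * h2 - A' * h1
    simp only [mul_eq_zero, hdet, false_or] at hx hy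
    simp [hx, hy]
  set e : (ℝ × ℝ) ≃L[ℝ] (ℝ × ℝ) :=
    (LinearEquiv.ofInjectiveEndo _ hinj).toContinuousLinearEquiv with he
  have heL : (e : ℝ × ℝ →L[ℝ] ℝ × ℝ) = L := by
    ext <;> simp [he]
  have hF : HasStrictFDerivAt (fun x => (f x, g x)) (e : ℝ × ℝ →L[ℝ] ℝ × ℝ) q := by
    rw [heL]; exact hf.prodMk hg
  set φ := hF.toOpenPartialHomeomorph _ with hφ
  have hcoe : ∀ x, φ x = (f x, g x) := fun x => by
    simp [hφ, HasStrictFDerivAt.toOpenPartialHomeomorph_coe]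
  have hqs : q ∈ φ.source := hF.mem_toOpenPartialHomeomorph_source
  have hφq : φ q = 0 := by rw [hcoe, hfq, hgq]; rfl
  have h0t : (0 : ℝ × ℝ) ∈ φ.target := hφq ▸ φ.map_source hqs
  have hsymm0 : φ.symm 0 = q := by rw [← hφq]; exact φ.left_inv hqs
  have hW : φ.target ∩ φ.symm ⁻¹' U ∈ 𝓝 (0 : ℝ × ℝ) := by
    apply Filter.inter_mem (φ.open_target.mem_nhds h0t)
    exact (φ.continuousAt_symm h0t).preimage_mem_nhds (by rw [hsymm0]; exact hU.mem_nhds hq)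
  obtain ⟨δ, hδ, hball⟩ := Metric.mem_nhds_iff.1 hW
  set J : Set (ℝ × ℝ) := (fun t : ℝ => ((0 : ℝ), t)) '' Set.Icc 0 (δ / 2) with hJ
  have hJs : J ⊆ φ.target ∩ φ.symm ⁻¹' U := by
    rintro _ ⟨t, ht, rfl⟩
    apply hball
    rw [mem_ball_zero_iff, Prod.norm_mk, norm_zero, Real.norm_eq_abs, abs_of_nonneg ht.1,
      max_eq_right ht.1]
    linarith [ht.2]
  have hval : ∀ t ∈ Set.Icc 0 (δ / 2), f (φ.symm (0, t)) = 0 ∧ g (φ.symm (0, t)) = t := by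
    intro t ht
    have := φ.right_inv (hJs ⟨t, ht, rfl⟩).1
    rw [hcoe] at this
    exact Prod.mk_inj.1 this
  refine ⟨φ.symm '' J, ?_, ?_, ?_, ?_, ?_⟩
  · exact (isPreconnected_Icc.image _ (by fun_prop)).image _
      (φ.continuousOn_symm.mono fun x hx => (hJs hx).1)
  · exact ⟨0, ⟨0, ⟨le_rfl, by positivity⟩, rfl⟩, hsymm0⟩
  · rintro _ ⟨x, hx, rfl⟩
    exact (hJs hx).2
  · rintro _ ⟨_, ⟨t, ht, rfl⟩, rfl⟩
    exact (hval t ht).1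
  · have ht : δ / 2 ∈ Set.Icc 0 (δ / 2) := ⟨by positivity, le_rfl⟩
    refine ⟨_, ⟨_, ⟨_, ht, rfl⟩, rfl⟩, ?_⟩
    rw [(hval _ ht).2]; positivity

lemma hasStrictFDerivAt_rho (v : Fin 4 → ℝ) (q : ℝ × ℝ) :
    HasStrictFDerivAt (fun x : ℝ × ℝ => rho v x.1 x.2)
      ((-(q.1 * v 0)) • ContinuousLinearMap.fst ℝ ℝ ℝ +
        (q.2 * v 0 - v 1) • ContinuousLinearMap.snd ℝ ℝ ℝ) q := by
  have h1 : HasStrictFDerivAt (fun x : ℝ × ℝ => x.1)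
    (ContinuousLinearMap.fst ℝ ℝ ℝ) q := hasStrictFDerivAt_fst
  have h2 : HasStrictFDerivAt (fun x : ℝ × ℝ => x.2)
    (ContinuousLinearMap.snd ℝ ℝ ℝ) q := hasStrictFDerivAt_snd
  have := ((h2.mul_const (v 1)).const_sub (v 2)).add
    ((((h2.mul h2).sub (h1.mul h1)).mul_const (v 0 / 2)))
  refine (this.congr_of_eventuallyEq (Eventually.of_forall fun x => ?_)).congr_fderiv ?_
  · simp [rho]; ring
  · ext <;> simp <;> ring

lemma hasStrictFDerivAt_tau (v : Fin 4 → ℝ) (s : ℝ) (q : ℝ × ℝ) :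
    HasStrictFDerivAt (fun x : ℝ × ℝ => tau v s x.1 x.2)
      ((-(2 * (s + 1 / 6) * q.1 * (v 1 - q.2 * v 0))) • ContinuousLinearMap.fst ℝ ℝ ℝ +
        ((s - 1 / 3) * q.1 ^ 2 * v 0 - rho v q.1 q.2) • ContinuousLinearMap.snd ℝ ℝ ℝ) q := by
  have h1 : HasStrictFDerivAt (fun x : ℝ × ℝ => x.1)
    (ContinuousLinearMap.fst ℝ ℝ ℝ) q := hasStrictFDerivAt_fst
  have h2 : HasStrictFDerivAt (fun x : ℝ × ℝ => x.2)
    (ContinuousLinearMap.snd ℝ ℝ ℝ) q := hasStrictFDerivAt_snd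
  have := ((((h2.mul_const (v 2)).const_sub (v 3)).add
    ((h2.mul h2).mul_const (v 1 / 2))).sub ((h2.mul (h2.mul h2)).mul_const (v 0 / 6))).sub
    ((((h2.mul_const (v 0)).const_sub (v 1)).mul (h1.mul h1)).mul_const (s + 1 / 6))
  refine (this.congr_of_eventuallyEq (Eventually.of_forall fun x => ?_)).congr_fderiv ?_
  · simp [tau]; ring
  · ext <;> simp [rho] <;> ring

lemma continuous_rho (v : Fin 4 → ℝ) : Continuous fun q : ℝ × ℝ => rho v q.1 q.2 := by
  unfold rho; fun_prop

lemma continuous_tau (v : Fin 4 → ℝ) (s : ℝ) :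
    Continuous fun q : ℝ × ℝ => tau v s q.1 q.2 := by
  unfold tau; fun_prop

lemma continuous_fwall (u v : Fin 4 → ℝ) (s : ℝ) :
    Continuous fun q : ℝ × ℝ => fwall u v s q.1 q.2 :=
  ((continuous_tau u s).mul (continuous_rho v)).sub ((continuous_tau v s).mul (continuous_rho u))

lemma rho_smul_add_smul (u v : Fin 4 → ℝ) (c d α β : ℝ) :
    rho (c • u + d • v) α β = c * rho u α β + d * rho v α β := by
  simp only [rho, Pi.add_apply, Pi.smul_apply, smul_eq_mul]; ring

lemma tau_smul_add_smul (u v : Fin 4 → ℝ) (c d s α β : ℝ) :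
    tau (c • u + d • v) s α β = c * tau u s α β + d * tau v s α β := by
  simp only [tau, Pi.add_apply, Pi.smul_apply, smul_eq_mul]; ring

lemma fwall_smul_add_smul (u w v : Fin 4 → ℝ) (c d s α β : ℝ) :
    fwall (c • u + d • w) v s α β = c * fwall u v s α β + d * fwall w v s α β := by
  simp only [fwall, rho_smul_add_smul, tau_smul_add_smul]; ring

lemma fwall_self (v : Fin 4 → ℝ) (s α β : ℝ) : fwall v v s α β = 0 := by
  simp only [fwall]; ring

lemma hasStrictFDerivAt_fwall {w v : Fin 4 → ℝ} {s : ℝ} {q : ℝ × ℝ}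
    (hρ : rho w q.1 q.2 = 0) (hτ : tau w s q.1 q.2 = 0) :
    HasStrictFDerivAt (fun x : ℝ × ℝ => fwall w v s x.1 x.2)
      ((q.1 * (tau v s q.1 q.2 * w 0 - 2 * (s + 1 / 6) * rho v q.1 q.2 * (w 1 - q.2 * w 0))) •
          ContinuousLinearMap.fst ℝ ℝ ℝ +
        ((s - 1 / 3) * q.1 ^ 2 * rho v q.1 q.2 * w 0 + tau v s q.1 q.2 * (w 1 - q.2 * w 0)) •
          ContinuousLinearMap.snd ℝ ℝ ℝ) q := by
  have := ((hasStrictFDerivAt_tau w s q).mul (hasStrictFDerivAt_rho v q)).sub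
    ((hasStrictFDerivAt_tau v s q).mul (hasStrictFDerivAt_rho w q))
  refine HasStrictFDerivAt.congr_fderiv this ?_
  ext <;> simp [hρ, hτ] <;> ring

/-- A vector killed by `ρ` and `τ` at a point is determined by its first two entries. -/
lemma apply_two_three_of_rho_tau_eq_zero {w : Fin 4 → ℝ} {s α β : ℝ} (hρ : rho w α β = 0)
    (hτ : tau w s α β = 0) :
    w 2 = β * w 1 - (β ^ 2 - α ^ 2) * w 0 / 2 ∧
      w 3 = β * w 2 - β ^ 2 / 2 * w 1 + β ^ 3 / 6 * w 0 +
        (s + 1 / 6) * (w 1 - β * w 0) * α ^ 2 := by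
  unfold rho at hρ
  unfold tau at hτ
  constructor <;> linarith

lemma eq_smul_of_rho_tau_eq_zero {w z : Fin 4 → ℝ} {s α β : ℝ}
    (hwρ : rho w α β = 0) (hwτ : tau w s α β = 0) (hzρ : rho z α β = 0) (hzτ : tau z s α β = 0)
    (hw : w ≠ 0) (h : w 0 * z 1 = z 0 * w 1) : ∃ t : ℝ, z = t • w := by
  obtain ⟨w2, w3⟩ := apply_two_three_of_rho_tau_eq_zero hwρ hwτ
  obtain ⟨z2, z3⟩ := apply_two_three_of_rho_tau_eq_zero hzρ hzτ
  obtain ⟨t, h0, h1⟩ : ∃ t, z 0 = t * w 0 ∧ z 1 = t * w 1 := by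
    by_cases hw0 : w 0 = 0
    · by_cases hw1 : w 1 = 0
      · refine absurd ?_ hw
        funext i
        fin_cases i <;> simp [w3, w2, hw0, hw1]
      · refine ⟨z 1 / w 1, ?_, by field_simp⟩
        rw [hw0, zero_mul] at h
        rw [hw0, mul_zero]
        exact (mul_eq_zero.1 h.symm).resolve_right hw1
    · refine ⟨z 0 / w 0, by field_simp, ?_⟩
      field_simp
      linarith
  refine ⟨t, funext fun i => ?_⟩
  have e2 : z 2 = t * w 2 := by rw [z2, w2, h0, h1]; ring
  have e3 : z 3 = t * w 3 := by rw [z3, w3, e2, h0, h1]; ring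
  fin_cases i <;> simp [h0, h1, e2, e3]

/-- Near a point off `Γ_v` and off `ρ_v = 0`, two walls through that point whose vectors are
independent modulo `v` cross transversally. -/
lemma exists_preconnected_wall_pos {u v z : Fin 4 → ℝ} {s : ℝ} (hs : 1 / 3 ≤ s) {q : ℝ × ℝ}
    (hq : 0 < q.1) (hρ : 0 < rho v q.1 q.2) (hτ : tau v s q.1 q.2 ≠ 0)
    (huv : ∀ c : ℝ, u ≠ c • v) (hz : ∀ c d : ℝ, z ≠ c • u + d • v)
    (hu0 : fwall u v s q.1 q.2 = 0) (hz0 : fwall z v s q.1 q.2 = 0) :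
    ∃ T : Set (ℝ × ℝ), IsPreconnected T ∧ q ∈ T ∧ T ⊆ Upsilon u v s ∧
      ∃ x ∈ T, 0 < fwall z v s x.1 x.2 := by
  set R := rho v q.1 q.2 with hR
  set S := tau v s q.1 q.2 with hS
  have key : ∀ w : Fin 4 → ℝ, fwall w v s q.1 q.2 = 0 →
      rho (R • w + (-rho w q.1 q.2) • v) q.1 q.2 = 0 ∧
      tau (R • w + (-rho w q.1 q.2) • v) s q.1 q.2 = 0 ∧
      ∀ α β, fwall (R • w + (-rho w q.1 q.2) • v) v s α β = R * fwall w v s α β := by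
    intro w hw
    unfold fwall at hw
    refine ⟨?_, ?_, fun α β => ?_⟩
    · rw [rho_smul_add_smul]; ring
    · rw [tau_smul_add_smul]; linarith
    · rw [fwall_smul_add_smul, fwall_self]; ring
  obtain ⟨uρ, uτ, uf⟩ := key u hu0
  obtain ⟨zρ, zτ, zf⟩ := key z hz0
  set w := R • u + (-rho u q.1 q.2) • v
  set y := R • z + (-rho z q.1 q.2) • v with hy
  have hw : w ≠ 0 := by
    intro h
    apply huv (rho u q.1 q.2 / R)
    have : R • u = rho u q.1 q.2 • v := by
      rw [← sub_eq_zero, sub_eq_add_neg, ← neg_smul]; exact h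
    rw [div_eq_inv_mul, mul_smul, ← this, smul_smul, inv_mul_cancel₀ hρ.ne', one_smul]
  have hind : w 0 * y 1 - y 0 * w 1 ≠ 0 := by
    intro h
    obtain ⟨t, ht⟩ := eq_smul_of_rho_tau_eq_zero uρ uτ zρ zτ hw (sub_eq_zero.1 h)
    apply hz t (R⁻¹ * (rho z q.1 q.2 - t * rho u q.1 q.2))
    have hz' : R • z = t • w + rho z q.1 q.2 • v := by rw [← ht, hy]; module
    calc z = R⁻¹ • (R • z) := by rw [smul_smul, inv_mul_cancel₀ hρ.ne', one_smul]
      _ = R⁻¹ • (t • (R • u + (-rho u q.1 q.2) • v) + rho z q.1 q.2 • v) := by rw [hz']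
      _ = (R⁻¹ * R) • t • u + (R⁻¹ * (rho z q.1 q.2 - t * rho u q.1 q.2)) • v := by module
      _ = _ := by rw [inv_mul_cancel₀ hρ.ne', one_smul]
  have hpos : 0 < S ^ 2 + 2 * (s + 1 / 6) * (s - 1 / 3) * q.1 ^ 2 * R ^ 2 := by
    have : 0 ≤ s - 1 / 3 := by linarith
    have : 0 ≤ s + 1 / 6 := by linarith
    positivity
  obtain ⟨T, hT, hqT, hTU, hT0, x, hxT, hx⟩ := exists_preconnected_zero_set_pos
    (hasStrictFDerivAt_fwall (v := v) uρ uτ) (hasStrictFDerivAt_fwall (v := v) zρ zτ)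
    (by
      have : q.1 * (w 0 * y 1 - y 0 * w 1) *
          (S ^ 2 + 2 * (s + 1 / 6) * (s - 1 / 3) * q.1 ^ 2 * R ^ 2) ≠ 0 :=
        mul_ne_zero (mul_ne_zero hq.ne' hind) hpos.ne'
      convert this using 1
      ring)
    (by simp only [uf, hu0, mul_zero]) (by simp only [zf, hz0, mul_zero])
    (isOpen_lt continuous_const continuous_fst) hq
  simp only [uf, zf] at hT0 hx
  exact ⟨T, hT, hqT, fun x hx => ⟨hTU hx, (mul_eq_zero.1 (hT0 x hx)).resolve_left hρ.ne'⟩, x, hxT,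
    pos_of_mul_pos_right hx hρ.le⟩

/-- The degree `i` generators of the tilted basis at `b`: the derivatives of `exp b`. -/
def expVec (i : Fin 4) (b : ℝ) : Fin 4 → ℝ :=
  match i with
  | 0 => ![1, b, b ^ 2 / 2, b ^ 3 / 6]
  | 1 => ![0, 1, b, b ^ 2 / 2]
  | 2 => ![0, 0, 1, b]
  | 3 => ![0, 0, 0, 1]

lemma fwall_expVec_zero (v : Fin 4 → ℝ) (s b α β : ℝ) :
    fwall (expVec 0 b) v s α β =
      -(v 1 - b * v 0) * ((b - β) ^ 4 / 12 + (b - β) ^ 2 * α ^ 2 * (s - 1 / 3) / 2 +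
          (s + 1 / 6) * α ^ 4 / 2) -
        rho v 0 b * ((b - β) * ((b - β) ^ 2 / 3 + (s - 1 / 3) * α ^ 2)) +
        tau v s 0 b * (α ^ 2 - (b - β) ^ 2) / 2 := by
  simp only [fwall, rho, tau, expVec, Matrix.cons_val]; ring

lemma fwall_expVec_one (v : Fin 4 → ℝ) (s b α β : ℝ) :
    fwall (expVec 1 b) v s α β =
      v 0 * ((b - β) ^ 4 / 12 + (b - β) ^ 2 * α ^ 2 * (s - 1 / 3) / 2 +
          (s + 1 / 6) * α ^ 4 / 2) -
        rho v 0 b * ((b - β) ^ 2 / 2 + (s + 1 / 6) * α ^ 2) - tau v s 0 b * (b - β) := by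
  simp only [fwall, rho, tau, expVec, Matrix.cons_val]; ring

lemma fwall_expVec_two (v : Fin 4 → ℝ) (s b α β : ℝ) :
    fwall (expVec 2 b) v s α β =
      (v 1 - b * v 0) * ((b - β) ^ 2 / 2 + (s + 1 / 6) * α ^ 2) +
        v 0 * ((b - β) * ((b - β) ^ 2 / 3 + (s - 1 / 3) * α ^ 2)) - tau v s 0 b := by
  simp only [fwall, rho, tau, expVec, Matrix.cons_val]; ring

lemma fwall_expVec_three (v : Fin 4 → ℝ) (s b α β : ℝ) :
    fwall (expVec 3 b) v s α β = rho v α β := by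
  simp only [fwall, rho, tau, expVec, Matrix.cons_val]; ring

lemma rho_expVec_zero (b α β : ℝ) : rho (expVec 0 b) α β = ((b - β) ^ 2 - α ^ 2) / 2 := by
  simp only [rho, expVec, Matrix.cons_val]; ring

lemma tau_expVec_zero (s b α β : ℝ) :
    tau (expVec 0 b) s α β = (b - β) ^ 3 / 6 - (s + 1 / 6) * (b - β) * α ^ 2 := by
  simp only [tau, expVec, Matrix.cons_val]; ring

/-- The expansion of `ρ_v` at `(0, b)`. -/
lemma rho_eq_taylor (v : Fin 4 → ℝ) (b α β : ℝ) :
    rho v α β = rho v 0 b + (b - β) * (v 1 - b * v 0) + ((b - β) ^ 2 - α ^ 2) * v 0 / 2 := by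
  simp only [rho]; ring

/-- The expansion of `τ_v` at `(0, b)` along `α = 0`. -/
lemma tau_zero_eq_taylor (v : Fin 4 → ℝ) (s b β : ℝ) :
    tau v s 0 β = tau v s 0 b + (b - β) * rho v 0 b + (b - β) ^ 2 / 2 * (v 1 - b * v 0) +
      (b - β) ^ 3 / 6 * v 0 := by
  simp only [rho, tau]; ring

/-- A wall through `(0, b)` is, modulo `v`, a combination of the first two tilted generators. -/
lemma exists_fwall_eq_expVec {u v : Fin 4 → ℝ} {s b : ℝ} (hρ : rho v 0 b ≠ 0)
    (hf : fwall u v s 0 b = 0) (hu : ∀ c : ℝ, u ≠ c • v) :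
    ∃ w₀ w₁ : ℝ, (w₀ ≠ 0 ∨ w₁ ≠ 0) ∧ ∀ α β, fwall u v s α β =
      w₀ * fwall (expVec 0 b) v s α β + w₁ * fwall (expVec 1 b) v s α β := by
  set c := rho u 0 b / rho v 0 b with hc
  set w := (1 : ℝ) • u + (-c) • v with hw
  have hcρ : c * rho v 0 b = rho u 0 b := div_mul_cancel₀ _ hρ
  have wρ : rho w 0 b = 0 := by rw [hw, rho_smul_add_smul]; linarith
  have wτ : tau w s 0 b = 0 := by
    rw [hw, tau_smul_add_smul]
    unfold fwall at hf
    apply mul_right_cancel₀ hρ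
    linear_combination hf - tau v s 0 b * hcρ
  obtain ⟨w2, w3⟩ := apply_two_three_of_rho_tau_eq_zero wρ wτ
  have hwe : w = w 0 • expVec 0 b + (w 1 - b * w 0) • expVec 1 b := by
    funext i
    fin_cases i <;> simp [expVec, w3, w2] <;> ring
  refine ⟨w 0, w 1 - b * w 0, ?_, fun α β => ?_⟩
  · by_contra! hcon
    apply hu c
    rw [hcon.2, hcon.1, zero_smul, zero_smul, add_zero] at hwe
    have : u = w + c • v := by rw [hw]; module
    rw [this, hwe, zero_add]
  · rw [← fwall_smul_add_smul, ← hwe, hw, fwall_smul_add_smul, fwall_self]; ring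

lemma exists_ne_combination (x y z : Fin 4 → ℝ) :
    ∃ w : Fin 4 → ℝ, ∀ c d e : ℝ, w ≠ c • x + d • y + e • z := by
  by_contra! hcon
  have hsurj : Function.Surjective (Fintype.linearCombination ℝ ![x, y, z]) := by
    intro w
    obtain ⟨c, d, e, rfl⟩ := hcon w
    exact ⟨![c, d, e], by simp [Fintype.linearCombination_apply, Fin.sum_univ_three]⟩
  have := LinearMap.finrank_range_le (Fintype.linearCombination ℝ ![x, y, z])
  rw [LinearMap.range_eq_top.2 hsurj, finrank_top] at this
  simp at this

lemma eventually_fwall_neg {z v : Fin 4 → ℝ} {s β : ℝ} {C : Set (ℝ × ℝ)}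
    (hz : fwall z v s 0 β < 0) : ∀ᶠ q in 𝓝[C] ((0 : ℝ), β), fwall z v s q.1 q.2 < 0 :=
  nhdsWithin_le_nhds ((continuous_fwall z v s).continuousAt.eventually_lt continuousAt_const hz)

lemma expVec_one_remainder_le {s : ℝ} (hs : 1 / 3 ≤ s) (x α : ℝ) :
    x ^ 4 / 12 + x ^ 2 * α ^ 2 * (s - 1 / 3) / 2 + (s + 1 / 6) * α ^ 4 / 2 ≤
      (x ^ 2 / 2 + (s + 1 / 6) * α ^ 2) ^ 2 := by
  have h1 : 0 ≤ x ^ 2 * α ^ 2 * ((s + 1 / 6) - (s - 1 / 3) / 2) := by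
    have : 0 ≤ (s + 1 / 6) - (s - 1 / 3) / 2 := by linarith
    positivity
  have h2 : 0 ≤ (s - 1 / 3) * (s + 1 / 6) * α ^ 4 := by
    have : 0 ≤ s - 1 / 3 := by linarith
    have : 0 < s + 1 / 6 := by linarith
    positivity
  have h3 : 0 ≤ x ^ 4 := by positivity
  nlinarith

lemma abs_fwall_expVec_zero_sub_le (v : Fin 4 → ℝ) {s : ℝ} (hs : 1 / 3 ≤ s) (b α β : ℝ) :
    |fwall (expVec 0 b) v s α β - tau v s 0 b * (α ^ 2 - (b - β) ^ 2) / 2| ≤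
      (|v 1 - b * v 0| * ((b - β) ^ 2 / 2 + (s + 1 / 6) * α ^ 2) + |rho v 0 b| * |b - β|) *
        ((b - β) ^ 2 / 2 + (s + 1 / 6) * α ^ 2) := by
  rw [fwall_expVec_zero]
  set x := b - β
  set D := v 1 - b * v 0
  set R := rho v 0 b
  set S := x ^ 2 / 2 + (s + 1 / 6) * α ^ 2
  set Q := x ^ 4 / 12 + x ^ 2 * α ^ 2 * (s - 1 / 3) / 2 + (s + 1 / 6) * α ^ 4 / 2
  set P := x ^ 2 / 3 + (s - 1 / 3) * α ^ 2
  have hm : 0 ≤ s - 1 / 3 := by linarith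
  have hk : 0 < s + 1 / 6 := by linarith
  have hQ0 : 0 ≤ Q := by positivity
  have hP0 : 0 ≤ P := by positivity
  have hPS : P ≤ S := by simp only [P, S]; nlinarith [sq_nonneg x, sq_nonneg α]
  have hQS : Q ≤ S ^ 2 := expVec_one_remainder_le hs x α
  have e : -D * Q - R * (x * P) + tau v s 0 b * (α ^ 2 - x ^ 2) / 2 -
      tau v s 0 b * (α ^ 2 - x ^ 2) / 2 = -(D * Q + R * x * P) := by ring
  rw [e, abs_neg]
  calc |D * Q + R * x * P| ≤ |D * Q| + |R * x * P| := abs_add_le _ _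
    _ = |D| * Q + |R| * |x| * P := by
      rw [abs_mul, abs_mul, abs_mul, abs_of_nonneg hQ0, abs_of_nonneg hP0]
    _ ≤ |D| * S ^ 2 + |R| * |x| * S := by gcongr
    _ = _ := by ring

/-- The elementary estimate behind `TauFreeComponent.exists_fwall_expVec_zero_pos`. -/
lemma one_le_of_estimates {k a c r ε x α S Q f T V : ℝ} (hk : 0 < k) (hAb : 0 < |T|)
    (hV : 0 ≤ V) (hεabs : |ε| = 1) (hA : ε * T = |T|) (hS0 : 0 < S)
    (h1 : 1 * S < 1) (h3 : |x| ≤ 1) (hS : S = x ^ 2 / 2 + k * α ^ 2)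
    (hxS : |α ^ 2 - x ^ 2| / 2 ≤ S) (hQ0 : 0 ≤ Q) (bQ : Q ≤ S ^ 2)
    (b0 : |f - T * (α ^ 2 - x ^ 2) / 2| ≤ (V * S + |c| * |x|) * S)
    (hTx : T * x = a * Q - c * S - r * f) (hf : ε * f ≤ 0) :
    1 ≤ ((1 / 2 + k) * ((|a| + |c| + |r| * (|T| + V + |c|)) / |T|) ^ 2 +
      k * (2 * (V + |c| * ((|a| + |c| + |r| * (|T| + V + |c|)) / |T|)) / |T|)) * S := by
  set L := (|a| + |c| + |r| * (|T| + V + |c|)) / |T| with hL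
  set M := 2 * (V + |c| * L) / |T| with hM
  have hfabs : |f| ≤ (|T| + V + |c|) * S := by
    have e : f = (f - T * (α ^ 2 - x ^ 2) / 2) + T * ((α ^ 2 - x ^ 2) / 2) := by ring
    have e2 : |T * ((α ^ 2 - x ^ 2) / 2)| ≤ |T| * S := by
      rw [abs_mul, abs_div, abs_two]; gcongr
    have e3 : (V * S + |c| * |x|) * S ≤ (V * 1 + |c| * 1) * S := by
      gcongr
      linarith
    have e4 := abs_add_le (f - T * (α ^ 2 - x ^ 2) / 2) (T * ((α ^ 2 - x ^ 2) / 2))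
    rw [← e] at e4
    linarith
  have hxL : |x| ≤ L * S := by
    have e1 : |a * Q| ≤ |a| * S := by
      rw [abs_mul, abs_of_nonneg hQ0]
      gcongr
      nlinarith
    have e2 : |c * S| = |c| * S := by rw [abs_mul, abs_of_pos hS0]
    have e3 : |r * f| ≤ |r| * ((|T| + V + |c|) * S) := by rw [abs_mul]; gcongr
    have e4 : |T * x| ≤ |a * Q| + |c * S| + |r * f| := by
      rw [hTx]
      exact (abs_sub _ _).trans (add_le_add_left (abs_sub _ _) _)
    rw [abs_mul] at e4
    rw [hL, div_mul_eq_mul_div, le_div_iff₀ hAb]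
    linarith
  have hL0 : 0 ≤ L := by positivity
  have hM0 : 0 ≤ M := by positivity
  have hαM : α ^ 2 ≤ x ^ 2 + M * S ^ 2 := by
    have e1 : ε * f ≥ |T| * ((α ^ 2 - x ^ 2) / 2) - (V * S + |c| * |x|) * S := by
      have e : ε * f = ε * (f - T * (α ^ 2 - x ^ 2) / 2) + |T| * ((α ^ 2 - x ^ 2) / 2) := by
        rw [← hA]; ring
      have e2 := neg_abs_le (ε * (f - T * (α ^ 2 - x ^ 2) / 2))
      rw [abs_mul, hεabs, one_mul] at e2
      linarith
    have e2 : (V * S + |c| * |x|) * S ≤ (V * S + |c| * (L * S)) * S := by gcongr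
    have e3 : α ^ 2 - x ^ 2 ≤ M * S ^ 2 := by
      rw [hM, div_mul_eq_mul_div, le_div_iff₀ hAb]
      linarith
    linarith
  have hx2 : x ^ 2 ≤ L ^ 2 * S ^ 2 := by
    rw [← sq_abs x, ← mul_pow]
    gcongr
  have hfin : S ≤ ((1 / 2 + k) * L ^ 2 + k * M) * S * S := by
    calc S = x ^ 2 / 2 + k * α ^ 2 := hS
      _ ≤ x ^ 2 / 2 + k * (x ^ 2 + M * S ^ 2) := by gcongr
      _ = (1 / 2 + k) * x ^ 2 + k * M * S ^ 2 := by ring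
      _ ≤ (1 / 2 + k) * (L ^ 2 * S ^ 2) + k * M * S ^ 2 := by gcongr
      _ = _ := by ring
  exact le_of_mul_le_mul_right (by linarith) hS0

/-- A bounded component `C` of a numerical wall, inside `R⁻_v`, on which `τ_v` has the constant
sign `ε`. -/
structure TauFreeComponent (u v : Fin 4 → ℝ) (s ε : ℝ) (C : Set (ℝ × ℝ)) : Prop where
  hs : 1 / 3 ≤ s
  v_ne : v 0 ≠ 0
  u_ne : ∀ c : ℝ, u ≠ c • v
  sign : ε = 1 ∨ ε = -1
  bounded : Bornology.IsBounded C
  nonempty : C.Nonempty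
  alpha_pos : ∀ q ∈ C, 0 < q.1
  wall : ∀ q ∈ C, fwall u v s q.1 q.2 = 0
  rho_pos : ∀ q ∈ C, 0 < rho v q.1 q.2
  beta_lt : ∀ q ∈ C, q.2 < v 1 / v 0
  tau_pos : ∀ q ∈ C, 0 < ε * tau v s q.1 q.2
  maximal : ∀ T : Set (ℝ × ℝ), IsPreconnected T → T ⊆ Upsilon u v s → (T ∩ C).Nonempty → T ⊆ C
  closed : ∀ q ∈ closure C, 0 < q.1 → q ∈ C

namespace TauFreeComponent

variable {u v : Fin 4 → ℝ} {s ε : ℝ} {C : Set (ℝ × ℝ)}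

lemma exists_pos (h : TauFreeComponent u v s ε C) {z : Fin 4 → ℝ}
    (hz : ∀ c d : ℝ, z ≠ c • u + d • v) {q : ℝ × ℝ} (hq : q ∈ C)
    (hzq : fwall z v s q.1 q.2 = 0) : ∃ x ∈ C, 0 < fwall z v s x.1 x.2 := by
  have hτ : tau v s q.1 q.2 ≠ 0 := fun h0 => by simpa [h0] using h.tau_pos q hq
  obtain ⟨T, hT, hqT, hTU, x, hx, hpos⟩ := exists_preconnected_wall_pos h.hs (h.alpha_pos q hq)
    (h.rho_pos q hq) hτ h.u_ne hz (h.wall q hq) hzq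
  exact ⟨x, h.maximal T hT hTU ⟨q, hqT, hq⟩ hx, hpos⟩

lemma fst_nonneg_of_mem_closure (h : TauFreeComponent u v s ε C) {q : ℝ × ℝ}
    (hq : q ∈ closure C) : 0 ≤ q.1 :=
  closure_minimal (fun x hx => (h.alpha_pos x hx).le)
    (isClosed_le continuous_const continuous_fst) hq

/-- Quotients of walls are open maps on `C`, so they have no extrema on `C`: if `f_z` is
nonnegative somewhere on `C` but negative near its boundary, then `z` is degenerate and `C` has no
boundary. -/
lemma degenerate_of_eventually_neg (h : TauFreeComponent u v s ε C) {w z : Fin 4 → ℝ}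
    (hw : ∀ q ∈ C, 0 < fwall w v s q.1 q.2) (hz : ∃ q ∈ C, 0 ≤ fwall z v s q.1 q.2)
    (hneg : ∀ β : ℝ, ((0 : ℝ), β) ∈ closure C →
      ∀ᶠ q in 𝓝[C] ((0 : ℝ), β), fwall z v s q.1 q.2 < 0) :
    (∀ β : ℝ, ((0 : ℝ), β) ∉ closure C) ∧ ∃ c d e : ℝ, z = c • u + d • v + e • w := by
  obtain ⟨q₀, hq₀, hzq₀⟩ := hz
  set K : Set (ℝ × ℝ) := {q | q ∈ C ∧ 0 ≤ fwall z v s q.1 q.2} with hK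
  have hKC : K ⊆ C := fun q hq => hq.1
  have hKclosed : IsClosed K := by
    refine isClosed_of_closure_subset fun q hq => ?_
    have hqC : q ∈ closure C := closure_mono hKC hq
    have hle : 0 ≤ fwall z v s q.1 q.2 :=
      closure_minimal (fun x hx => hx.2) (isClosed_le continuous_const (continuous_fwall z v s)) hq
    rcases (h.fst_nonneg_of_mem_closure hqC).lt_or_eq with hpos | h0
    · exact ⟨h.closed q hqC hpos, hle⟩
    · exfalso
      obtain ⟨q1, q2⟩ := q
      obtain rfl : (0 : ℝ) = q1 := h0
      have h1 := (hneg q2 hqC).filter_mono (nhdsWithin_mono _ hKC)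
      have : (𝓝[K] ((0 : ℝ), q2)).NeBot := mem_closure_iff_nhdsWithin_neBot.1 hq
      obtain ⟨x, hx, hxK⟩ := (h1.and self_mem_nhdsWithin).exists
      exact absurd hx hxK.2.not_gt
  have hKcompact : IsCompact K :=
    Metric.isCompact_of_isClosed_isBounded hKclosed (h.bounded.subset hKC)
  obtain ⟨q₁, hq₁, hmax⟩ := hKcompact.exists_isMaxOn ⟨q₀, hq₀, hzq₀⟩
    (f := fun q => fwall z v s q.1 q.2 / fwall w v s q.1 q.2)
    ((continuous_fwall z v s).continuousOn.div (continuous_fwall w v s).continuousOn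
      fun q hq => (hw q hq.1).ne')
  set N := fwall z v s q₁.1 q₁.2 / fwall w v s q₁.1 q₁.2 with hN
  have hN0 : 0 ≤ N := div_nonneg hq₁.2 (hw _ hq₁.1).le
  have hle : ∀ q ∈ C, fwall z v s q.1 q.2 ≤ N * fwall w v s q.1 q.2 := by
    intro q hq
    by_cases hqz : 0 ≤ fwall z v s q.1 q.2
    · exact (div_le_iff₀ (hw q hq)).1 (hmax ⟨hq, hqz⟩)
    · exact (not_le.1 hqz).le.trans (mul_nonneg hN0 (hw q hq).le)
  have hdeg : ∃ c d : ℝ, (1 : ℝ) • z + (-N) • w = c • u + d • v := by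
    by_contra! hcon
    obtain ⟨x, hx, hpos⟩ := h.exists_pos hcon hq₁.1 (by
      rw [fwall_smul_add_smul, hN, neg_mul, div_mul_cancel₀ _ (hw _ hq₁.1).ne']; ring)
    rw [fwall_smul_add_smul] at hpos
    linarith [hle x hx]
  obtain ⟨c, d, hcd⟩ := hdeg
  have hz' : z = c • u + d • v + N • w := by rw [← hcd]; module
  refine ⟨fun β hβ => ?_, c, d, N, hz'⟩
  have : (𝓝[C] ((0 : ℝ), β)).NeBot := mem_closure_iff_nhdsWithin_neBot.1 hβ
  obtain ⟨x, hx, hxC⟩ := ((hneg β hβ).and self_mem_nhdsWithin).exists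
  have e1 : fwall z v s x.1 x.2 = N * fwall w v s x.1 x.2 := by
    have : z = (1 : ℝ) • (c • u + d • v) + N • w := by rw [one_smul]; exact hz'
    rw [this, fwall_smul_add_smul, fwall_smul_add_smul, fwall_self, h.wall x hxC]; ring
  rw [e1] at hx
  exact absurd hx (mul_nonneg hN0 (hw x hxC).le).not_gt

lemma fwall_eq_zero (h : TauFreeComponent u v s ε C) {β : ℝ} (hβ : ((0 : ℝ), β) ∈ closure C) :
    fwall u v s 0 β = 0 :=
  closure_minimal (t := {q : ℝ × ℝ | fwall u v s q.1 q.2 = 0}) (fun q hq => h.wall q hq)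
    (isClosed_eq (continuous_fwall u v s) continuous_const) hβ

lemma rho_nonneg (h : TauFreeComponent u v s ε C) {β : ℝ} (hβ : ((0 : ℝ), β) ∈ closure C) :
    0 ≤ rho v 0 β :=
  closure_minimal (t := {q : ℝ × ℝ | 0 ≤ rho v q.1 q.2}) (fun q hq => (h.rho_pos q hq).le)
    (isClosed_le continuous_const (continuous_rho v)) hβ

lemma tau_nonneg (h : TauFreeComponent u v s ε C) {β : ℝ} (hβ : ((0 : ℝ), β) ∈ closure C) :
    0 ≤ ε * tau v s 0 β :=
  closure_minimal (t := {q : ℝ × ℝ | 0 ≤ ε * tau v s q.1 q.2}) (fun q hq => (h.tau_pos q hq).le)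
    (isClosed_le continuous_const (continuous_const.mul (continuous_tau v s))) hβ

lemma beta_le (h : TauFreeComponent u v s ε C) {β : ℝ} (hβ : ((0 : ℝ), β) ∈ closure C) :
    β ≤ v 1 / v 0 :=
  closure_minimal (t := {q : ℝ × ℝ | q.2 ≤ v 1 / v 0}) (fun q hq => (h.beta_lt q hq).le)
    (isClosed_le continuous_snd continuous_const) hβ

lemma slope_nonneg (h : TauFreeComponent u v s ε C) {β : ℝ} (hβ : ((0 : ℝ), β) ∈ closure C) :
    0 ≤ v 0 * (v 1 - β * v 0) := by
  have h1 : v 1 = v 1 / v 0 * v 0 := (div_mul_cancel₀ _ h.v_ne).symm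
  have h2 : v 0 * (v 1 - β * v 0) = v 0 ^ 2 * (v 1 / v 0 - β) := by
    linear_combination v 0 * h1
  rw [h2]
  exact mul_nonneg (sq_nonneg _) (sub_nonneg.2 (h.beta_le hβ))

lemma eq_of_rho_eq_zero (h : TauFreeComponent u v s ε C) {β β' : ℝ}
    (hβ : ((0 : ℝ), β) ∈ closure C) (hβ' : ((0 : ℝ), β') ∈ closure C)
    (h0 : rho v 0 β = 0) (h0' : rho v 0 β' = 0) : β = β' := by
  by_contra hne
  have hprod : (β - β') * (v 0 * ((v 1 - β * v 0) + (v 1 - β' * v 0))) = 0 := by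
    simp only [rho] at h0 h0'
    linear_combination 2 * v 0 * (h0' - h0)
  have hsum := (mul_eq_zero.1 hprod).resolve_left (sub_ne_zero.2 hne)
  have h1 := h.slope_nonneg hβ
  have h2 := h.slope_nonneg hβ'
  have h3 : v 0 * v 0 * (β - β') = 0 := by nlinarith
  exact mul_ne_zero (mul_ne_zero h.v_ne h.v_ne) (sub_ne_zero.2 hne) h3

lemma tau_lt (h : TauFreeComponent u v s ε C) {β b : ℝ}
    (hβ : ((0 : ℝ), β) ∈ closure C) (hb : ((0 : ℝ), b) ∈ closure C) (hlt : β < b) :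
    tau v s 0 b < tau v s 0 β := by
  have hx : 0 < b - β := sub_pos.2 hlt
  have h1 := h.rho_nonneg hb
  have h2 := h.rho_nonneg hβ
  rw [rho_eq_taylor v b] at h2
  have h3 := h.slope_nonneg hb
  rw [tau_zero_eq_taylor v s b β]
  set x := b - β
  set D := v 1 - b * v 0
  rcases h.v_ne.lt_or_gt with hv | hv
  · have : 0 < x ^ 3 * (-v 0) := by have := neg_pos.2 hv; positivity
    have : 0 ≤ x * (rho v 0 b + x * D + (x ^ 2 - 0 ^ 2) * v 0 / 2) := mul_nonneg hx.le h2
    have : 0 ≤ x * rho v 0 b := mul_nonneg hx.le h1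
    linarith
  · have hD : 0 ≤ D := nonneg_of_mul_nonneg_right h3 hv
    have : 0 < x * rho v 0 b + x ^ 2 / 2 * D + x ^ 3 / 6 * v 0 := by positivity
    linarith

lemma eq_of_tau_eq_zero (h : TauFreeComponent u v s ε C) {β β' : ℝ}
    (hβ : ((0 : ℝ), β) ∈ closure C) (hβ' : ((0 : ℝ), β') ∈ closure C)
    (h0 : tau v s 0 β = 0) (h0' : tau v s 0 β' = 0) : β = β' := by
  rcases lt_trichotomy β β' with hlt | heq | hlt
  · have := h.tau_lt hβ hβ' hlt; linarith
  · exact heq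
  · have := h.tau_lt hβ' hβ hlt; linarith

/-- A wall cannot close up through a single regular boundary point, nor without any. -/
lemma false_of_boundary_subsingleton (h : TauFreeComponent u v s ε C) (b : ℝ)
    (hb : ∀ β : ℝ, ((0 : ℝ), β) ∈ closure C → β = b ∧ 0 < rho v 0 b) : False := by
  have core : ∀ z : Fin 4 → ℝ, (∀ c d e : ℝ, z ≠ c • u + d • v + e • expVec 3 0) →
      (((0 : ℝ), b) ∈ closure C → fwall z v s 0 b = 0) →
      (∃ q ∈ C, 0 < fwall z v s q.1 q.2) → False := by
    rintro z hz hzb ⟨q, hq, hpos⟩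
    set N := fwall z v s q.1 q.2 / rho v q.1 q.2 with hN
    have hN0 : 0 < N := div_pos hpos (h.rho_pos q hq)
    obtain ⟨-, c, d, e, hcd⟩ := h.degenerate_of_eventually_neg (w := expVec 3 0)
      (z := (1 : ℝ) • z + (-N) • expVec 3 0)
      (fun q hq => by rw [fwall_expVec_three]; exact h.rho_pos q hq)
      ⟨q, hq, by
        rw [fwall_smul_add_smul, fwall_expVec_three, hN, neg_mul,
          div_mul_cancel₀ _ (h.rho_pos q hq).ne']; linarith⟩
      (fun β hβ => eventually_fwall_neg (by
        obtain ⟨rfl, hρ⟩ := hb β hβ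
        rw [fwall_smul_add_smul, fwall_expVec_three, hzb hβ]
        linarith [mul_pos hN0 hρ]))
    apply hz c d (e + N)
    calc z = ((1 : ℝ) • z + (-N) • expVec 3 0) + N • expVec 3 0 := by module
      _ = _ := by rw [hcd]; module
  obtain ⟨w, hw⟩ := exists_ne_combination u v (expVec 3 0)
  set N := fwall w v s 0 b / rho v 0 b with hN
  set z := (1 : ℝ) • w + (-N) • expVec 3 0 with hzdef
  have hz : ∀ c d e : ℝ, z ≠ c • u + d • v + e • expVec 3 0 := by
    intro c d e hcd
    apply hw c d (e + N)
    calc w = z + N • expVec 3 0 := by rw [hzdef]; module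
      _ = _ := by rw [hcd]; module
  have hzb : ((0 : ℝ), b) ∈ closure C → fwall z v s 0 b = 0 := by
    intro hbC
    rw [hzdef, fwall_smul_add_smul, fwall_expVec_three, hN, neg_mul,
      div_mul_cancel₀ _ (hb b hbC).2.ne']
    ring
  obtain ⟨q, hq⟩ := h.nonempty
  rcases lt_trichotomy (fwall z v s q.1 q.2) 0 with hlt | heq | hgt
  · have hneg : ∀ α β, fwall ((-1 : ℝ) • z + (0 : ℝ) • z) v s α β = -fwall z v s α β := by
      intro α β; rw [fwall_smul_add_smul]; ring
    refine core ((-1 : ℝ) • z + (0 : ℝ) • z) (fun c d e hcd => ?_) (fun hbC => ?_) ⟨q, hq, ?_⟩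
    · apply hz (-c) (-d) (-e)
      calc z = -((-1 : ℝ) • z + (0 : ℝ) • z) := by module
        _ = _ := by rw [hcd]; module
    · rw [hneg, hzb hbC, neg_zero]
    · rw [hneg]; linarith
  · refine core z hz hzb (h.exists_pos (fun c d hcd => hz c d 0 ?_) hq heq)
    rw [hcd, zero_smul, add_zero]
  · exact core z hz hzb ⟨q, hq, hgt⟩
lemma fwall_expVec_zero_neg (h : TauFreeComponent u v s ε C) {b β : ℝ}
    (hb : ((0 : ℝ), b) ∈ closure C) (hβ : ((0 : ℝ), β) ∈ closure C)
    (hτ : 0 < ε * tau v s 0 b) (hx : 0 < ε * (b - β)) :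
    ε * fwall (expVec 0 b) v s 0 β < 0 := by
  have hR := h.rho_nonneg hb
  have hRβ := h.rho_nonneg hβ
  have hD := h.slope_nonneg hb
  have hDβ := h.slope_nonneg hβ
  rw [rho_eq_taylor v b] at hRβ
  have e : ε * fwall (expVec 0 b) v s 0 β = -((b - β) ^ 2 * (ε * ((b - β) ^ 2 * (v 1 - b * v 0) +
      4 * ((b - β) * rho v 0 b) + 6 * tau v s 0 b)) / 12) := by
    rw [fwall_expVec_zero]; ring
  have hDe : v 1 - β * v 0 = v 1 - b * v 0 + (b - β) * v 0 := by ring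
  rw [hDe] at hDβ
  rw [e]
  have hx0 : b - β ≠ 0 := fun h0 => by simp [h0] at hx
  set x := b - β
  set D := v 1 - b * v 0
  set R := rho v 0 b
  set T := tau v s 0 b
  have key : 0 < ε * (x ^ 2 * D + 4 * (x * R) + 6 * T) := by
    rcases h.sign with rfl | rfl
    · rw [one_mul] at hx hτ ⊢
      have h1 : 0 ≤ x * R := mul_nonneg hx.le hR
      rcases h.v_ne.lt_or_gt with hv | hv
      · have : 0 < x ^ 3 * (-v 0) := by have := neg_pos.2 hv; positivity
        have : 0 ≤ x * (R + x * D + (x ^ 2 - 0 ^ 2) * v 0 / 2) := mul_nonneg hx.le hRβ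
        linarith
      · have hD0 : 0 ≤ D := nonneg_of_mul_nonneg_right hD hv
        positivity
    · have hy : 0 < -x := by linarith
      have h1 : 0 ≤ -x * R := mul_nonneg hy.le hR
      have h2 : 0 ≤ -x * (R + x * D + (x ^ 2 - 0 ^ 2) * v 0 / 2) := mul_nonneg hy.le hRβ
      rcases h.v_ne.lt_or_gt with hv | hv
      · have : 0 < (-x) ^ 3 * (-v 0) := by have := neg_pos.2 hv; positivity
        linarith
      · have : 0 ≤ x ^ 2 * (D + x * v 0) :=
          mul_nonneg (sq_nonneg x) (nonneg_of_mul_nonneg_right hDβ hv)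
        linarith
  have := sq_pos_of_ne_zero hx0
  have := mul_pos this key
  linarith

lemma eventually_fwall_expVec_zero_neg (h : TauFreeComponent u v s ε C) {b β : ℝ}
    (hb : ((0 : ℝ), b) ∈ closure C) (hβ : ((0 : ℝ), β) ∈ closure C)
    (hτ : 0 < ε * tau v s 0 b) (hne : β ≠ b) :
    ∀ᶠ q in 𝓝[C] ((0 : ℝ), β), ε * fwall (expVec 0 b) v s q.1 q.2 < 0 := by
  have hε : ε ≠ 0 := by rcases h.sign with rfl | rfl <;> norm_num
  have hx0 : b - β ≠ 0 := sub_ne_zero.2 hne.symm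
  rcases (mul_ne_zero hε hx0).lt_or_gt with hx | hx
  · have h1 : ∀ᶠ q in 𝓝[C] ((0 : ℝ), β), ε * tau (expVec 0 b) s q.1 q.2 < 0 := by
      refine nhdsWithin_le_nhds ((continuous_const.mul
        (continuous_tau (expVec 0 b) s)).continuousAt.eventually_lt continuousAt_const ?_)
      change ε * tau (expVec 0 b) s 0 β < 0
      rw [tau_expVec_zero]
      have := mul_pos_of_neg_of_neg hx (neg_lt_zero.2 (sq_pos_of_ne_zero hx0))
      linarith
    have h2 : ∀ᶠ q in 𝓝[C] ((0 : ℝ), β), 0 < rho (expVec 0 b) q.1 q.2 := by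
      refine nhdsWithin_le_nhds (continuousAt_const.eventually_lt
        (continuous_rho (expVec 0 b)).continuousAt ?_)
      rw [rho_expVec_zero]
      have := sq_pos_of_ne_zero hx0
      linarith
    filter_upwards [h1, h2, self_mem_nhdsWithin] with q h1 h2 hq
    have h3 := mul_neg_of_neg_of_pos h1 (h.rho_pos q hq)
    have h4 := mul_pos (h.tau_pos q hq) h2
    rw [fwall]
    linarith
  · exact nhdsWithin_le_nhds ((continuous_const.mul
      (continuous_fwall (expVec 0 b) v s)).continuousAt.eventually_lt continuousAt_const
      (h.fwall_expVec_zero_neg hb hβ hτ hx))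

/-- Near a regular boundary point, `f_u` forces `α` to dominate `|β - b|`. -/
lemma exists_fwall_expVec_zero_pos (h : TauFreeComponent u v s ε C) {b r : ℝ}
    (hb : ((0 : ℝ), b) ∈ closure C) (hτ : 0 < ε * tau v s 0 b)
    (hr : ∀ q ∈ C, fwall (expVec 1 b) v s q.1 q.2 = r * fwall (expVec 0 b) v s q.1 q.2) :
    ∃ q ∈ C, 0 < ε * fwall (expVec 0 b) v s q.1 q.2 := by
  by_contra! hcon
  have hεabs : |ε| = 1 := by rcases h.sign with rfl | rfl <;> simp
  have hA : ε * tau v s 0 b = |tau v s 0 b| := by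
    rw [← abs_of_pos hτ, abs_mul, hεabs, one_mul]
  have hAb : 0 < |tau v s 0 b| := hA ▸ hτ
  have hk : 0 < s + 1 / 6 := by linarith [h.hs]
  set T := tau v s 0 b
  set V := |v 1 - b * v 0|
  set R := |rho v 0 b|
  set L := (|v 0| + R + |r| * (|T| + V + R)) / |T|
  set P := (1 / 2 + (s + 1 / 6)) * L ^ 2 + (s + 1 / 6) * (2 * (V + R * L) / |T|)
  have ev : ∀ P : ℝ, ∀ᶠ q : ℝ × ℝ in 𝓝[C] ((0 : ℝ), b),
      P * ((b - q.2) ^ 2 / 2 + (s + 1 / 6) * q.1 ^ 2) < 1 := fun P => by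
    refine nhdsWithin_le_nhds (ContinuousAt.eventually_lt (Continuous.continuousAt (by fun_prop))
      continuousAt_const ?_)
    norm_num
  have ev' : ∀ᶠ q : ℝ × ℝ in 𝓝[C] ((0 : ℝ), b), |b - q.2| < 1 := by
    refine nhdsWithin_le_nhds (ContinuousAt.eventually_lt (Continuous.continuousAt (by fun_prop))
      continuousAt_const ?_)
    norm_num
  have : (𝓝[C] ((0 : ℝ), b)).NeBot := mem_closure_iff_nhdsWithin_neBot.1 hb
  obtain ⟨⟨α, β⟩, ⟨⟨⟨h1, h2⟩, h3⟩, hq⟩⟩ :=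
    ((((ev 1).and (ev P)).and ev').and self_mem_nhdsWithin).exists
  have hα := h.alpha_pos _ hq
  have hf := hcon _ hq
  have hrq := hr _ hq
  have b0 := abs_fwall_expVec_zero_sub_le v h.hs b α β
  have bQ := expVec_one_remainder_le h.hs (b - β) α
  rw [fwall_expVec_one] at hrq
  dsimp only at h1 h2 h3 hα hf hrq
  set x := b - β
  set f := fwall (expVec 0 b) v s α β
  have hm : 0 ≤ s - 1 / 3 := by linarith [h.hs]
  have hQ0 : 0 ≤ x ^ 4 / 12 + x ^ 2 * α ^ 2 * (s - 1 / 3) / 2 + (s + 1 / 6) * α ^ 4 / 2 := by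
    positivity
  set Q := x ^ 4 / 12 + x ^ 2 * α ^ 2 * (s - 1 / 3) / 2 + (s + 1 / 6) * α ^ 4 / 2
  have hS0 : 0 < x ^ 2 / 2 + (s + 1 / 6) * α ^ 2 := by positivity
  have hxS : |α ^ 2 - x ^ 2| / 2 ≤ x ^ 2 / 2 + (s + 1 / 6) * α ^ 2 := by
    have : |α ^ 2 - x ^ 2| ≤ x ^ 2 + 2 * (s + 1 / 6) * α ^ 2 := by
      rw [abs_le]
      constructor <;> nlinarith [sq_nonneg x, sq_nonneg α]
    linarith
  set S := x ^ 2 / 2 + (s + 1 / 6) * α ^ 2 with hS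
  have key := one_le_of_estimates hk hAb (abs_nonneg _) hεabs hA hS0 h1 h3.le hS hxS
    hQ0 bQ b0 (by linarith : T * x = v 0 * Q - rho v 0 b * S - r * f) hf
  exact h2.not_ge key

lemma false_of_regular_boundary (h : TauFreeComponent u v s ε C) {b : ℝ}
    (hb : ((0 : ℝ), b) ∈ closure C) (hρ : 0 < rho v 0 b) (hτ : 0 < ε * tau v s 0 b) : False := by
  obtain ⟨w₀, w₁, hw, hu⟩ := exists_fwall_eq_expVec hρ.ne' (h.fwall_eq_zero hb) h.u_ne
  have hev := fun β hβ hne => h.eventually_fwall_expVec_zero_neg (β := β) hb hβ hτ hne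
  by_cases hw1 : w₁ = 0
  · have hw0 : w₀ ≠ 0 := hw.resolve_right (not_not.2 hw1)
    refine h.false_of_boundary_subsingleton b fun β hβ => ⟨?_, hρ⟩
    by_contra hne
    have : (𝓝[C] ((0 : ℝ), β)).NeBot := mem_closure_iff_nhdsWithin_neBot.1 hβ
    obtain ⟨q, hq, hqC⟩ := ((hev β hβ hne).and self_mem_nhdsWithin).exists
    have := h.wall q hqC
    rw [hu, hw1, zero_mul, add_zero] at this
    rw [(mul_eq_zero.1 this).resolve_left hw0, mul_zero] at hq
    exact lt_irrefl _ hq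
  · obtain ⟨q, hq, hpos⟩ := h.exists_fwall_expVec_zero_pos (r := -(w₀ / w₁)) hb hτ fun q hq => by
      have := h.wall q hq
      rw [hu] at this
      field_simp
      linarith
    set N := ε * fwall (expVec 0 b) v s q.1 q.2 / rho v q.1 q.2 with hN
    have hN0 : 0 < N := div_pos hpos (h.rho_pos q hq)
    refine (h.degenerate_of_eventually_neg (w := expVec 3 0)
      (z := ε • expVec 0 b + (-N) • expVec 3 0)
      (fun q hq => by rw [fwall_expVec_three]; exact h.rho_pos q hq)
      ⟨q, hq, by
        rw [fwall_smul_add_smul, fwall_expVec_three, hN, neg_mul,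
          div_mul_cancel₀ _ (h.rho_pos q hq).ne']; linarith⟩ fun β hβ => ?_).1 b hb
    by_cases hne : β = b
    · subst hne
      apply eventually_fwall_neg
      rw [fwall_smul_add_smul, fwall_expVec_three, fwall_expVec_zero]
      linarith [mul_pos hN0 hρ]
    · filter_upwards [hev β hβ hne, self_mem_nhdsWithin] with q hq hqC
      rw [fwall_smul_add_smul, fwall_expVec_three]
      linarith [mul_pos hN0 (h.rho_pos q hqC)]

lemma eventually_cusp_neg (h : TauFreeComponent u v s ε C) {p : ℝ}
    (hp : ((0 : ℝ), p) ∈ closure C) (hρ : rho v 0 p = 0) (hτ : tau v s 0 p = 0) (N : ℝ) :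
    ∀ᶠ q in 𝓝[C] ((0 : ℝ), p), N * fwall (expVec 1 p) v s q.1 q.2 +
      (-1) * (v 0 * fwall (expVec 2 p) v s q.1 q.2 + 1 * fwall (expVec 3 p) v s q.1 q.2) < 0 := by
  have hk : 0 < s + 1 / 6 := by linarith [h.hs]
  have hm : 0 ≤ s - 1 / 3 := by linarith [h.hs]
  have hv2 : 0 < v 0 ^ 2 := sq_pos_of_ne_zero h.v_ne
  have small : ∀ {g : ℝ × ℝ → ℝ} {c : ℝ}, Continuous g → g ((0 : ℝ), p) < c →
      ∀ᶠ q in 𝓝[C] ((0 : ℝ), p), g q < c := fun hg hc =>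
    nhdsWithin_le_nhds (hg.continuousAt.eventually_lt continuousAt_const hc)
  have hQ : ∀ x α : ℝ, N * (v 0 * (x ^ 4 / 12 + x ^ 2 * α ^ 2 * (s - 1 / 3) / 2 +
      (s + 1 / 6) * α ^ 4 / 2)) ≤ |N * v 0| * (x ^ 2 / 2 + (s + 1 / 6) * α ^ 2) ^ 2 := by
    intro x α
    rw [← mul_assoc]
    have : 0 ≤ x ^ 4 / 12 + x ^ 2 * α ^ 2 * (s - 1 / 3) / 2 + (s + 1 / 6) * α ^ 4 / 2 := by
      positivity
    exact mul_le_mul (le_abs_self _) (expVec_one_remainder_le h.hs x α) this (abs_nonneg _)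
  simp only [fwall_expVec_one, fwall_expVec_two, fwall_expVec_three, hρ, hτ, zero_mul, sub_zero]
  rcases (h.slope_nonneg hp).lt_or_eq with hD | hD
  · have h1 := small (g := fun q => |N * v 0| * ((p - q.2) ^ 2 / 2 + (s + 1 / 6) * q.1 ^ 2) +
      v 0 ^ 2 * |p - q.2|) (c := v 0 * (v 1 - p * v 0)) (by fun_prop) (by simpa using hD)
    filter_upwards [h1, self_mem_nhdsWithin] with q hq hqC
    have hα := h.alpha_pos q hqC
    have hρq := h.rho_pos q hqC
    have hQq := hQ (p - q.2) q.1
    set x := p - q.2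
    set α := q.1
    have hP : -(v 0 ^ 2 * (x * (x ^ 2 / 3 + (s - 1 / 3) * α ^ 2))) ≤
        v 0 ^ 2 * (|x| * (x ^ 2 / 2 + (s + 1 / 6) * α ^ 2)) := by
      have e1 : 0 ≤ x ^ 2 / 3 + (s - 1 / 3) * α ^ 2 := by positivity
      have e2 : x ^ 2 / 3 + (s - 1 / 3) * α ^ 2 ≤ x ^ 2 / 2 + (s + 1 / 6) * α ^ 2 := by
        nlinarith [sq_nonneg x, sq_nonneg α]
      rw [← mul_neg, ← neg_mul]
      gcongr
      exact neg_le_abs x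
    have hS : 0 < x ^ 2 / 2 + (s + 1 / 6) * α ^ 2 := by positivity
    have := mul_lt_mul_of_pos_right hq hS
    linarith
  · have hV : v 1 - p * v 0 = 0 := (mul_eq_zero.1 hD.symm).resolve_left h.v_ne
    set k := s + 1 / 6 with hkdef
    have h1 := small (g := fun q => |N * v 0| * (2 * (1 / 2 + k) ^ 2) * (p - q.2))
      (c := v 0 ^ 2 / 3) (by fun_prop) (by simp; positivity)
    have h2 := small (g := fun q => |N * v 0| * (2 * k ^ 2 / v 0 ^ 2) * (2 * rho v q.1 q.2))
      (c := 1 / 2) (by have := continuous_rho v; fun_prop) (by simp [hρ])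
    filter_upwards [h1, h2, self_mem_nhdsWithin] with q hq1 hq2 hqC
    have hα := h.alpha_pos q hqC
    have hρq := h.rho_pos q hqC
    have hx : 0 < p - q.2 := by
      have := h.beta_lt q hqC
      have e : v 1 / v 0 = p := by rw [div_eq_iff h.v_ne]; linarith
      linarith
    have hQq := hQ (p - q.2) q.1
    have hρe : 2 * rho v q.1 q.2 = ((p - q.2) ^ 2 - q.1 ^ 2) * v 0 := by
      rw [rho_eq_taylor v p, hρ, hV]; ring
    rw [hV]
    set x := p - q.2
    set α := q.1
    set y := 2 * rho v α q.2 with hy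
    have hy0 : 0 < y := by positivity
    have hα2 : α ^ 2 ≤ x ^ 2 + y / |v 0| := by
      have e : α ^ 2 = x ^ 2 - y / v 0 := by
        rw [hρe, mul_div_cancel_right₀ _ h.v_ne]; ring
      have e2 := neg_abs_le (y / v 0)
      rw [abs_div, abs_of_pos hy0] at e2
      linarith
    have hS2 : (x ^ 2 / 2 + k * α ^ 2) ^ 2 ≤
        2 * (1 / 2 + k) ^ 2 * x ^ 4 + 2 * k ^ 2 / v 0 ^ 2 * y ^ 2 := by
      calc (x ^ 2 / 2 + k * α ^ 2) ^ 2 ≤ (x ^ 2 / 2 + k * (x ^ 2 + y / |v 0|)) ^ 2 := by gcongr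
        _ ≤ 2 * ((1 / 2 + k) * x ^ 2) ^ 2 + 2 * (k * (y / |v 0|)) ^ 2 := by
          linarith [sq_nonneg ((1 / 2 + k) * x ^ 2 - k * (y / |v 0|))]
        _ = _ := by rw [mul_pow k, div_pow, sq_abs]; ring
    have hS3 := mul_le_mul_of_nonneg_left hS2 (abs_nonneg (N * v 0))
    have e1 := mul_lt_mul_of_pos_right hq1 (pow_pos hx 3)
    have e2 := mul_lt_mul_of_pos_right hq2 hy0
    have e3 : 0 ≤ v 0 ^ 2 * (x * ((s - 1 / 3) * α ^ 2)) := by positivity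
    linarith

lemma false_of_cusp_boundary (h : TauFreeComponent u v s ε C) {p : ℝ}
    (hp : ((0 : ℝ), p) ∈ closure C) (hρ : rho v 0 p = 0) (hτ : tau v s 0 p = 0)
    (hE : ∀ β : ℝ, ((0 : ℝ), β) ∈ closure C → β = p) : False := by
  have hf : ∀ q ∈ C, 0 < fwall (v 0 • expVec 1 p + (0 : ℝ) • v) v s q.1 q.2 := by
    intro q hq
    have hα := h.alpha_pos q hq
    have hm : 0 ≤ s - 1 / 3 := by linarith [h.hs]
    have hk : 0 < s + 1 / 6 := by linarith [h.hs]
    have hv2 : 0 < v 0 ^ 2 := sq_pos_of_ne_zero h.v_ne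
    have e : fwall (v 0 • expVec 1 p + (0 : ℝ) • v) v s q.1 q.2 =
        v 0 ^ 2 * ((p - q.2) ^ 4 / 12 + (p - q.2) ^ 2 * q.1 ^ 2 * (s - 1 / 3) / 2 +
          (s + 1 / 6) * q.1 ^ 4 / 2) := by
      rw [fwall_smul_add_smul, fwall_expVec_one, hρ, hτ]; ring
    rw [e]
    positivity
  obtain ⟨q, hq⟩ := h.nonempty
  have hq1 : fwall (expVec 1 p) v s q.1 q.2 ≠ 0 := fun h0 => by
    have := hf q hq
    rw [fwall_smul_add_smul, h0, fwall_self] at this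
    simp at this
  set z := v 0 • expVec 2 p + (1 : ℝ) • expVec 3 p with hz
  set N := fwall z v s q.1 q.2 / fwall (expVec 1 p) v s q.1 q.2 with hN
  refine (h.degenerate_of_eventually_neg (z := N • expVec 1 p + (-1 : ℝ) • z) hf
    ⟨q, hq, by rw [fwall_smul_add_smul, hN, div_mul_cancel₀ _ hq1]; linarith⟩
    fun β hβ => ?_).1 p hp
  obtain rfl := hE β hβ
  simpa only [fwall_smul_add_smul, hz] using h.eventually_cusp_neg hβ hρ hτ N

lemma false_of_rho_eq_zero_boundary (h : TauFreeComponent u v s ε C) {p : ℝ}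
    (hp : ((0 : ℝ), p) ∈ closure C) (hρ : rho v 0 p = 0) (hτ : 0 < ε * tau v s 0 p)
    (hE : ∀ β : ℝ, ((0 : ℝ), β) ∈ closure C → β = p) : False := by
  obtain ⟨q, hq⟩ := h.nonempty
  set N := ε * fwall (expVec 2 p) v s q.1 q.2 / rho v q.1 q.2 with hN
  refine (h.degenerate_of_eventually_neg (w := expVec 3 0)
    (z := ε • expVec 2 p + (-N) • expVec 3 p)
    (fun q hq => by rw [fwall_expVec_three]; exact h.rho_pos q hq)
    ⟨q, hq, by
      rw [fwall_smul_add_smul, fwall_expVec_three, hN, neg_mul,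
        div_mul_cancel₀ _ (h.rho_pos q hq).ne']; linarith⟩ fun β hβ => ?_).1 p hp
  obtain rfl := hE β hβ
  apply eventually_fwall_neg
  rw [fwall_smul_add_smul, fwall_expVec_three, fwall_expVec_two, hρ]
  linarith

/-- A boundary point with `ρ_v = 0` and one with `τ_v = 0` cannot coexist. -/
lemma false_of_rho_eq_zero_of_tau_eq_zero (h : TauFreeComponent u v s ε C) {p b : ℝ}
    (hp : ((0 : ℝ), p) ∈ closure C) (hρp : rho v 0 p = 0) (hτp : tau v s 0 p ≠ 0)
    (hb : ((0 : ℝ), b) ∈ closure C) (hρb : 0 < rho v 0 b) (hτb : tau v s 0 b = 0) : False := by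
  have hpb : p ≠ b := fun e => hρb.ne' (e ▸ hρp)
  obtain ⟨w₀, w₁, hw, hu⟩ := exists_fwall_eq_expVec hρb.ne' (h.fwall_eq_zero hb) h.u_ne
  set R := rho v 0 b with hR
  set V := |v 1 - b * v 0| with hV
  have hle : ∀ q ∈ C,
      |w₁| * (R - |v 0| * ((b - q.2) ^ 2 / 2 + (s + 1 / 6) * q.1 ^ 2)) ≤
      |w₀| * (V * ((b - q.2) ^ 2 / 2 + (s + 1 / 6) * q.1 ^ 2) + R * |b - q.2|) := by
    intro q hq
    have hα := h.alpha_pos q hq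
    have hm : 0 ≤ s - 1 / 3 := by linarith [h.hs]
    have hk : 0 < s + 1 / 6 := by linarith [h.hs]
    have h0 := h.wall q hq
    have b0 := abs_fwall_expVec_zero_sub_le v h.hs b q.1 q.2
    have bQ := expVec_one_remainder_le h.hs (b - q.2) q.1
    rw [hτb, zero_mul, zero_div, sub_zero, ← hR, abs_of_pos hρb] at b0
    rw [hu, fwall_expVec_one, hτb, zero_mul, sub_zero, ← hR] at h0
    set x := b - q.2
    set f := fwall (expVec 0 b) v s q.1 q.2
    have hQ0 : 0 ≤ x ^ 4 / 12 + x ^ 2 * q.1 ^ 2 * (s - 1 / 3) / 2 +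
      (s + 1 / 6) * q.1 ^ 4 / 2 := by positivity
    set Q := x ^ 4 / 12 + x ^ 2 * q.1 ^ 2 * (s - 1 / 3) / 2 + (s + 1 / 6) * q.1 ^ 4 / 2
    have hS0 : 0 < x ^ 2 / 2 + (s + 1 / 6) * q.1 ^ 2 := by positivity
    set S := x ^ 2 / 2 + (s + 1 / 6) * q.1 ^ 2
    have e1 : |w₁| * |v 0 * Q - R * S| = |w₀| * |f| := by
      rw [← abs_mul, ← abs_mul, ← abs_neg]; congr 1; linarith
    have e2 : R * S - |v 0| * S ^ 2 ≤ |v 0 * Q - R * S| := by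
      have e3 : v 0 * Q ≤ |v 0| * S ^ 2 := mul_le_mul (le_abs_self _) bQ hQ0 (abs_nonneg _)
      have e4 := neg_abs_le (v 0 * Q - R * S)
      linarith
    have e3 := mul_le_mul_of_nonneg_left e2 (abs_nonneg w₁)
    have e4 := mul_le_mul_of_nonneg_left b0 (abs_nonneg w₀)
    refine le_of_mul_le_mul_right ?_ hS0
    linarith
  have hle0 : |w₁| * R ≤ 0 := by
    simpa using le_on_closure hle (Continuous.continuousOn (by fun_prop))
      (Continuous.continuousOn (by fun_prop)) hb
  have hw1 : w₁ = 0 := by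
    by_contra hne
    exact absurd (mul_pos (abs_pos.2 hne) hρb) hle0.not_gt
  have hw0 : w₀ ≠ 0 := hw.resolve_right (not_not.2 hw1)
  have h0 := h.fwall_eq_zero hp
  rw [hu, hw1, zero_mul, add_zero] at h0
  have h1 := (mul_eq_zero.1 h0).resolve_left hw0
  rw [fwall, hρp, rho_expVec_zero] at h1
  have h2 : tau v s 0 p * (b - p) ^ 2 = 0 := by linarith
  exact mul_ne_zero hτp (pow_ne_zero 2 (sub_ne_zero.2 hpb.symm)) h2

lemma false (h : TauFreeComponent u v s ε C) : False := by
  have alt : ∀ β : ℝ, ((0 : ℝ), β) ∈ closure C → rho v 0 β ≠ 0 → tau v s 0 β = 0 := by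
    intro β hβ hρ
    by_contra hτ
    refine h.false_of_regular_boundary hβ ((h.rho_nonneg hβ).lt_of_ne' hρ)
      ((h.tau_nonneg hβ).lt_of_ne' (mul_ne_zero ?_ hτ))
    rcases h.sign with rfl | rfl <;> norm_num
  by_cases hex : ∃ p : ℝ, ((0 : ℝ), p) ∈ closure C ∧ rho v 0 p = 0
  · obtain ⟨p, hp, hρ⟩ := hex
    by_cases hτ : tau v s 0 p = 0
    · refine h.false_of_cusp_boundary hp hρ hτ fun β hβ => ?_
      by_cases hρβ : rho v 0 β = 0
      · exact h.eq_of_rho_eq_zero hβ hp hρβ hρ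
      · exact h.eq_of_tau_eq_zero hβ hp (alt β hβ hρβ) hτ
    · have hετ : 0 < ε * tau v s 0 p := by
        refine (h.tau_nonneg hp).lt_of_ne' (mul_ne_zero ?_ hτ)
        rcases h.sign with rfl | rfl <;> norm_num
      refine h.false_of_rho_eq_zero_boundary hp hρ hετ fun β hβ => ?_
      by_cases hρβ : rho v 0 β = 0
      · exact h.eq_of_rho_eq_zero hβ hp hρβ hρ
      · exact (h.false_of_rho_eq_zero_of_tau_eq_zero hp hρ hτ hβ
          ((h.rho_nonneg hβ).lt_of_ne' hρβ) (alt β hβ hρβ)).elim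
  · push Not at hex
    by_cases hE : ∃ b : ℝ, ((0 : ℝ), b) ∈ closure C
    · obtain ⟨b, hb⟩ := hE
      exact h.false_of_boundary_subsingleton b fun β hβ =>
        ⟨h.eq_of_tau_eq_zero hβ hb (alt β hβ (hex β hβ)) (alt b hb (hex b hb)),
          (h.rho_nonneg hb).lt_of_ne' (hex b hb)⟩
    · exact h.false_of_boundary_subsingleton 0 fun β hβ => (hE ⟨β, hβ⟩).elim

end TauFreeComponent

/-- For `s ≥ 1/3`, any bounded connected component of a numerical λ-wall contained in
`R⁻_v` intersects `Γ_{v,s}`. -/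
theorem bounded_component_in_Rminus_meets_Gamma
    (u v : Fin 4 → ℝ) (hv0 : v 0 ≠ 0)
    (hbog : v 1 ^ 2 - 2 * v 0 * v 2 ≥ 0)
    (hprop : ¬ ∃ c : ℝ, u = c • v ∨ v = c • u)
    (s : ℝ) (hs : 1 / 3 ≤ s)
    (p : ℝ × ℝ) (hp : p ∈ Upsilon u v s)
    (hbd : Bornology.IsBounded (connectedComponentIn (Upsilon u v s) p))
    (hsub : connectedComponentIn (Upsilon u v s) p ⊆ Rminus v) :
    ∃ q ∈ connectedComponentIn (Upsilon u v s) p, tau v s q.1 q.2 = 0 := by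
  set C := connectedComponentIn (Upsilon u v s) p with hC
  by_contra! hcon
  have hpC : p ∈ C := mem_connectedComponentIn hp
  have hCpre : IsPreconnected C := isPreconnected_connectedComponentIn
  have hCU : C ⊆ Upsilon u v s := connectedComponentIn_subset _ _
  obtain ⟨ε, hε, hτ⟩ : ∃ ε : ℝ, (ε = 1 ∨ ε = -1) ∧ ∀ q ∈ C, 0 < ε * tau v s q.1 q.2 := by
    have hivt : ∀ a ∈ C, ∀ b ∈ C, tau v s a.1 a.2 ≤ 0 → 0 ≤ tau v s b.1 b.2 → False := by
      intro a ha b hb h1 h2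
      obtain ⟨q, hq, h0⟩ :=
        hCpre.intermediate_value ha hb (continuous_tau v s).continuousOn ⟨h1, h2⟩
      exact hcon q hq h0
    rcases lt_or_ge (tau v s p.1 p.2) 0 with hlt | hge
    · refine ⟨-1, Or.inr rfl, fun q hq => ?_⟩
      have := not_le.1 (hivt p hpC q hq hlt.le)
      linarith
    · refine ⟨1, Or.inl rfl, fun q hq => ?_⟩
      rw [one_mul]
      exact not_le.1 fun h => hivt q hq p hpC h hge
  have hmax : ∀ T : Set (ℝ × ℝ), IsPreconnected T → T ⊆ Upsilon u v s → (T ∩ C).Nonempty →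
      T ⊆ C := by
    rintro T hT hTU ⟨x, hxT, hxC⟩
    rw [hC, connectedComponentIn_eq hxC]
    exact hT.subset_connectedComponentIn hxT hTU
  refine TauFreeComponent.false (u := u) (v := v) (s := s) (ε := ε) (C := C)
    ⟨hs, hv0, fun c hc => hprop ⟨c, Or.inl hc⟩, hε, hbd, ⟨p, hpC⟩, fun q hq => (hCU hq).1,
      fun q hq => (hCU hq).2, fun q hq => (hsub hq).2.1, fun q hq => (hsub hq).2.2, hτ, hmax,
      fun q hq hq0 => ?_⟩
  have hqf : fwall u v s q.1 q.2 = 0 :=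
    closure_minimal (t := {q : ℝ × ℝ | fwall u v s q.1 q.2 = 0}) (fun x hx => (hCU hx).2)
      (isClosed_eq (continuous_fwall u v s) continuous_const) hq
  refine hmax (insert q C) (hCpre.subset_closure (Set.subset_insert _ _)
    (Set.insert_subset hq subset_closure)) (Set.insert_subset ⟨hq0, hqf⟩ hCU)
    ⟨p, Set.mem_insert_of_mem _ hpC, hpC⟩ (Set.mem_insert _ _)
end
end

section
/- Let u,v ∈ ℝ⁴ with v0 ≠ 0, Q^tilt(v) = v1² − 2v0v2 ≥ 0, and u not proportional to v (there is no c ∈ ℝ with u = c·v or v = c·u). Let Σ = {(α,β,s) ∈ ℝ³ : α > 0, s > 0, f_{u,v,s}(α,β) = 0} with the subspace topology, and let C be a nonempty connected component of Σ. (i) If C contains a point whose s-coordinate equals s0, then for every s1 with 0 < s1 ≤ s0, C contains a point whose s-coordinate equals s1. (ii) If C contains a point whose s-coordinate equals some s0 ≥ 1/3, then for every s1 ≥ 1/3, C contains a point whose s-coordinate equals s1. -/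
noncomputable section

/-- The surface wall `Σ_{u,v} = {(α,β,s) : α > 0, s > 0, f_{u,v,s}(α,β) = 0}`,
with points recorded as `(α, β, s)`. -/
def SigmaWall (u v : Fin 4 → ℝ) : Set (ℝ × ℝ × ℝ) :=
  {p | 0 < p.1 ∧ 0 < p.2.2 ∧ fwall u v p.2.2 p.1 p.2.1 = 0}

open Set Topology

/-- The locus `s * A(t,b) + B(t,b) = 0` in the region `t > 0`, `s > 0`, with points `(t, b, s)`. -/
def linearWall (A B : ℝ × ℝ → ℝ) : Set (ℝ × ℝ × ℝ) :=
  {p | 0 < p.1 ∧ 0 < p.2.2 ∧ p.2.2 * A (p.1, p.2.1) + B (p.1, p.2.1) = 0}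

/-- The connected component of `p` in `S` meets the slice of height `s`. -/
def MeetsSlice (S : Set (ℝ × ℝ × ℝ)) (p : ℝ × ℝ × ℝ) (s : ℝ) : Prop :=
  ∃ q ∈ connectedComponentIn S p, q.2.2 = s

lemma MeetsSlice.of_mem {S : Set (ℝ × ℝ × ℝ)} {p q : ℝ × ℝ × ℝ} {s : ℝ}
    (hq : q ∈ connectedComponentIn S p) (h : MeetsSlice S q s) : MeetsSlice S p s := by
  rwa [MeetsSlice, connectedComponentIn_eq hq]

lemma MeetsSlice.map {S T : Set (ℝ × ℝ × ℝ)} {p : ℝ × ℝ × ℝ} {s : ℝ}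
    {φ : ℝ × ℝ × ℝ → ℝ × ℝ × ℝ} (hφ : Continuous φ) (hST : MapsTo φ S T)
    (hs : ∀ x, (φ x).2.2 = x.2.2) (hp : p ∈ S) (h : MeetsSlice S p s) :
    MeetsSlice T (φ p) s := by
  obtain ⟨q, hq, rfl⟩ := h
  refine ⟨φ q, ?_, hs q⟩
  refine (isPreconnected_connectedComponentIn.image φ hφ.continuousOn).subset_connectedComponentIn
    ⟨p, mem_connectedComponentIn hp, rfl⟩ ?_ ⟨q, hq, rfl⟩
  rintro _ ⟨x, hx, rfl⟩
  exact hST (connectedComponentIn_subset _ _ hx)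

/-- The heights attained on a connected component form an interval. -/
lemma MeetsSlice.of_le {S : Set (ℝ × ℝ × ℝ)} {p q : ℝ × ℝ × ℝ} {s : ℝ} (hp : p ∈ S)
    (hq : q ∈ connectedComponentIn S p) (h₁ : p.2.2 ≤ s) (h₂ : s ≤ q.2.2) :
    MeetsSlice S p s := by
  have hc : ContinuousOn (fun x : ℝ × ℝ × ℝ => x.2.2) (connectedComponentIn S p) := by fun_prop
  exact isPreconnected_connectedComponentIn.intermediate_value
    (mem_connectedComponentIn hp) hq hc ⟨h₁, h₂⟩

lemma linearWall_neg (A B : ℝ × ℝ → ℝ) :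
    linearWall (fun x => -A x) (fun x => -B x) = linearWall A B := by
  ext p
  simp only [linearWall, mem_ofPred_eq]
  refine and_congr_right fun _ => and_congr_right fun _ => ⟨fun h => ?_, fun h => ?_⟩ <;> linarith

/-- Over a zero of `A` the wall contains a full vertical ray. -/
lemma meetsSlice_of_coeff_eq_zero {A B : ℝ × ℝ → ℝ} {t b s s₁ : ℝ}
    (hp : (t, b, s) ∈ linearWall A B) (hA : A (t, b) = 0) (hs₁ : 0 < s₁) :
    MeetsSlice (linearWall A B) (t, b, s) s₁ := by
  have hB : B (t, b) = 0 := by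
    have := hp.2.2
    simpa [hA] using this
  have hc : Continuous fun r : ℝ => ((t, b, r) : ℝ × ℝ × ℝ) := by fun_prop
  refine ⟨(t, b, s₁), (isPreconnected_Ioi.image _ hc.continuousOn).subset_connectedComponentIn
    ⟨s, mem_Ioi.2 hp.2.1, rfl⟩ ?_ ⟨s₁, mem_Ioi.2 hs₁, rfl⟩, rfl⟩
  rintro _ ⟨r, hr, rfl⟩
  exact ⟨hp.1, hr, by simp [hA, hB]⟩

/-- Over a preconnected set on which `A ≠ 0` and `-B / A > 0`, the wall contains a connected
graph. -/
lemma mem_component_of_graph {A B : ℝ × ℝ → ℝ} (hA : Continuous A) (hB : Continuous B)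
    {K : Set (ℝ × ℝ)} (hK : IsPreconnected K) (hpos : ∀ x ∈ K, 0 < x.1) (hne : ∀ x ∈ K, A x ≠ 0)
    (hgr : ∀ x ∈ K, 0 < -B x / A x) {t b s : ℝ} (hx : (t, b) ∈ K)
    (hs : s * A (t, b) + B (t, b) = 0) {y : ℝ × ℝ} (hy : y ∈ K) :
    (y.1, y.2, -B y / A y) ∈ connectedComponentIn (linearWall A B) (t, b, s) := by
  have hc : ContinuousOn (fun x : ℝ × ℝ => ((x.1, x.2, -B x / A x) : ℝ × ℝ × ℝ)) K :=
    continuousOn_fst.prodMk (continuousOn_snd.prodMk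
      (hB.neg.continuousOn.div hA.continuousOn hne))
  refine (hK.image _ hc).subset_connectedComponentIn ⟨(t, b), hx, ?_⟩ ?_ ⟨y, hy, rfl⟩
  · have : -B (t, b) / A (t, b) = s := by
      rw [div_eq_iff (hne _ hx)]; linarith
    simp [this]
  · rintro _ ⟨x, hx, rfl⟩
    refine ⟨hpos x hx, hgr x hx, ?_⟩
    have := hne x hx
    simp only [Prod.mk.eta]
    field_simp
    ring

lemma third_le_height {a b : ℝ} (ha : 0 < a) (h : a / 3 + b ≤ 0) : 1 / 3 ≤ -b / a := by
  rw [le_div_iff₀ ha]; linarith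

/-- Within the region of heights at least `1/3`, one can travel along a preconnected set
on which `A > 0`. -/
lemma exists_mem_component_of_third_le {A B : ℝ × ℝ → ℝ} (hA : Continuous A) (hB : Continuous B)
    {K : Set (ℝ × ℝ)} (hK : IsPreconnected K) (hpos : ∀ x ∈ K, 0 < x.1) (hAK : ∀ x ∈ K, 0 < A x)
    (hth : ∀ x ∈ K, A x / 3 + B x ≤ 0) {t b s : ℝ} (hx : (t, b) ∈ K)
    (hs : s * A (t, b) + B (t, b) = 0) {y : ℝ × ℝ} (hy : y ∈ K) :
    ∃ r, 1 / 3 ≤ r ∧ (y.1, y.2, r) ∈ connectedComponentIn (linearWall A B) (t, b, s) :=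
  ⟨-B y / A y, third_le_height (hAK y hy) (hth y hy),
    mem_component_of_graph hA hB hK hpos (fun x hx => (hAK x hx).ne')
      (fun x hx => by have := third_le_height (hAK x hx) (hth x hx); linarith) hx hs hy⟩

/-- Climbing along a preconnected set up to a point where height `s₁` is exceeded. -/
lemma meetsSlice_of_climb {A B : ℝ × ℝ → ℝ} (hA : Continuous A) (hB : Continuous B)
    {K : Set (ℝ × ℝ)} (hK : IsPreconnected K) (hpos : ∀ x ∈ K, 0 < x.1) (hAK : ∀ x ∈ K, 0 < A x)
    (hth : ∀ x ∈ K, A x / 3 + B x ≤ 0) {t b s s₁ : ℝ} (hx : (t, b) ∈ K)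
    (hp : (t, b, s) ∈ linearWall A B) (hs₁ : s ≤ s₁)
    (hy : ∃ y ∈ K, s₁ * A y + B y < 0) : MeetsSlice (linearWall A B) (t, b, s) s₁ := by
  obtain ⟨y, hyK, hy⟩ := hy
  refine MeetsSlice.of_le hp (mem_component_of_graph hA hB hK hpos (fun x hx => (hAK x hx).ne')
      (fun x hx => by have := third_le_height (hAK x hx) (hth x hx); linarith) hx hp.2.2 hyK) hs₁ ?_
  rw [le_div_iff₀ (hAK y hyK)]
  linarith

lemma meetsSlice_of_climb_closure {A B : ℝ × ℝ → ℝ} (hA : Continuous A) (hB : Continuous B)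
    {K : Set (ℝ × ℝ)} (hK : IsPreconnected K) (hpos : ∀ x ∈ K, 0 < x.1) (hAK : ∀ x ∈ K, 0 < A x)
    (hth : ∀ x ∈ K, A x / 3 + B x ≤ 0) {t b s s₁ : ℝ} (hx : (t, b) ∈ K)
    (hp : (t, b, s) ∈ linearWall A B) (hs₁ : s ≤ s₁)
    {c : ℝ × ℝ} (hc : c ∈ closure K) (hcneg : s₁ * A c + B c < 0) :
    MeetsSlice (linearWall A B) (t, b, s) s₁ := by
  refine meetsSlice_of_climb hA hB hK hpos hAK hth hx hp hs₁ ?_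
  have ho : IsOpen {x | s₁ * A x + B x < 0} :=
    isOpen_lt (by fun_prop) continuous_const
  obtain ⟨y, hy, hyK⟩ := mem_closure_iff.1 hc _ ho hcneg
  exact ⟨y, hyK, hy⟩

/-- Following a path in `A ≠ 0` from height at least `s₁`, either height `s₁` is attained in the
component, or the whole path lifts. -/
lemma meetsSlice_or_mem_of_path {A B : ℝ × ℝ → ℝ} (hA : Continuous A) (hB : Continuous B)
    {γ : ℝ → ℝ × ℝ} (hγ : Continuous γ) {l : ℝ} (hl : 0 ≤ l)
    (hpos : ∀ τ ∈ Icc 0 l, 0 < (γ τ).1) (hne : ∀ τ ∈ Icc 0 l, A (γ τ) ≠ 0)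
    {t b s s₁ : ℝ} (h0 : γ 0 = (t, b)) (hp : (t, b, s) ∈ linearWall A B) (hs₁ : 0 < s₁)
    (hle : s₁ ≤ s) :
    MeetsSlice (linearWall A B) (t, b, s) s₁ ∨
      ∃ r, s₁ ≤ r ∧ ((γ l).1, (γ l).2, r) ∈ connectedComponentIn (linearWall A B) (t, b, s) := by
  have hs0 : -B (γ 0) / A (γ 0) = s := by
    rw [div_eq_iff (hne 0 ⟨le_rfl, hl⟩), h0]
    have := hp.2.2
    simp only at this
    linarith
  have hcont : ContinuousOn (fun τ => -B (γ τ) / A (γ τ)) (Icc 0 l) :=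
    (by fun_prop : Continuous fun τ => -B (γ τ)).continuousOn.div
      (by fun_prop : Continuous fun τ => A (γ τ)).continuousOn hne
  have key : ∀ l' ∈ Icc 0 l, (∀ τ ∈ Icc 0 l', s₁ ≤ -B (γ τ) / A (γ τ)) →
      ((γ l').1, (γ l').2, -B (γ l') / A (γ l')) ∈
        connectedComponentIn (linearWall A B) (t, b, s) := by
    intro l' hl' h
    have hsub : ∀ τ ∈ Icc 0 l', τ ∈ Icc 0 l := fun τ hτ => ⟨hτ.1, hτ.2.trans hl'.2⟩
    refine mem_component_of_graph hA hB (isPreconnected_Icc.image γ hγ.continuousOn)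
      (K := γ '' Icc 0 l') ?_ ?_ ?_ ⟨0, ⟨le_rfl, hl'.1⟩, h0⟩ hp.2.2 ⟨l', ⟨hl'.1, le_rfl⟩, rfl⟩
    · rintro _ ⟨τ, hτ, rfl⟩; exact hpos τ (hsub τ hτ)
    · rintro _ ⟨τ, hτ, rfl⟩; exact hne τ (hsub τ hτ)
    · rintro _ ⟨τ, hτ, rfl⟩; exact hs₁.trans_le (h τ hτ)
  by_cases hall : ∀ τ ∈ Icc 0 l, s₁ ≤ -B (γ τ) / A (γ τ)
  · exact Or.inr ⟨_, hall l ⟨hl, le_rfl⟩, key l ⟨hl, le_rfl⟩ hall⟩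
  · left
    push Not at hall
    obtain ⟨τ₁, hτ₁, hlt⟩ := hall
    have hZ : IsCompact (Icc 0 l ∩ (fun τ => -B (γ τ) / A (γ τ)) ⁻¹' Iic s₁) :=
      isCompact_Icc.of_isClosed_subset (hcont.preimage_isClosed_of_isClosed isClosed_Icc
        isClosed_Iic) inter_subset_left
    obtain ⟨τ, hτ, hmin⟩ := hZ.exists_isLeast ⟨τ₁, hτ₁, hlt.le⟩
    have hsub : Icc 0 τ ⊆ Icc 0 l := Icc_subset_Icc_right hτ.1.2
    obtain ⟨σ, hσ, hσe⟩ := intermediate_value_Icc' hτ.1.1 (hcont.mono hsub)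
      (show s₁ ∈ Icc _ _ from ⟨hτ.2, by simpa only [hs0] using hle⟩)
    simp only at hσe
    have hστ : σ = τ := le_antisymm hσ.2 (hmin ⟨hsub hσ, hσe.le⟩)
    subst hστ
    refine ⟨_, key σ hτ.1 fun ρ hρ => ?_, hσe⟩
    by_contra hcon
    push Not at hcon
    have h1 : σ ≤ ρ := hmin ⟨hsub hρ, hcon.le⟩
    have h2 : ρ = σ := le_antisymm hρ.2 h1
    rw [h2, hσe] at hcon
    exact lt_irrefl _ hcon

/-! ### The pencil containing a vector `(0, 0, 1, z)` -/

/-- Coefficient of `s` when the pencil is spanned by `(0,0,1,z)` and `(1,0,0,e)`. -/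
def planeCoeff : ℝ × ℝ → ℝ := fun x => x.2 * x.1

/-- Constant term when the pencil is spanned by `(0,0,1,z)` and `(1,0,0,e)`. -/
def planeConst (z e : ℝ) : ℝ × ℝ → ℝ := fun x =>
  -x.2 * x.1 / 3 + z * x.1 / 2 + x.2 ^ 3 / 3 - z * x.2 ^ 2 / 2 + e

lemma continuous_planeCoeff : Continuous planeCoeff := by unfold planeCoeff; fun_prop

lemma continuous_planeConst (z e : ℝ) : Continuous (planeConst z e) := by
  unfold planeConst; fun_prop

lemma exists_cubic_pos (k c₂ c₁ c₀ : ℝ) (hk : 0 < k) :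
    ∃ x : ℝ, 0 ≤ x ∧ 0 < k * x ^ 3 + c₂ * x ^ 2 + c₁ * x + c₀ := by
  set M := |c₂| + |c₁| + |c₀| with hM
  have h2 := neg_abs_le c₂
  have h1 := neg_abs_le c₁
  have h0 := neg_abs_le c₀
  have hM0 : 0 ≤ M := by positivity
  refine ⟨1 + M / k, by positivity, ?_⟩
  set x := 1 + M / k with hx
  have hkx : k * x = k + M := by rw [hx]; field_simp
  have hx1 : 1 ≤ x := by rw [hx]; have : 0 ≤ M / k := by positivity
                         linarith
  have hxx : 1 ≤ x ^ 2 := by nlinarith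
  have e1 : k * x ^ 3 = (k + M) * x ^ 2 := by rw [← hkx]; ring
  have a2 : -|c₂| * x ^ 2 ≤ c₂ * x ^ 2 := by gcongr
  have a1 : -|c₁| * x ^ 2 ≤ c₁ * x := by
    have : |c₁| * x ≤ |c₁| * x ^ 2 := by gcongr; nlinarith
    nlinarith
  have a0 : -|c₀| * x ^ 2 ≤ c₀ := by
    have : |c₀| * 1 ≤ |c₀| * x ^ 2 := by gcongr
    linarith
  have : 0 < k * x ^ 2 := by positivity
  nlinarith

lemma isPreconnected_vertical {s : Set ℝ} (hs : IsPreconnected s) (b : ℝ) :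
    IsPreconnected (s ×ˢ ({b} : Set ℝ)) := hs.prod isPreconnected_singleton

lemma isPreconnected_horizontal {s : Set ℝ} (hs : IsPreconnected s) (t : ℝ) :
    IsPreconnected (({t} : Set ℝ) ×ˢ s) := isPreconnected_singleton.prod hs

lemma meetsSlice_plane_of_nonneg (z e : ℝ) {t b s s₁ : ℝ} (hb : 0 ≤ b)
    (hp : (t, b, s) ∈ linearWall planeCoeff (planeConst z e)) (hs₁ : 0 < s₁)
    (h : s₁ ≤ s ∨ (1 / 3 ≤ s ∧ 1 / 3 ≤ s₁)) :
    MeetsSlice (linearWall planeCoeff (planeConst z e)) (t, b, s) s₁ := by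
  have hA := continuous_planeCoeff
  have hB := continuous_planeConst z e
  have ht : 0 < t := hp.1
  rcases hb.eq_or_lt with rfl | hb
  · exact meetsSlice_of_coeff_eq_zero hp (by simp [planeCoeff]) hs₁
  have heq : s * (b * t) + (-b * t / 3 + z * t / 2 + b ^ 3 / 3 - z * b ^ 2 / 2 + e) = 0 := hp.2.2
  by_cases hle : s₁ ≤ s
  · obtain ⟨l, hl, hlpos⟩ := exists_cubic_pos (1 / 3) (b - z / 2)
      (s₁ * t - t / 3 + b ^ 2 - z * b)
      (s₁ * (b * t) + (-b * t / 3 + z * t / 2 + b ^ 3 / 3 - z * b ^ 2 / 2 + e)) (by norm_num)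
    rcases meetsSlice_or_mem_of_path hA hB (γ := fun τ => (t, b + τ)) (by fun_prop) hl
      (fun _ _ => ht) (fun τ hτ => by
        have : 0 < b + τ := by linarith [hτ.1]
        simp only [planeCoeff]; positivity) (by simp) hp hs₁ hle with h' | ⟨r, hr, hmem⟩
    · exact h'
    · exfalso
      have := (connectedComponentIn_subset _ _ hmem).2.2
      simp only [planeCoeff, planeConst] at this
      have hpos : 0 ≤ (r - s₁) * ((b + l) * t) :=
        mul_nonneg (by linarith) (by positivity)
      nlinarith
  · replace h := h.resolve_left hle
    push Not at hle
    have hth : z * t / 2 + b ^ 3 / 3 - z * b ^ 2 / 2 + e ≤ 0 := by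
      have : 0 ≤ (s - 1 / 3) * (b * t) := mul_nonneg (by linarith) (by positivity)
      nlinarith
    rcases lt_or_ge 0 z with hz | hz
    · refine meetsSlice_of_climb_closure hA hB (isPreconnected_vertical isPreconnected_Ioc b)
        (K := Ioc 0 t ×ˢ {b}) (c := (0, b)) ?_ ?_ ?_ ⟨⟨ht, le_rfl⟩, rfl⟩ hp hle.le ?_ ?_
      · rintro ⟨t', b'⟩ ⟨h1, rfl⟩; exact h1.1
      · rintro ⟨t', b'⟩ ⟨h1, rfl⟩; exact mul_pos hb h1.1
      · rintro ⟨t', b'⟩ ⟨h1, rfl⟩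
        have : z * t' ≤ z * t := by gcongr; exact h1.2
        simp only [planeCoeff, planeConst]; linarith
      · rw [closure_prod_eq, closure_Ioc ht.ne, closure_singleton]
        exact ⟨⟨le_rfl, ht.le⟩, rfl⟩
      · have : 0 < z * t := by positivity
        simp only [planeCoeff, planeConst]; nlinarith
    · have hmono : ∀ b', 0 ≤ b' → b' ≤ b →
          b' ^ 3 / 3 - z * b' ^ 2 / 2 ≤ b ^ 3 / 3 - z * b ^ 2 / 2 := by
        intro b' h0 h1
        have e3 : b' ^ 3 ≤ b ^ 3 := by gcongr
        have e2 : -z * b' ^ 2 ≤ -z * b ^ 2 := by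
          have : 0 ≤ -z := by linarith
          gcongr
        linarith
      refine meetsSlice_of_climb_closure hA hB (isPreconnected_horizontal isPreconnected_Ioc t)
        (K := {t} ×ˢ Ioc 0 b) (c := (t, 0)) ?_ ?_ ?_ ⟨rfl, ⟨hb, le_rfl⟩⟩ hp hle.le ?_ ?_
      · rintro ⟨t', b'⟩ ⟨rfl, h1⟩; exact ht
      · rintro ⟨t', b'⟩ ⟨rfl, h1⟩; exact mul_pos h1.1 ht
      · rintro ⟨t', b'⟩ ⟨rfl, h1⟩
        have := hmono b' h1.1.le h1.2
        simp only [planeCoeff, planeConst]; linarith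
      · rw [closure_prod_eq, closure_Ioc hb.ne, closure_singleton]
        exact ⟨rfl, ⟨le_rfl, hb.le⟩⟩
      · have : 0 < b ^ 3 := by positivity
        have : 0 ≤ -z * b ^ 2 := mul_nonneg (by linarith) (by positivity)
        simp only [planeCoeff, planeConst]; nlinarith

lemma continuous_reflect : Continuous fun x : ℝ × ℝ × ℝ => ((x.1, -x.2.1, x.2.2) : ℝ × ℝ × ℝ) := by
  fun_prop

lemma meetsSlice_plane (z e : ℝ) {p : ℝ × ℝ × ℝ} {s₁ : ℝ}
    (hp : p ∈ linearWall planeCoeff (planeConst z e)) (hs₁ : 0 < s₁)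
    (h : s₁ ≤ p.2.2 ∨ (1 / 3 ≤ p.2.2 ∧ 1 / 3 ≤ s₁)) :
    MeetsSlice (linearWall planeCoeff (planeConst z e)) p s₁ := by
  obtain ⟨t, b, s⟩ := p
  rcases le_total 0 b with hb | hb
  · exact meetsSlice_plane_of_nonneg z e hb hp hs₁ h
  · have hrefl : ∀ z e : ℝ, MapsTo (fun x : ℝ × ℝ × ℝ => (x.1, -x.2.1, x.2.2))
        (linearWall planeCoeff (planeConst z e))
        (linearWall planeCoeff (planeConst (-z) (-e))) := by
      rintro z e ⟨t, b, s⟩ ⟨h1, h2, h3⟩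
      refine ⟨h1, h2, ?_⟩
      simp only [planeCoeff, planeConst] at h3 ⊢
      linear_combination -h3
    have hp' : (t, -b, s) ∈ linearWall planeCoeff (planeConst (-z) (-e)) := hrefl z e hp
    have h' := (meetsSlice_plane_of_nonneg (-z) (-e) (neg_nonneg.2 hb) hp' hs₁ h).map
      continuous_reflect (hrefl (-z) (-e)) (fun _ => rfl) hp'
    simpa using h'

/-! ### The pencil containing a vector `(0, 1, 0, m + D / 2)` -/

/-- Coefficient of `s` when the pencil is spanned by `(0,1,0,m+D/2)` and `(1,0,D/2,n)`. -/
def discCoeff (D : ℝ) : ℝ × ℝ → ℝ := fun x => x.1 * (x.1 + x.2 ^ 2 - D) / 2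

/-- Constant term when the pencil is spanned by `(0,1,0,m+D/2)` and `(1,0,D/2,n)`. -/
def discConst (D m n : ℝ) : ℝ × ℝ → ℝ := fun x =>
  (x.1 - (m + D)) ^ 2 / 4 - (m ^ 2 / 4 - m * x.2 ^ 2 / 2 - n * x.2 - x.2 ^ 4 / 12)
    - x.1 * (x.1 + x.2 ^ 2 - D) / 6

lemma continuous_discCoeff (D : ℝ) : Continuous (discCoeff D) := by unfold discCoeff; fun_prop

lemma continuous_discConst (D m n : ℝ) : Continuous (discConst D m n) := by
  unfold discConst; fun_prop

/-- Along `b = 0` the wall contains the curve `(s + 1/6) t = m + D/2`, on which every height is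
attained. -/
lemma meetsSlice_disc_axis (D m n : ℝ) {t s s₁ : ℝ}
    (hp : (t, 0, s) ∈ linearWall (discCoeff D) (discConst D m n)) (hs₁ : 0 < s₁) :
    MeetsSlice (linearWall (discCoeff D) (discConst D m n)) (t, 0, s) s₁ := by
  obtain ⟨ht, hs, heq⟩ := id hp
  simp only at ht hs
  by_cases htD : t = D
  · exact meetsSlice_of_coeff_eq_zero hp (by simp [discCoeff, htD]) hs₁
  have hq : (s + 1 / 6) * t = m + D / 2 := by
    have h1 : (t - D) * ((s + 1 / 6) * t - (m + D / 2)) = 0 := by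
      simp only [discCoeff, discConst] at heq
      linear_combination 2 * heq
    linarith [(mul_eq_zero.1 h1).resolve_left (sub_ne_zero.2 htD)]
  have hc : ContinuousOn (fun r : ℝ => (((m + D / 2) / (r + 1 / 6), 0, r) : ℝ × ℝ × ℝ))
      (Ioi 0) := by
    refine ContinuousOn.prodMk (continuousOn_const.div (by fun_prop) ?_) (by fun_prop)
    intro r hr
    have : (0 : ℝ) < r := hr
    positivity
  refine ⟨((m + D / 2) / (s₁ + 1 / 6), 0, s₁), (isPreconnected_Ioi.image _ hc
    ).subset_connectedComponentIn ⟨s, hs, ?_⟩ ?_ ⟨s₁, hs₁, rfl⟩, rfl⟩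
  · have : (m + D / 2) / (s + 1 / 6) = t := by
      rw [← hq]; field_simp
    simp only [this]
  · rintro _ ⟨r, hr, rfl⟩
    have hr' : (0 : ℝ) < r := hr
    have hq0 : 0 < m + D / 2 := by rw [← hq]; positivity
    refine ⟨by positivity, hr, ?_⟩
    have hx : (r + 1 / 6) * ((m + D / 2) / (r + 1 / 6)) = m + D / 2 := by field_simp
    simp only [discCoeff, discConst]
    set x := (m + D / 2) / (r + 1 / 6)
    linear_combination (x - D) / 2 * hx

lemma meetsSlice_disc_of_le (D m n : ℝ) {t b s s₁ : ℝ} (hb : 0 ≤ b)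
    (hp : (t, b, s) ∈ linearWall (discCoeff D) (discConst D m n)) (hs₁ : 0 < s₁) (hle : s₁ ≤ s) :
    MeetsSlice (linearWall (discCoeff D) (discConst D m n)) (t, b, s) s₁ := by
  have hA := continuous_discCoeff D
  have hB := continuous_discConst D m n
  have ht : 0 < t := hp.1
  rcases lt_trichotomy (t + b ^ 2 - D) 0 with hG | hG | hG
  · rcases meetsSlice_or_mem_of_path hA hB (γ := fun τ => (t, b - τ)) (by fun_prop) hb
      (fun _ _ => ht) (fun τ hτ => by
        have h1 : (b - τ) ^ 2 ≤ b ^ 2 := pow_le_pow_left₀ (by linarith [hτ.2]) (by linarith [hτ.1]) 2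
        have : t * (t + (b - τ) ^ 2 - D) < 0 := mul_neg_of_pos_of_neg ht (by linarith)
        simp only [discCoeff]; exact ne_of_lt (by linarith)) (by simp) hp hs₁ hle with
      h' | ⟨r, hr, hmem⟩
    · exact h'
    · simp only [sub_self] at hmem
      exact .of_mem hmem (meetsSlice_disc_axis D m n (connectedComponentIn_subset _ _ hmem) hs₁)
  · exact meetsSlice_of_coeff_eq_zero hp (by simp [discCoeff, hG]) hs₁
  · obtain ⟨l, hl, hlpos⟩ := exists_cubic_pos ((s₁ + 1 / 6) / 2)
      ((s₁ - 1 / 3) * (2 * t + b ^ 2 - D) / 2 + (t - (m + D)) / 2)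
      ((s₁ - 1 / 3) * (t * (t + b ^ 2 - D)) / 2 + (t - (m + D)) ^ 2 / 4
        - (m ^ 2 / 4 - m * b ^ 2 / 2 - n * b - b ^ 4 / 12)) 0 (by positivity)
    rcases meetsSlice_or_mem_of_path hA hB (γ := fun τ => (t + τ, b)) (by fun_prop) hl
      (fun τ hτ => by simp only; linarith [hτ.1]) (fun τ hτ => by
        have : 0 < (t + τ) * (t + τ + b ^ 2 - D) :=
          mul_pos (by linarith [hτ.1]) (by linarith [hτ.1])
        simp only [discCoeff]; positivity) (by simp) hp hs₁ hle with h' | ⟨r, hr, hmem⟩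
    · exact h'
    · exfalso
      have heq := (connectedComponentIn_subset _ _ hmem).2.2
      simp only [discCoeff, discConst] at heq
      have hpos : 0 ≤ l * ((r - s₁) * ((t + l) * (t + l + b ^ 2 - D))) :=
        mul_nonneg hl (mul_nonneg (by linarith) (mul_nonneg (by linarith) (by linarith)))
      refine lt_irrefl (0 : ℝ) ?_
      linear_combination hlpos + hpos / 2 + l * heq

lemma meetsSlice_disc_of_vertex (D m n : ℝ) {b s s₁ : ℝ} (hb : 0 ≤ b)
    (hp : (m + D, b, s) ∈ linearWall (discCoeff D) (discConst D m n)) (hs : 1 / 3 ≤ s)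
    (hle : s ≤ s₁) (hm0 : 0 < m + D) (hmD : D - b ^ 2 < m + D)
    (hg : 0 ≤ m ^ 2 / 4 - m * b ^ 2 / 2 - n * b - b ^ 4 / 12) :
    MeetsSlice (linearWall (discCoeff D) (discConst D m n)) (m + D, b, s) s₁ := by
  have hA := continuous_discCoeff D
  have hB := continuous_discConst D m n
  have hAb : ∀ b', 0 < m + b' ^ 2 → 0 < discCoeff D (m + D, b') := fun b' h => by
    have : 0 < (m + D) * (m + b' ^ 2) := mul_pos hm0 h
    simp only [discCoeff]; nlinarith
  rcases lt_or_ge 0 m with hm | hm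
  · obtain ⟨r, hr, hmem⟩ := exists_mem_component_of_third_le hA hB
      (isPreconnected_horizontal isPreconnected_Icc (m + D)) (K := {m + D} ×ˢ Icc 0 b)
      (by rintro ⟨t', b'⟩ ⟨rfl, h1⟩; exact hm0)
      (by rintro ⟨t', b'⟩ ⟨rfl, h1⟩; exact hAb b' (by positivity))
      (by
        rintro ⟨t', b'⟩ ⟨rfl, h1, h2⟩
        simp only at h1 h2
        have hg' : 0 ≤ m ^ 2 / 4 - m * b' ^ 2 / 2 - n * b' - b' ^ 4 / 12 := by
          rcases hb.eq_or_lt with rfl | hb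
          · obtain rfl : b' = 0 := le_antisymm h2 h1
            simpa using hg
          · have h3 : b' ^ 3 ≤ b ^ 3 := by gcongr
            have e1 : 0 ≤ b * b' * (m * (b - b') / 2 + (b ^ 3 - b' ^ 3) / 12) :=
              mul_nonneg (by positivity) (add_nonneg
                (div_nonneg (mul_nonneg hm.le (by linarith)) (by norm_num)) (by linarith))
            have e2 : 0 ≤ (b - b') * (m ^ 2 / 4) := mul_nonneg (by linarith) (by positivity)
            have e3 := mul_nonneg h1 hg
            refine nonneg_of_mul_nonneg_right (a := b) ?_ hb
            linear_combination e1 + e2 + e3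
        simp only [discCoeff, discConst]; linarith)
      ⟨rfl, hb, le_rfl⟩ hp.2.2 (y := (m + D, 0)) ⟨rfl, le_rfl, hb⟩
    exact .of_mem hmem
      (meetsSlice_disc_axis D m n (connectedComponentIn_subset _ _ hmem) (by linarith))
  have hb0 : 0 < b := by
    rcases hb.eq_or_lt with rfl | hb
    · norm_num at hmD; linarith
    · exact hb
  obtain ⟨r, hr0, rfl⟩ : ∃ r, 0 ≤ r ∧ m = -r ^ 2 :=
    ⟨√(-m), Real.sqrt_nonneg _, by rw [Real.sq_sqrt (by linarith)]; ring⟩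
  have hrb : r < b := lt_of_pow_lt_pow_left₀ 2 hb (by linarith)
  have hident : ∀ b', b * ((-r ^ 2) ^ 2 / 4 - -r ^ 2 * b' ^ 2 / 2 - n * b' - b' ^ 4 / 12) =
      b' * ((-r ^ 2) ^ 2 / 4 - -r ^ 2 * b ^ 2 / 2 - n * b - b ^ 4 / 12) +
      (b - b') * ((b * b' - r ^ 2) ^ 2 / 4 + b * b' * (b - b') ^ 2 / 12) := fun b' => by ring
  have hgb : ∀ b', 0 ≤ b' → b' ≤ b →
      0 ≤ (-r ^ 2) ^ 2 / 4 - -r ^ 2 * b' ^ 2 / 2 - n * b' - b' ^ 4 / 12 := fun b' h1 h2 => by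
    refine nonneg_of_mul_nonneg_right (a := b) ?_ hb0
    rw [hident]
    have : 0 ≤ b - b' := by linarith
    positivity
  have hK : ∀ x ∈ ({-r ^ 2 + D} : Set ℝ) ×ˢ Ioc r b,
      0 < x.1 ∧ 0 < discCoeff D x ∧ discCoeff D x / 3 + discConst D (-r ^ 2) n x ≤ 0 := by
    rintro ⟨t', b'⟩ ⟨rfl, h1, h2⟩
    simp only at h1 h2
    refine ⟨hm0, hAb b' ?_, ?_⟩
    · have : r ^ 2 < b' ^ 2 := pow_lt_pow_left₀ h1 hr0 two_ne_zero
      linarith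
    · have := hgb b' (by linarith) h2
      simp only [discCoeff, discConst]; linarith
  have hKc := isPreconnected_horizontal (isPreconnected_Ioc (a := r) (b := b)) (-r ^ 2 + D)
  rcases hr0.eq_or_lt with rfl | hr
  · have hn : 0 < -n := by
      have : 0 < b ^ 3 := by positivity
      have h2 : 0 ≤ b * (-n - b ^ 3 / 12) := by linear_combination hg
      have := nonneg_of_mul_nonneg_right h2 hb0
      linarith
    obtain ⟨b', hb'1, hb'2⟩ : ∃ b', (s₁ - 1 / 3) * D * b' / 2 + n + b' ^ 3 / 12 < 0 ∧
        b' ∈ Ioc 0 b := by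
      have ho : IsOpen {x : ℝ | (s₁ - 1 / 3) * D * x / 2 + n + x ^ 3 / 12 < 0} :=
        isOpen_lt (by fun_prop) continuous_const
      have hcl : (0 : ℝ) ∈ closure (Ioc 0 b) := by
        rw [closure_Ioc hb0.ne]; exact ⟨le_rfl, hb⟩
      exact mem_closure_iff.1 hcl _ ho (by
        change (s₁ - 1 / 3) * D * 0 / 2 + n + 0 ^ 3 / 12 < 0
        linarith)
    refine meetsSlice_of_climb hA hB hKc (fun x hx => (hK x hx).1) (fun x hx => (hK x hx).2.1)
      (fun x hx => (hK x hx).2.2) ⟨rfl, hrb, le_rfl⟩ hp hle ⟨(_, b'), ⟨rfl, hb'2⟩, ?_⟩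
    have := mul_neg_of_pos_of_neg hb'2.1 hb'1
    simp only [discCoeff, discConst]
    linear_combination this
  · refine meetsSlice_of_climb_closure hA hB hKc (fun x hx => (hK x hx).1)
      (fun x hx => (hK x hx).2.1) (fun x hx => (hK x hx).2.2) ⟨rfl, hrb, le_rfl⟩ hp hle
      (c := (-r ^ 2 + D, r)) ?_ ?_
    · rw [closure_prod_eq, closure_Ioc hrb.ne, closure_singleton]
      exact ⟨rfl, le_rfl, hrb.le⟩
    · have hgr : 0 < (-r ^ 2) ^ 2 / 4 - -r ^ 2 * r ^ 2 / 2 - n * r - r ^ 4 / 12 := by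
        refine pos_of_mul_pos_right (a := b) ?_ hb
        rw [hident]
        have : 0 < b - r := by linarith
        positivity
      simp only [discCoeff, discConst]
      linear_combination hgr

lemma meetsSlice_disc_of_third_le (D m n : ℝ) {t b s s₁ : ℝ} (hb : 0 ≤ b)
    (hp : (t, b, s) ∈ linearWall (discCoeff D) (discConst D m n)) (hs : 1 / 3 ≤ s)
    (hle : s ≤ s₁) :
    MeetsSlice (linearWall (discCoeff D) (discConst D m n)) (t, b, s) s₁ := by
  have hA := continuous_discCoeff D
  have hB := continuous_discConst D m n
  have ht : 0 < t := hp.1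
  have heq := hp.2.2
  simp only [discCoeff, discConst] at heq
  rcases lt_trichotomy (t + b ^ 2 - D) 0 with hG | hG | hG
  · have hE : 0 ≤ (t - (m + D)) ^ 2 / 4
        - (m ^ 2 / 4 - m * b ^ 2 / 2 - n * b - b ^ 4 / 12) := by
      have : 0 ≤ (s - 1 / 3) * (t * -(t + b ^ 2 - D)) :=
        mul_nonneg (by linarith) (mul_nonneg ht.le (by linarith))
      linarith
    rw [← linearWall_neg] at hp ⊢
    rcases le_or_gt (m + D) t with hm | hm
    · have htc : t < D - b ^ 2 := by linarith
      refine meetsSlice_of_climb_closure (A := fun x => -discCoeff D x)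
        (B := fun x => -discConst D m n x) hA.neg hB.neg
        (isPreconnected_vertical isPreconnected_Ico b)
        (K := Ico t (D - b ^ 2) ×ˢ {b}) (c := (D - b ^ 2, b)) ?_ ?_ ?_ ⟨⟨le_rfl, htc⟩, rfl⟩
        hp hle ?_ ?_
      · rintro ⟨t', b'⟩ ⟨h1, rfl⟩; exact ht.trans_le h1.1
      · rintro ⟨t', b'⟩ ⟨h1, rfl⟩
        have : 0 < t' * -(t' + b' ^ 2 - D) :=
          mul_pos (ht.trans_le h1.1) (by have := h1.2; simp only at this; linarith)
        simp only [discCoeff]; linarith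
      · rintro ⟨t', b'⟩ ⟨h1, rfl⟩
        have h2 : t ≤ t' := h1.1
        have : (t - (m + D)) ^ 2 ≤ (t' - (m + D)) ^ 2 :=
          pow_le_pow_left₀ (by linarith) (by linarith) 2
        simp only [discCoeff, discConst]; linarith
      · rw [closure_prod_eq, closure_Ico htc.ne, closure_singleton]
        exact ⟨⟨htc.le, le_rfl⟩, rfl⟩
      · have : (t - (m + D)) ^ 2 < (D - b ^ 2 - (m + D)) ^ 2 :=
          pow_lt_pow_left₀ (by linarith) (by linarith) two_ne_zero
        simp only [discCoeff, discConst]; linarith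
    · refine meetsSlice_of_climb_closure (A := fun x => -discCoeff D x)
        (B := fun x => -discConst D m n x) hA.neg hB.neg
        (isPreconnected_vertical isPreconnected_Ioc b)
        (K := Ioc 0 t ×ˢ {b}) (c := (0, b)) ?_ ?_ ?_ ⟨⟨ht, le_rfl⟩, rfl⟩ hp hle ?_ ?_
      · rintro ⟨t', b'⟩ ⟨h1, rfl⟩; exact h1.1
      · rintro ⟨t', b'⟩ ⟨h1, rfl⟩
        have : 0 < t' * -(t' + b' ^ 2 - D) :=
          mul_pos h1.1 (by have := h1.2; simp only at this; linarith)
        simp only [discCoeff]; linarith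
      · rintro ⟨t', b'⟩ ⟨h1, rfl⟩
        have h2 : t' ≤ t := h1.2
        have : (m + D - t) ^ 2 ≤ (m + D - t') ^ 2 :=
          pow_le_pow_left₀ (by linarith) (by linarith) 2
        simp only [discCoeff, discConst]; linarith
      · rw [closure_prod_eq, closure_Ioc ht.ne, closure_singleton]
        exact ⟨⟨le_rfl, ht.le⟩, rfl⟩
      · have : (m + D - t) ^ 2 < (m + D - 0) ^ 2 :=
          pow_lt_pow_left₀ (by linarith) (by linarith) two_ne_zero
        simp only [discCoeff, discConst]; linarith
  · exact meetsSlice_of_coeff_eq_zero hp (by simp [discCoeff, hG]) (by linarith)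
  have hE : (t - (m + D)) ^ 2 / 4
      - (m ^ 2 / 4 - m * b ^ 2 / 2 - n * b - b ^ 4 / 12) ≤ 0 := by
    have : 0 ≤ (s - 1 / 3) * (t * (t + b ^ 2 - D)) :=
      mul_nonneg (by linarith) (mul_nonneg ht.le (by linarith))
    linarith
  have hAt : ∀ t', 0 < t' → D - b ^ 2 < t' → 0 < discCoeff D (t', b) := fun t' h0 h1 => by
    have : 0 < t' * (t' + b ^ 2 - D) := mul_pos h0 (by linarith)
    simp only [discCoeff]; linarith
  rcases le_or_gt (m + D) (max (D - b ^ 2) 0) with hm | hm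
  · have hte : max (D - b ^ 2) 0 < t := max_lt (by linarith) ht
    have hte0 : 0 ≤ max (D - b ^ 2) 0 := le_max_right _ _
    have hteD : D - b ^ 2 ≤ max (D - b ^ 2) 0 := le_max_left _ _
    have hteA : max (D - b ^ 2) 0 * (max (D - b ^ 2) 0 + b ^ 2 - D) = 0 := by
      rcases max_choice (D - b ^ 2) 0 with h | h <;> rw [h] <;> ring
    set te := max (D - b ^ 2) 0
    refine meetsSlice_of_climb_closure hA hB (isPreconnected_vertical isPreconnected_Ioc b)
      (K := Ioc te t ×ˢ {b}) (c := (te, b)) ?_ ?_ ?_ ⟨⟨hte, le_rfl⟩, rfl⟩ hp hle ?_ ?_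
    · rintro ⟨t', b'⟩ ⟨h1, rfl⟩; exact hte0.trans_lt h1.1
    · rintro ⟨t', b'⟩ ⟨h1, rfl⟩; exact hAt t' (hte0.trans_lt h1.1) (hteD.trans_lt h1.1)
    · rintro ⟨t', b'⟩ ⟨h1, rfl⟩
      have h2 : te < t' := h1.1
      have h3 : t' ≤ t := h1.2
      have : (t' - (m + D)) ^ 2 ≤ (t - (m + D)) ^ 2 :=
        pow_le_pow_left₀ (by linarith) (by linarith) 2
      simp only [discCoeff, discConst]; linarith
    · rw [closure_prod_eq, closure_Ioc hte.ne, closure_singleton]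
      exact ⟨⟨le_rfl, hte.le⟩, rfl⟩
    · have : (te - (m + D)) ^ 2 < (t - (m + D)) ^ 2 :=
        pow_lt_pow_left₀ (by linarith) (by linarith) two_ne_zero
      simp only [discCoeff, discConst, hteA]; linarith
  · obtain ⟨hmD, hm0⟩ := max_lt_iff.1 hm
    obtain ⟨r, hr, hmem⟩ := exists_mem_component_of_third_le hA hB
      (isPreconnected_vertical isPreconnected_uIcc b) (K := uIcc t (m + D) ×ˢ {b})
      (by rintro ⟨t', b'⟩ ⟨h1, rfl⟩; exact (lt_min ht hm0).trans_le h1.1)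
      (by
        rintro ⟨t', b'⟩ ⟨h1, rfl⟩
        exact hAt t' ((lt_min ht hm0).trans_le h1.1)
          ((lt_min (by linarith) hmD).trans_le h1.1))
      (by
        rintro ⟨t', b'⟩ ⟨h1, rfl⟩
        have : (t' - (m + D)) ^ 2 ≤ (t - (m + D)) ^ 2 :=
          by
          have h2 := abs_sub_right_of_mem_uIcc h1
          rw [abs_sub_comm, abs_sub_comm (m + D)] at h2
          exact sq_le_sq.2 h2
        simp only [discCoeff, discConst]; linarith)
      ⟨left_mem_uIcc, rfl⟩ hp.2.2 (y := (m + D, b)) ⟨right_mem_uIcc, rfl⟩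
    simp only at hmem
    have hg : 0 ≤ m ^ 2 / 4 - m * b ^ 2 / 2 - n * b - b ^ 4 / 12 := by
      nlinarith [sq_nonneg (t - (m + D))]
    by_cases hrs : s₁ ≤ r
    · exact .of_le hp hmem hle hrs
    refine .of_mem hmem ?_
    have hp' := connectedComponentIn_subset _ _ hmem
    push Not at hrs
    exact meetsSlice_disc_of_vertex D m n hb hp' hr hrs.le hm0 hmD hg

lemma meetsSlice_disc (D m n : ℝ) {p : ℝ × ℝ × ℝ} {s₁ : ℝ}
    (hp : p ∈ linearWall (discCoeff D) (discConst D m n)) (hs₁ : 0 < s₁)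
    (h : s₁ ≤ p.2.2 ∨ (1 / 3 ≤ p.2.2 ∧ 1 / 3 ≤ s₁)) :
    MeetsSlice (linearWall (discCoeff D) (discConst D m n)) p s₁ := by
  have key : ∀ (n t b s : ℝ), 0 ≤ b → (t, b, s) ∈ linearWall (discCoeff D) (discConst D m n) →
      (s₁ ≤ s ∨ (1 / 3 ≤ s ∧ 1 / 3 ≤ s₁)) →
      MeetsSlice (linearWall (discCoeff D) (discConst D m n)) (t, b, s) s₁ := by
    intro n t b s hb hp h
    by_cases hle : s₁ ≤ s
    · exact meetsSlice_disc_of_le D m n hb hp hs₁ hle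
    · exact meetsSlice_disc_of_third_le D m n hb hp (h.resolve_left hle).1 (not_le.1 hle).le
  obtain ⟨t, b, s⟩ := p
  rcases le_total 0 b with hb | hb
  · exact key n t b s hb hp h
  · have hrefl : ∀ n : ℝ, MapsTo (fun x : ℝ × ℝ × ℝ => (x.1, -x.2.1, x.2.2))
        (linearWall (discCoeff D) (discConst D m n))
        (linearWall (discCoeff D) (discConst D m (-n))) := by
      rintro n ⟨t, b, s⟩ ⟨h1, h2, h3⟩
      refine ⟨h1, h2, ?_⟩
      simp only [discCoeff, discConst] at h3 ⊢
      linear_combination h3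
    have hp' : (t, -b, s) ∈ linearWall (discCoeff D) (discConst D m (-n)) := hrefl n hp
    have h' := (key (-n) t (-b) s (neg_nonneg.2 hb) hp' h).map
      continuous_reflect (hrefl (-n)) (fun _ => rfl) hp'
    simpa using h'

/-! ### Normal forms of the surface wall -/

lemma meetsSlice_sigmaWall_of_normalForm {u v : Fin 4 → ℝ} {A B : ℝ × ℝ → ℝ} {c β₀ : ℝ}
    (hc : c ≠ 0)
    (hf : ∀ s α β, fwall u v s α β = c * (s * A (α ^ 2, β - β₀) + B (α ^ 2, β - β₀)))
    {p : ℝ × ℝ × ℝ} (hp : p ∈ SigmaWall u v) {s₁ : ℝ}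
    (h : ∀ q ∈ linearWall A B, q.2.2 = p.2.2 → MeetsSlice (linearWall A B) q s₁) :
    MeetsSlice (SigmaWall u v) p s₁ := by
  obtain ⟨α, β, s⟩ := p
  obtain ⟨hα, hs, heq⟩ := hp
  simp only at hα hs heq
  have hq : (α ^ 2, β - β₀, s) ∈ linearWall A B := by
    refine ⟨by positivity, hs, ?_⟩
    rw [hf] at heq
    exact (mul_eq_zero.1 heq).resolve_left hc
  have hφ : Continuous fun x : ℝ × ℝ × ℝ => ((√x.1, x.2.1 + β₀, x.2.2) : ℝ × ℝ × ℝ) := by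
    fun_prop
  have hmaps : MapsTo (fun x : ℝ × ℝ × ℝ => (√x.1, x.2.1 + β₀, x.2.2)) (linearWall A B)
      (SigmaWall u v) := by
    rintro ⟨t, b, r⟩ ⟨h1, h2, h3⟩
    refine ⟨Real.sqrt_pos.2 h1, h2, ?_⟩
    simp only at h1 h3
    simp only [hf, Real.sq_sqrt h1.le, add_sub_cancel_right, h3, mul_zero]
  have h' := (h _ hq rfl).map hφ hmaps (fun _ => rfl) hq
  simpa [Real.sqrt_sq hα.le] using h'

lemma meetsSlice_sigmaWall {u v : Fin 4 → ℝ} (hv0 : v 0 ≠ 0) (hprop : ∀ c : ℝ, u ≠ c • v)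
    {p : ℝ × ℝ × ℝ} (hp : p ∈ SigmaWall u v) {s₁ : ℝ} (hs₁ : 0 < s₁)
    (h : s₁ ≤ p.2.2 ∨ (1 / 3 ≤ p.2.2 ∧ 1 / 3 ≤ s₁)) : MeetsSlice (SigmaWall u v) p s₁ := by
  obtain ⟨a, ha⟩ : ∃ a, u 0 = a * v 0 := ⟨u 0 / v 0, by field_simp⟩
  obtain ⟨V1, hV1⟩ : ∃ x, v 1 = x * v 0 := ⟨v 1 / v 0, by field_simp⟩
  obtain ⟨V2, hV2⟩ : ∃ x, v 2 = x * v 0 := ⟨v 2 / v 0, by field_simp⟩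
  obtain ⟨V3, hV3⟩ : ∃ x, v 3 = x * v 0 := ⟨v 3 / v 0, by field_simp⟩
  by_cases hw1 : u 1 - a * v 1 = 0
  · have hu1 : u 1 = a * v 1 := by linarith
    by_cases hw2 : u 2 - a * v 2 = 0
    · have hu2 : u 2 = a * v 2 := by linarith
      have hw3 : u 3 - a * v 3 ≠ 0 := by
        intro hw3
        refine hprop a ?_
        ext i
        fin_cases i
        · simpa using ha
        · simpa using hu1
        · simpa using hu2
        · simp; linarith
      refine meetsSlice_sigmaWall_of_normalForm (A := fun _ => 0)
        (B := fun x => rho v 0 x.2 - x.1 * v 0 / 2) (c := u 3 - a * v 3) (β₀ := 0) hw3 ?_ hp ?_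
      · intro s α β
        simp only [fwall, tau, rho, ha, hu1, hu2]
        ring
      · rintro ⟨t, b, s⟩ hq -
        exact meetsSlice_of_coeff_eq_zero hq rfl hs₁
    · obtain ⟨z, hz⟩ : ∃ z, u 3 - a * v 3 = (V1 + z) * (u 2 - a * v 2) :=
        ⟨(u 3 - a * v 3) / (u 2 - a * v 2) - V1, by field_simp; ring⟩
      have hu3 : u 3 = a * v 3 + (V1 + z) * (u 2 - a * v 2) := by linarith
      obtain ⟨w, hw⟩ : ∃ w, u 2 = a * v 2 + w := ⟨u 2 - a * v 2, by ring⟩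
      have hw0 : w ≠ 0 := by rwa [hw, add_sub_cancel_left] at hw2
      refine meetsSlice_sigmaWall_of_normalForm (A := planeCoeff)
        (B := planeConst z (V3 - V1 * V2 + V1 ^ 3 / 3 - z * (V2 - V1 ^ 2 / 2)))
        (c := -(w * v 0)) (β₀ := V1) (neg_ne_zero.2 (mul_ne_zero hw0 hv0)) ?_ hp ?_
      · intro s α β
        simp only [fwall, tau, rho, planeCoeff, planeConst, hu3, hw, hu1, ha, hV1, hV2, hV3]
        ring
      · rintro q hq hqs
        exact meetsSlice_plane _ _ hq hs₁ (by rwa [hqs])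
  · obtain ⟨w, hw⟩ : ∃ w, u 1 = a * v 1 + w := ⟨u 1 - a * v 1, by ring⟩
    have hw0 : w ≠ 0 := by rwa [hw, add_sub_cancel_left] at hw1
    obtain ⟨β₀, hβ⟩ : ∃ x, u 2 = a * v 2 + x * w := ⟨(u 2 - a * v 2) / w, by field_simp; ring⟩
    obtain ⟨q₀, hq₀⟩ : ∃ x, u 3 = a * v 3 + (x + β₀ ^ 2 / 2) * w :=
      ⟨(u 3 - a * v 3) / w - β₀ ^ 2 / 2, by field_simp; ring⟩
    refine meetsSlice_sigmaWall_of_normalForm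
      (A := discCoeff (2 * (V2 - (V1 - β₀) * β₀ - β₀ ^ 2 / 2)))
      (B := discConst (2 * (V2 - (V1 - β₀) * β₀ - β₀ ^ 2 / 2))
        (q₀ - (V2 - (V1 - β₀) * β₀ - β₀ ^ 2 / 2))
        (V3 - (V1 - β₀) * (q₀ + β₀ ^ 2 / 2)
          - β₀ * (V2 - (V1 - β₀) * β₀) + β₀ ^ 3 / 3))
      (c := w * v 0) (β₀ := β₀) (mul_ne_zero hw0 hv0) ?_ hp ?_
    · intro s α β
      simp only [fwall, tau, rho, discCoeff, discConst, hq₀, hβ, hw, ha, hV1, hV2, hV3]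
      ring
    · rintro q hq hqs
      exact meetsSlice_disc _ _ _ hq hs₁ (by rwa [hqs])

/-- If a connected component of the surface wall `Σ_{u,v}` meets the slice `s = s0`,
then (i) it meets every slice `s = s1` with `0 < s1 ≤ s0`, and (ii) if `s0 ≥ 1/3`,
it meets every slice `s = s1` with `s1 ≥ 1/3`. -/
theorem surface_wall_component_slices
    (u v : Fin 4 → ℝ) (hv0 : v 0 ≠ 0)
    (hbog : v 1 ^ 2 - 2 * v 0 * v 2 ≥ 0)
    (hprop : ¬ ∃ c : ℝ, u = c • v ∨ v = c • u)
    (p : ℝ × ℝ × ℝ) (hp : p ∈ SigmaWall u v) :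
    (∀ s0 : ℝ, (∃ q ∈ connectedComponentIn (SigmaWall u v) p, q.2.2 = s0) →
      ∀ s1 : ℝ, 0 < s1 → s1 ≤ s0 →
        ∃ q ∈ connectedComponentIn (SigmaWall u v) p, q.2.2 = s1) ∧
    (∀ s0 : ℝ, 1 / 3 ≤ s0 →
      (∃ q ∈ connectedComponentIn (SigmaWall u v) p, q.2.2 = s0) →
      ∀ s1 : ℝ, 1 / 3 ≤ s1 →
        ∃ q ∈ connectedComponentIn (SigmaWall u v) p, q.2.2 = s1) := by
  have hv : ∀ c : ℝ, u ≠ c • v := fun c hc => hprop ⟨c, Or.inl hc⟩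
  refine ⟨?_, ?_⟩
  · rintro s0 ⟨q, hq, rfl⟩ s1 hs1 hle
    exact MeetsSlice.of_mem hq
      (meetsSlice_sigmaWall hv0 hv (connectedComponentIn_subset _ _ hq) hs1 (Or.inl hle))
  · rintro s0 hs0 ⟨q, hq, rfl⟩ s1 hs1
    exact MeetsSlice.of_mem hq (meetsSlice_sigmaWall hv0 hv
      (connectedComponentIn_subset _ _ hq) (by linarith) (Or.inr ⟨hs0, hs1⟩))
end
end

section
/- Let v ∈ ℝ⁴ with v0 > 0 and Q^tilt(v) = v1² − 2v0v2 ≥ 0, let x,y ∈ ℝ and set u = (0,1,x,y). Then the following are equivalent: (1) the numerical ν-wall Ξ_{u,v} is empty, i.e. there is no (α,β) with α > 0 and t_{u,v}(α,β) = 0; (2) for every κ ∈ ℝ, the vector κv + u satisfies the Bogomolov inequality Q^tilt(κv+u) ≥ 0; (3) (x − v1/v0)² ≤ (v1/v0)² − 2v2/v0; (4) δ_{02}(u,v)² ≤ 2·δ_{01}(u,v)·δ_{12}(u,v). -/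
noncomputable section

/-- `t_{u,v}(α,β) = ρ_u(α,β)·ch₁^β(v) − ρ_v(α,β)·ch₁^β(u)`. -/
def twall (u v : Fin 4 → ℝ) (α β : ℝ) : ℝ :=
  rho u α β * (v 1 - β * v 0) - rho v α β * (u 1 - β * u 0)

/-- For `v` with `v0 > 0` satisfying the Bogomolov inequality and `u = (0,1,x,y)`, four
characterizations of the emptiness of the numerical ν-wall `Ξ_{u,v}`. -/
theorem nu_wall_empty_tfae (v : Fin 4 → ℝ) (hv0 : 0 < v 0)
    (hbog : v 1 ^ 2 - 2 * v 0 * v 2 ≥ 0) (x y : ℝ)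
    (u : Fin 4 → ℝ) (hu : u = ![0, 1, x, y]) :
    List.TFAE
      [ ¬ ∃ α β : ℝ, 0 < α ∧ twall u v α β = 0,
        ∀ κ : ℝ, ((κ • v + u) 1) ^ 2 - 2 * ((κ • v + u) 0) * ((κ • v + u) 2) ≥ 0,
        (x - v 1 / v 0) ^ 2 ≤ (v 1 / v 0) ^ 2 - 2 * v 2 / v 0,
        (u 0 * v 2 - u 2 * v 0) ^ 2 ≤
          2 * (u 0 * v 1 - u 1 * v 0) * (u 1 * v 2 - u 2 * v 1) ] := by
  subst hu
  set P : ℝ := v 0 * x ^ 2 - 2 * x * v 1 + 2 * v 2 with hP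
  have htwall (α β : ℝ) : twall ![0, 1, x, y] v α β =
      (v 0 * ((β - x) ^ 2 + α ^ 2) - P) / 2 := by
    simp [twall, rho, hP]
    ring
  have hquad (κ : ℝ) : ((κ • v + ![0, 1, x, y]) 1) ^ 2
      - 2 * ((κ • v + ![0, 1, x, y]) 0) * ((κ • v + ![0, 1, x, y]) 2) =
      (κ * (v 1 - v 0 * x) + 1) ^ 2 - κ ^ 2 * (v 0 * P) := by
    simp [hP]
    ring
  have hwall : (¬ ∃ α β : ℝ, 0 < α ∧ twall ![0, 1, x, y] v α β = 0) ↔ P ≤ 0 := by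
    constructor
    · contrapose!
      intro h
      refine ⟨√(P / v 0), x, Real.sqrt_pos.2 (div_pos h hv0), ?_⟩
      rw [htwall, Real.sq_sqrt (div_pos h hv0).le]
      field_simp
      ring
    · rintro h ⟨α, β, hα, ht⟩
      rw [htwall] at ht
      have : 0 < v 0 * ((β - x) ^ 2 + α ^ 2) := by positivity
      linarith
  have hbogomolov : (∀ κ : ℝ, ((κ • v + ![0, 1, x, y]) 1) ^ 2
      - 2 * ((κ • v + ![0, 1, x, y]) 0) * ((κ • v + ![0, 1, x, y]) 2) ≥ 0) ↔ P ≤ 0 := by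
    simp only [hquad]
    constructor
    · intro h
      have hd := discrim_le_zero (a := (v 1 - v 0 * x) ^ 2 - v 0 * P)
        (b := 2 * (v 1 - v 0 * x)) (c := 1) fun κ => by linarith [h κ]
      rw [discrim] at hd
      exact nonpos_of_mul_nonpos_right (by linarith : v 0 * P ≤ 0) hv0
    · intro h κ
      have := mul_nonneg (sq_nonneg κ) (mul_nonneg hv0.le (neg_nonneg.2 h))
      nlinarith [sq_nonneg (κ * (v 1 - v 0 * x) + 1)]
  have hcircle : (x - v 1 / v 0) ^ 2 ≤ (v 1 / v 0) ^ 2 - 2 * v 2 / v 0 ↔ P ≤ 0 := by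
    have : (x - v 1 / v 0) ^ 2 - ((v 1 / v 0) ^ 2 - 2 * v 2 / v 0) = P / v 0 := by
      rw [hP]
      field_simp
      ring
    rw [← sub_nonpos, this, div_le_iff₀ hv0, zero_mul]
  have hminors : ((![0, 1, x, y] : Fin 4 → ℝ) 0 * v 2 - (![0, 1, x, y] : Fin 4 → ℝ) 2 * v 0) ^ 2 ≤
      2 * ((![0, 1, x, y] : Fin 4 → ℝ) 0 * v 1 - (![0, 1, x, y] : Fin 4 → ℝ) 1 * v 0) *
        ((![0, 1, x, y] : Fin 4 → ℝ) 1 * v 2 - (![0, 1, x, y] : Fin 4 → ℝ) 2 * v 1) ↔ P ≤ 0 := by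
    have : (0 * v 2 - x * v 0) ^ 2 - 2 * (0 * v 1 - 1 * v 0) * (1 * v 2 - x * v 1) =
        v 0 * P := by
      rw [hP]
      ring
    change (0 * v 2 - x * v 0) ^ 2 ≤ 2 * (0 * v 1 - 1 * v 0) * (1 * v 2 - x * v 1) ↔ P ≤ 0
    rw [← sub_nonpos, this]
    exact ⟨fun h => nonpos_of_mul_nonpos_right h hv0, mul_nonpos_of_nonneg_of_nonpos hv0.le⟩
  rw [hwall, hbogomolov, hcircle, hminors]
  simp
end
end

section
/- Let u,v ∈ ℝ⁴ with v0 ≠ 0 and Q^tilt(v) = v1² − 2v0v2 ≥ 0, and let (α0,β0) with α0 > 0 satisfy t_{u,v}(α0,β0) = 0 and ρ_v(α0,β0) = 0 (i.e. the numerical ν-wall Ξ_{u,v} intersects Θ_v at (α0,β0)). Then f_{u,v,s}(α0,β0) = 0 for every real s; that is, the numerical λ-wall Υ_{u,v,s} also passes through (α0,β0) for every s. -/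
noncomputable section

/-- With `v 0 ≠ 0` and nonnegative tilt discriminant, the twisted first Chern character does not
vanish on the hyperbola `ρ_v = 0` in the upper half plane. -/
theorem twisted_ch_one_ne_zero_of_rho_eq_zero {v : Fin 4 → ℝ} {α β : ℝ}
    (hv0 : v 0 ≠ 0) (hQ : 0 ≤ v 1 ^ 2 - 2 * v 0 * v 2) (hα : 0 < α) (hρ : rho v α β = 0) :
    v 1 - β * v 0 ≠ 0 := by
  intro h
  have hpos : 0 < (α * v 0) ^ 2 := by positivity
  have hdisc : v 1 ^ 2 - 2 * v 0 * v 2 = -(α * v 0) ^ 2 := by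
    unfold rho at hρ
    linear_combination (v 1 - β * v 0) * h - 2 * v 0 * hρ
  linarith

/-- If the numerical ν-wall `Ξ_{u,v}` meets `Θ_v` at a point, then the numerical λ-wall
`Υ_{u,v,s}` passes through that point for every `s`. -/
theorem nu_wall_on_theta_implies_lambda_wall
    (u v : Fin 4 → ℝ) (hv0 : v 0 ≠ 0) (hbog : v 1 ^ 2 - 2 * v 0 * v 2 ≥ 0)
    (α0 β0 : ℝ) (hα : 0 < α0)
    (ht : twall u v α0 β0 = 0) (hρ : rho v α0 β0 = 0) :
    ∀ s : ℝ, fwall u v s α0 β0 = 0 := by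
  intro s
  have hne := twisted_ch_one_ne_zero_of_rho_eq_zero hv0 hbog hα hρ
  have hu : rho u α0 β0 = 0 := by simpa [twall, hρ, hne] using ht
  simp [fwall, hρ, hu]
end
end

section
/- Let u,v ∈ ℝ⁴, let s̄ ≥ 0, and suppose (α0,β0) with α0 > 0 satisfies f_{u,v,s̄}(α0,β0) = 0, τ_{v,s̄}(α0,β0) = 0 and ρ_v(α0,β0) ≠ 0 (i.e. the numerical λ-wall Υ_{u,v,s̄} crosses Γ_{v,s̄} away from Θ_v). Then for every s ≥ 0, setting α_s = α0·√((s̄+1/6)/(s+1/6)) > 0, one has f_{u,v,s}(α_s,β0) = 0 and τ_{v,s}(α_s,β0) = 0. In particular the numerical λ-wall Υ_{u,v,s} crosses Γ_{v,s} for every s ≥ 0, at points whose β-coordinate does not depend on s. -/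
noncomputable section

/-- `τ_{w,s}` depends on `s` and `α` only through `(s + 1/6) α²`. -/
theorem tau_eq_of_mul_sq_eq (w : Fin 4 → ℝ) {s t a b : ℝ} (β : ℝ)
    (h : (s + 1 / 6) * a ^ 2 = (t + 1 / 6) * b ^ 2) : tau w s a β = tau w t b β := by
  unfold tau
  linear_combination -(w 1 - β * w 0) * h

/-- If the numerical λ-wall `Υ_{u,v,s̄}` crosses `Γ_{v,s̄}` away from `Θ_v`, then for every
`s ≥ 0` the wall `Υ_{u,v,s}` crosses `Γ_{v,s}` at the point `(α_s, β0)` with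
`α_s = α0·√((s̄+1/6)/(s+1/6))`; in particular the β-coordinate is independent of `s`. -/
theorem lambda_wall_crosses_Gamma_indep_of_s
    (u v : Fin 4 → ℝ) (sbar : ℝ) (hsbar : 0 ≤ sbar) (α0 β0 : ℝ) (hα0 : 0 < α0)
    (hf : fwall u v sbar α0 β0 = 0) (hτ : tau v sbar α0 β0 = 0)
    (hρ : rho v α0 β0 ≠ 0) :
    ∀ s : ℝ, 0 ≤ s →
      0 < α0 * Real.sqrt ((sbar + 1 / 6) / (s + 1 / 6)) ∧
      fwall u v s (α0 * Real.sqrt ((sbar + 1 / 6) / (s + 1 / 6))) β0 = 0 ∧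
      tau v s (α0 * Real.sqrt ((sbar + 1 / 6) / (s + 1 / 6))) β0 = 0 := by
  intro s hs
  have hq : 0 < (sbar + 1 / 6) / (s + 1 / 6) := by positivity
  have key : (s + 1 / 6) * (α0 * Real.sqrt ((sbar + 1 / 6) / (s + 1 / 6))) ^ 2 =
      (sbar + 1 / 6) * α0 ^ 2 := by
    rw [mul_pow, Real.sq_sqrt hq.le]
    field_simp
  have hu : tau u sbar α0 β0 = 0 := by
    simpa [fwall, hτ, hρ] using hf
  have hus := (tau_eq_of_mul_sq_eq u β0 key).trans hu
  have hvs := (tau_eq_of_mul_sq_eq v β0 key).trans hτ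
  exact ⟨mul_pos hα0 (Real.sqrt_pos.2 hq), by rw [fwall, hus, hvs, zero_mul, zero_mul, sub_zero], hvs⟩
end
end

section
/- Let s > 1/3 and let u,v ∈ ℝ⁴ satisfy δ_{10}(u,v) = 0 and δ_{20}(u,v) ≠ 0. Then there exists β_max > 0 (depending on u, v and s) such that every (α,β) with α > 0 and f_{u,v,s}(α,β) = 0 satisfies |β| ≤ β_max; that is, Υ_{u,v,s} ⊆ (0,∞) × [−β_max, β_max]. -/
noncomputable section

/-- When `δ₁₀(u,v) = 0`, the wall equation has leading coefficient in `β` given by `δ₂₀(u,v)`. -/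
lemma fwall_eq_of_delta_eq_zero (u v : Fin 4 → ℝ) (s α β : ℝ)
    (h10 : u 1 * v 0 - u 0 * v 1 = 0) :
    fwall u v s α β =
      (u 3 * v 2 - u 2 * v 3) - β * (u 3 * v 1 - u 1 * v 3)
        + (β ^ 2 - α ^ 2) / 2 * (u 3 * v 0 - u 0 * v 3)
        + (β ^ 2 / 2 + (s + 1 / 6) * α ^ 2) * (u 2 * v 1 - u 1 * v 2)
        - β * (β ^ 2 / 3 + (s - 1 / 3) * α ^ 2) * (u 2 * v 0 - u 0 * v 2) := by
  unfold fwall tau rho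
  linear_combination
    ((β ^ 2 / 2 - (s + 1 / 6) * α ^ 2) * ((β ^ 2 - α ^ 2) / 2)
      + β * (-β ^ 3 / 6 + (s + 1 / 6) * β * α ^ 2)) * h10

/-- If a cubic of the form above vanishes, then `β` is bounded in terms of its coefficients. -/
lemma abs_le_of_cubic_eq_zero {a b c d e s α β : ℝ} (hs : 1 / 3 < s) (he : e ≠ 0)
    (h : a - β * b + (β ^ 2 - α ^ 2) / 2 * c + (β ^ 2 / 2 + (s + 1 / 6) * α ^ 2) * d
      - β * (β ^ 2 / 3 + (s - 1 / 3) * α ^ 2) * e = 0) :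
    |β| ≤ 1 + (|a| + |b| + |c| + (s + 1 / 6) * |d|) / (min (1 / 3) (s - 1 / 3) * |e|) := by
  set m := min (1 / 3) (s - 1 / 3)
  set M := |a| + |b| + |c| + (s + 1 / 6) * |d| with hM
  have hm : 0 < m := lt_min (by norm_num) (by linarith)
  have hme : 0 < m * |e| := mul_pos hm (abs_pos.mpr he)
  have hM0 : 0 ≤ M := by
    have : 0 ≤ s + 1 / 6 := by linarith
    positivity
  rcases le_total |β| 1 with hβ | hβ
  · exact hβ.trans (le_add_of_nonneg_right (by positivity))
  suffices |β| ≤ M / (m * |e|) by linarith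
  rw [le_div_iff₀ hme]
  have hsq : |β| ≤ β ^ 2 := by rw [← sq_abs β]; nlinarith
  have hα : 0 ≤ α ^ 2 := sq_nonneg α
  have hQ : 0 < β ^ 2 + α ^ 2 := by linarith
  have lower : m * (β ^ 2 + α ^ 2) ≤ β ^ 2 / 3 + (s - 1 / 3) * α ^ 2 := by
    have h1 : m ≤ 1 / 3 := min_le_left _ _
    have h2 : m ≤ s - 1 / 3 := min_le_right _ _
    nlinarith [mul_le_mul_of_nonneg_right h1 (sq_nonneg β), mul_le_mul_of_nonneg_right h2 hα]
  have ha : |a| ≤ |a| * (β ^ 2 + α ^ 2) :=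
    le_mul_of_one_le_right (abs_nonneg a) (by linarith)
  have hb : |β * b| ≤ |b| * (β ^ 2 + α ^ 2) := by
    rw [abs_mul, mul_comm]
    exact mul_le_mul_of_nonneg_left (by linarith) (abs_nonneg b)
  have hc : |(β ^ 2 - α ^ 2) / 2 * c| ≤ |c| * (β ^ 2 + α ^ 2) := by
    rw [abs_mul, mul_comm]
    refine mul_le_mul_of_nonneg_left (abs_le.mpr ⟨?_, ?_⟩) (abs_nonneg c) <;> linarith
  have hd : |(β ^ 2 / 2 + (s + 1 / 6) * α ^ 2) * d|
      ≤ (s + 1 / 6) * |d| * (β ^ 2 + α ^ 2) := by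
    have h0 : 0 ≤ β ^ 2 / 2 + (s + 1 / 6) * α ^ 2 := by
      have : 0 ≤ s + 1 / 6 := by linarith
      positivity
    rw [abs_mul, abs_of_nonneg h0, mul_right_comm]
    refine mul_le_mul_of_nonneg_right ?_ (abs_nonneg d)
    nlinarith [sq_nonneg β]
  have main : |β| * (β ^ 2 / 3 + (s - 1 / 3) * α ^ 2) * |e| ≤ M * (β ^ 2 + α ^ 2) := by
    have h0 : 0 ≤ β ^ 2 / 3 + (s - 1 / 3) * α ^ 2 := le_trans (by positivity) lower
    rw [← abs_of_nonneg h0, ← abs_mul, ← abs_mul, ← sub_eq_zero.mp h, hM]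
    calc _ ≤ |a| + |β * b| + |(β ^ 2 - α ^ 2) / 2 * c|
          + |(β ^ 2 / 2 + (s + 1 / 6) * α ^ 2) * d| :=
          (abs_add_le _ _).trans (add_le_add_left ((abs_add_le _ _).trans
            (add_le_add_left (abs_sub _ _) _)) _)
      _ ≤ _ := by linarith
  refine le_of_mul_le_mul_right (le_trans ?_ main) hQ
  calc |β| * (m * |e|) * (β ^ 2 + α ^ 2) = |β| * (m * (β ^ 2 + α ^ 2)) * |e| := by ring
    _ ≤ _ := by gcongr

/-- For `s > 1/3` and `δ_{10}(u,v) = 0`, `δ_{20}(u,v) ≠ 0`, the numerical λ-wall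
`Υ_{u,v,s}` is contained in a horizontal strip `(0,∞) × [−β_max, β_max]`. -/
theorem unbounded_lambda_wall_strip
    (u v : Fin 4 → ℝ) (s : ℝ) (hs : 1 / 3 < s)
    (h10 : u 1 * v 0 - u 0 * v 1 = 0) (h20 : u 2 * v 0 - u 0 * v 2 ≠ 0) :
    ∃ βmax : ℝ, 0 < βmax ∧
      ∀ α β : ℝ, 0 < α → fwall u v s α β = 0 → |β| ≤ βmax := by
  refine ⟨_, ?_, fun α β _ h => abs_le_of_cubic_eq_zero hs h20
    ((fwall_eq_of_delta_eq_zero u v s α β h10).symm.trans h)⟩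
  have hm : 0 < min (1 / 3) (s - 1 / 3) := lt_min (by norm_num) (by linarith)
  have hs' : 0 < s + 1 / 6 := by linarith
  positivity
end
end

section
/- Let 0 < s ≤ 1/3 and let u,v ∈ ℝ⁴ satisfy v0 > 0, δ_{10}(u,v) = 0 and δ_{20}(u,v) ≠ 0. Then there exists α_max > 0 (depending on u, v and s) such that every (α,β) with α > α_max and f_{u,v,s}(α,β) = 0 satisfies ρ_v(α,β) < 0. -/
noncomputable section

/-- A cubic equation in the shifted coordinate `b` has no large solution with `b² - α² ≥ -2c`. -/
lemma exists_bound_of_reduced_wall (s c e K : ℝ) (hs0 : 0 < s) :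
    ∃ αmax : ℝ, 0 < αmax ∧ ∀ α b : ℝ, αmax < α →
      b * ((b ^ 2 - α ^ 2) / 3 + s * α ^ 2) = e / 2 * (b ^ 2 - α ^ 2) + K →
      (b ^ 2 - α ^ 2) / 2 + c < 0 := by
  set M : ℝ := |e| * |c| + |K| + 2 * |c| / 3 with hM
  have hM0 : 0 ≤ M := by positivity
  refine ⟨1 + 2 * |c| + (2 * |e| + 1) ^ 2 + M / s, by positivity, fun α b hα h => ?_⟩
  by_contra! hρ
  have hMs : 0 ≤ M / s := by positivity
  have hα1 : 1 ≤ α := by nlinarith [abs_nonneg c, sq_nonneg (2 * |e| + 1)]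
  have hαsq : α ≤ α ^ 2 := by nlinarith
  have hX : 0 ≤ b ^ 2 - α ^ 2 + 2 * |c| := by linarith [le_abs_self c]
  have hb : 2 * |e| + 1 ≤ |b| := by
    refine abs_le_of_sq_le_sq' ?_ (abs_nonneg b) |>.2
    rw [sq_abs]
    linarith
  have hsα : M < s * α ^ 2 := by
    have : M / s < α ^ 2 := by
      linarith [abs_nonneg c, sq_nonneg (2 * |e| + 1)]
    rwa [div_lt_iff₀' hs0] at this
  have hXabs : |b ^ 2 - α ^ 2| ≤ b ^ 2 - α ^ 2 + 2 * |c| + 2 * |c| := by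
    rw [abs_le]
    constructor <;> linarith [abs_nonneg c]
  have hpos : 0 < s * α ^ 2 - 2 * |c| / 3 := by
    have : 0 ≤ |e| * |c| + |K| := by positivity
    linarith
  have hright : |b| * ((b ^ 2 - α ^ 2) / 3 + s * α ^ 2) ≤
      |e| / 2 * (b ^ 2 - α ^ 2 + 2 * |c| + 2 * |c|) + |K| := by
    calc |b| * ((b ^ 2 - α ^ 2) / 3 + s * α ^ 2)
        = |b * ((b ^ 2 - α ^ 2) / 3 + s * α ^ 2)| := by
          rw [abs_mul, abs_of_nonneg (a := (b ^ 2 - α ^ 2) / 3 + s * α ^ 2) (by linarith)]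
      _ = |e / 2 * (b ^ 2 - α ^ 2) + K| := by rw [h]
      _ ≤ |e / 2 * (b ^ 2 - α ^ 2)| + |K| := abs_add_le _ _
      _ = |e| / 2 * |b ^ 2 - α ^ 2| + |K| := by rw [abs_mul, abs_div, abs_two]
      _ ≤ _ := by gcongr
  have hleft : (2 * |e| + 1) * ((b ^ 2 - α ^ 2) / 3 + s * α ^ 2) ≤
      |b| * ((b ^ 2 - α ^ 2) / 3 + s * α ^ 2) :=
    mul_le_mul_of_nonneg_right hb (by linarith)
  nlinarith [mul_nonneg (abs_nonneg e) hX, mul_nonneg (abs_nonneg e) hpos.le]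

/-- For `0 < s ≤ 1/3` and `δ_{10}(u,v) = 0`, `δ_{20}(u,v) ≠ 0`, points of the numerical
λ-wall with `α` sufficiently large lie in the region `{ρ_v < 0}`. -/
theorem unbounded_lambda_wall_eventually_in_R0
    (u v : Fin 4 → ℝ) (s : ℝ) (hs0 : 0 < s) (hs : s ≤ 1 / 3) (hv0 : 0 < v 0)
    (h10 : u 1 * v 0 - u 0 * v 1 = 0) (h20 : u 2 * v 0 - u 0 * v 2 ≠ 0) :
    ∃ αmax : ℝ, 0 < αmax ∧
      ∀ α β : ℝ, αmax < α → fwall u v s α β = 0 → rho v α β < 0 := by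
  obtain ⟨D, hD⟩ : ∃ D, D = u 2 - u 0 / v 0 * v 2 := ⟨_, rfl⟩
  obtain ⟨k, hk⟩ : ∃ k, k = u 0 / v 0 := ⟨_, rfl⟩
  obtain ⟨m, hm⟩ : ∃ m, m = v 1 / v 0 := ⟨_, rfl⟩
  obtain ⟨c, hc⟩ : ∃ c, c = v 2 / v 0 - m ^ 2 / 2 := ⟨_, rfl⟩
  obtain ⟨w, hw⟩ : ∃ w, w = v 3 / v 0 := ⟨_, rfl⟩
  have hv0' := hv0.ne'
  have hD0 : D ≠ 0 := by
    rintro rfl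
    apply h20
    field_simp at hD
    linarith
  obtain ⟨e, he⟩ : ∃ e, e = (u 3 - k * v 3) / D - m := ⟨_, rfl⟩
  have hu0 : u 0 = k * v 0 := by rw [hk]; field_simp
  have hv1 : v 1 = m * v 0 := by rw [hm]; field_simp
  have hv2 : v 2 = (c + m ^ 2 / 2) * v 0 := by rw [hc]; field_simp; ring
  have hv3 : v 3 = w * v 0 := by rw [hw]; field_simp
  have hu1 : u 1 = k * v 1 := by
    apply mul_right_cancel₀ hv0'
    rw [hu0] at h10
    linarith
  have hu2 : u 2 = k * v 2 + D := by rw [hD, hk]; ring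
  have hu3 : u 3 = k * v 3 + D * (e + m) := by rw [he]; field_simp; ring
  obtain ⟨αmax, hpos, hmax⟩ :=
    exists_bound_of_reduced_wall s c e (e * c - (w - m * c - m ^ 3 / 6)) hs0
  refine ⟨αmax, hpos, fun α β hα hf => ?_⟩
  have hρ : rho v α β = (((β - m) ^ 2 - α ^ 2) / 2 + c) * v 0 := by
    rw [rho, hv2, hv1]
    ring
  rw [hρ]
  refine mul_neg_of_neg_of_pos (hmax α (β - m) hα ?_) hv0
  apply mul_left_cancel₀ (mul_ne_zero hD0 hv0')
  simp only [fwall, rho, tau, hu0, hu1, hu2, hu3, hv1, hv2, hv3] at hf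
  linear_combination -hf
end
end

section
/- Let s > 0 with s ≠ 1/3, and let u,v ∈ ℝ⁴ satisfy δ_{10}(u,v) = 0 and δ_{20}(u,v) ≠ 0. Write δ_{ij} = δ_{ij}(u,v), set β' = 3·((6s+1)δ_{21}/3 − δ_{30}) / ((6s−2)δ_{20}), and set N(β) = (1/3)δ_{20}β³ − (1/2)(δ_{30}+δ_{21})β² + δ_{31}β − δ_{32}. Assume N(β') ≠ 0. Then the numerical λ-wall Υ_{u,v,s} has an unbounded branch asymptotic to the vertical line β = β': for every M > 0 there exists (α,β) with α > M, |β − β'| < 1/M and f_{u,v,s}(α,β) = 0. (Indeed, when δ_{10}(u,v)=0 one has f_{u,v,s}(α,β) = D(β)α² − N(β) with D(β) = −((3s−1)/3)δ_{20}β + ((6s+1)/6)δ_{21} − (1/2)δ_{30}, and D(β') = 0.) -/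
noncomputable section

/-- `δ_{ij}(u,v) = u_i v_j − u_j v_i`. -/
def dlt (u v : Fin 4 → ℝ) (i j : Fin 4) : ℝ := u i * v j - u j * v i

/-- If `δ_{10} = 0`, then `f_{u,v,s}` has no term in `α⁴`, and its coefficient of `α²` is
linear in `β`. -/
theorem fwall_eq_of_dlt_one_zero_eq_zero {u v : Fin 4 → ℝ} (h10 : dlt u v 1 0 = 0)
    (s α β : ℝ) :
    fwall u v s α β =
      (-((3 * s - 1) / 3) * dlt u v 2 0 * β + (6 * s + 1) / 6 * dlt u v 2 1
          - 1 / 2 * dlt u v 3 0) * α ^ 2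
        - ((1 / 3) * dlt u v 2 0 * β ^ 3 - (1 / 2) * (dlt u v 3 0 + dlt u v 2 1) * β ^ 2
          + dlt u v 3 1 * β - dlt u v 3 2) := by
  simp only [dlt] at h10
  simp only [fwall, tau, rho, dlt]
  linear_combination
    ((s + 1 / 6) / 2 * α ^ 4 + (s / 2 - 1 / 6) * α ^ 2 * β ^ 2 + β ^ 4 / 12) * h10

open Filter Topology in
/-- The curve `c (β - b) α² = N(β)` is asymptotic to the line `β = b` when `N` is continuous
and does not vanish at `b`. -/
theorem exists_mul_sub_mul_sq_eq {N : ℝ → ℝ} {b c : ℝ} (hN : ContinuousAt N b)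
    (hc : c ≠ 0) (hb : N b ≠ 0) {M : ℝ} (hM : 0 < M) :
    ∃ α β : ℝ, M < α ∧ |β - b| < 1 / M ∧ c * (β - b) * α ^ 2 = N β := by
  have line : Tendsto (fun ε : ℝ => b + ε * (N b / c)) (𝓝[>] 0) (𝓝 b) := by
    have h : Continuous fun ε : ℝ => b + ε * (N b / c) := by fun_prop
    simpa using (h.tendsto 0).mono_left nhdsWithin_le_nhds
  have ratio : Tendsto (fun ε : ℝ => N (b + ε * (N b / c)) / N b) (𝓝[>] 0) (𝓝 1) := by
    simpa [hb] using (hN.tendsto.comp line).div_const (N b)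
  have close : ∀ᶠ ε in 𝓝[>] (0 : ℝ), |b + ε * (N b / c) - b| < 1 / M :=
    line.eventually (Metric.ball_mem_nhds b (one_div_pos.mpr hM))
  have large := (ratio.pos_mul_atTop one_pos tendsto_inv_nhdsGT_zero).eventually_gt_atTop (M ^ 2)
  obtain ⟨ε, hclose, hlarge, hε⟩ := (close.and (large.and self_mem_nhdsWithin)).exists
  have hε0 : ε ≠ 0 := (Set.mem_Ioi.mp hε).ne'
  refine ⟨√(N (b + ε * (N b / c)) / N b * ε⁻¹), b + ε * (N b / c),
    Real.lt_sqrt_of_sq_lt hlarge, hclose, ?_⟩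
  rw [Real.sq_sqrt ((sq_nonneg M).trans hlarge.le)]
  field_simp
  ring

/-- For `s ≠ 1/3` with `δ_{10} = 0` and `δ_{20} ≠ 0`, one connected component of the
numerical λ-wall `Υ_{u,v,s}` is asymptotic to the vertical line `β = β'`. -/
theorem unbounded_lambda_wall_vertical_asymptote
    (u v : Fin 4 → ℝ) (s : ℝ) (hs : 0 < s) (hs' : s ≠ 1 / 3)
    (h10 : dlt u v 1 0 = 0) (h20 : dlt u v 2 0 ≠ 0)
    (β' : ℝ)
    (hβ' : β' = 3 * ((6 * s + 1) * dlt u v 2 1 / 3 - dlt u v 3 0) /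
      ((6 * s - 2) * dlt u v 2 0))
    (hN : (1 / 3) * dlt u v 2 0 * β' ^ 3
        - (1 / 2) * (dlt u v 3 0 + dlt u v 2 1) * β' ^ 2
        + dlt u v 3 1 * β' - dlt u v 3 2 ≠ 0) :
    ∀ M : ℝ, 0 < M → ∃ α β : ℝ, M < α ∧ |β - β'| < 1 / M ∧ fwall u v s α β = 0 := by
  intro M hM
  have hs3 : 6 * s - 2 ≠ 0 := fun h => hs' (by linarith)
  have hc : -((3 * s - 1) / 3) * dlt u v 2 0 ≠ 0 :=
    mul_ne_zero (fun h => hs3 (by linarith)) h20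
  rw [eq_div_iff (mul_ne_zero hs3 h20)] at hβ'
  obtain ⟨α, β, hα, hβ, h⟩ := exists_mul_sub_mul_sq_eq
    (N := fun β => (1 / 3) * dlt u v 2 0 * β ^ 3
      - (1 / 2) * (dlt u v 3 0 + dlt u v 2 1) * β ^ 2 + dlt u v 3 1 * β - dlt u v 3 2)
    (by fun_prop) hc hN hM
  refine ⟨α, β, hα, hβ, ?_⟩
  rw [fwall_eq_of_dlt_one_zero_eq_zero h10]
  linear_combination h - α ^ 2 / 6 * hβ'
end
end

section
/- Let v ∈ ℝ⁴ with v0 > 0, Q^tilt(v) = v1² − 2v0v2 ≥ 0 and q(v) < 0, and fix s > 0. Then there exists (α,β) with α > 0, ρ_v(α,β) = 0, τ_{v,s}(α,β) = 0 and β < v1/v0 (i.e. the curve Γ_{v,s} intersects the left branch of the hyperbola Θ_v) if and only if v0²v3 > v0v1v2 − v1³/3. -/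
noncomputable section

/-- If `D ^ (3 / 2) < 3 * E`, the cubic `E - D x / 3 - s x (x ^ 2 - D)` has a root
beyond `√D`. -/
theorem exists_cubic_root_gt_sqrt {D E s : ℝ} (hD : 0 ≤ D) (hE : 0 < E) (hs : 0 < s)
    (hDE : D ^ 3 < 9 * E ^ 2) :
    ∃ x : ℝ, 0 < x ∧ D < x ^ 2 ∧ E - D * x / 3 - s * x * (x ^ 2 - D) = 0 := by
  obtain ⟨r, hr, rfl⟩ : ∃ r : ℝ, 0 ≤ r ∧ r ^ 2 = D := ⟨√D, Real.sqrt_nonneg D, Real.sq_sqrt hD⟩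
  have hrE : r ^ 3 < 3 * E := by
    apply lt_of_pow_lt_pow_left₀ 2 (by positivity)
    linarith [show (r ^ 3) ^ 2 = (r ^ 2) ^ 3 by ring]
  obtain ⟨k, hk, rfl⟩ : ∃ k : ℝ, 0 < k ∧ s * k = E := ⟨E / s, by positivity, by field_simp⟩
  have hcont : ContinuousOn (fun x : ℝ => s * k - r ^ 2 * x / 3 - s * x * (x ^ 2 - r ^ 2))
      (Set.Icc r (r + (1 + k))) := by fun_prop
  have hend : s * k - r ^ 2 * (r + (1 + k)) / 3
      - s * (r + (1 + k)) * ((r + (1 + k)) ^ 2 - r ^ 2) ≤ 0 := by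
    have hpos : 0 ≤ r ^ 2 * (r + (1 + k)) / 3 := by positivity
    have hle : k ≤ (r + (1 + k)) * ((r + (1 + k)) ^ 2 - r ^ 2) := by
      have h : 0 ≤ (r + (1 + k)) * ((r + (1 + k)) ^ 2 - r ^ 2) - k := by
        ring_nf
        positivity
      linarith
    nlinarith [mul_le_mul_of_nonneg_left hle hs.le]
  obtain ⟨x, ⟨hrx, -⟩, hx⟩ := intermediate_value_Icc' (by linarith) hcont
    ⟨hend, by nlinarith⟩
  simp only at hx
  have hne : r ≠ x := by
    rintro rfl
    nlinarith
  have hlt : r < x := lt_of_le_of_ne hrx hne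
  exact ⟨x, by linarith, by gcongr, hx⟩

/-- For `v` with `v0 > 0`, satisfying the Bogomolov inequality and `q(v) < 0`, the curve
`Γ_{v,s}` intersects the left branch of the hyperbola `Θ_v` iff
`v0²v3 > v0v1v2 − v1³/3`. -/
theorem Gamma_meets_left_branch_iff
    (v : Fin 4 → ℝ) (hv0 : 0 < v 0) (hbog : v 1 ^ 2 - 2 * v 0 * v 2 ≥ 0)
    (hq : 3 * v 1 ^ 2 * v 2 ^ 2 - 6 * v 1 ^ 3 * v 3 + 18 * v 0 * v 1 * v 2 * v 3
        - 8 * v 0 * v 2 ^ 3 - 9 * v 0 ^ 2 * v 3 ^ 2 < 0)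
    (s : ℝ) (hs : 0 < s) :
    (∃ α β : ℝ, 0 < α ∧ rho v α β = 0 ∧ tau v s α β = 0 ∧ β < v 1 / v 0) ↔
      v 0 ^ 2 * v 3 > v 0 * v 1 * v 2 - v 1 ^ 3 / 3 := by
  obtain ⟨a, ha⟩ : ∃ a, a = v 0 := ⟨_, rfl⟩
  obtain ⟨m, hm⟩ : ∃ m, v 1 = m * a := ⟨v 1 / v 0, by rw [ha]; field_simp⟩
  obtain ⟨c, hc⟩ : ∃ c, v 2 = c * a := ⟨v 2 / v 0, by rw [ha]; field_simp⟩
  obtain ⟨d, hd⟩ : ∃ d, v 3 = d * a := ⟨v 3 / v 0, by rw [ha]; field_simp⟩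
  simp only [rho, tau, ← ha, hm, hc, hd] at *
  clear ha hm hc hd
  have hma : m * a / a = m := by field_simp
  have hcond : a ^ 2 * (d * a) > a * (m * a) * (c * a) - (m * a) ^ 3 / 3 ↔
      0 < d - m * c + m ^ 3 / 3 := by
    rw [gt_iff_lt, ← sub_pos, ← mul_pos_iff_of_pos_left (b := d - m * c + m ^ 3 / 3)
      (pow_pos hv0 3)]
    ring_nf
  rw [hma, hcond]
  have hD : 0 ≤ m ^ 2 - 2 * c := by
    refine nonneg_of_mul_nonneg_right (a := a ^ 2) ?_ (by positivity)
    linarith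
  have hDE : (m ^ 2 - 2 * c) ^ 3 < 9 * (d - m * c + m ^ 3 / 3) ^ 2 := by
    rw [← sub_pos, ← mul_pos_iff_of_pos_left (pow_pos hv0 4)]
    linarith
  constructor
  · rintro ⟨α, β, hα, hρ, hτ, hβ⟩
    have hα2 : α ^ 2 = (m - β) ^ 2 - (m ^ 2 - 2 * c) :=
      mul_left_cancel₀ hv0.ne' (by linarith)
    have hE : d - m * c + m ^ 3 / 3 =
        (m ^ 2 - 2 * c) * (m - β) / 3 + s * (m - β) * α ^ 2 := by
      rw [hα2] at hτ ⊢
      exact mul_left_cancel₀ hv0.ne' (by linarith)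
    have hx : 0 < m - β := sub_pos.2 hβ
    rw [hE]
    positivity
  · intro hE
    obtain ⟨x, hx, hDx, hroot⟩ := exists_cubic_root_gt_sqrt hD hE hs hDE
    have hsq : √(x ^ 2 - (m ^ 2 - 2 * c)) ^ 2 = x ^ 2 - (m ^ 2 - 2 * c) :=
      Real.sq_sqrt (by linarith)
    refine ⟨√(x ^ 2 - (m ^ 2 - 2 * c)), m - x, Real.sqrt_pos.2 (by linarith), ?_, ?_, by linarith⟩
    · rw [hsq]
      ring
    · rw [hsq]
      linear_combination a * hroot
end
end

section
/- Let u,u',v ∈ ℝ⁴ with v0 ≠ 0, and suppose the two vectors (δ_{01}(u,v), δ_{02}(u,v), δ_{12}(u,v)) and (δ_{01}(u',v), δ_{02}(u',v), δ_{12}(u',v)) are linearly independent in ℝ³. Then every (α,β) with α > 0 satisfying t_{u,v}(α,β) = 0 and t_{u',v}(α,β) = 0 must satisfy β = v1/v0 and v0²α² = −(v1² − 2v0v2). In particular, if Q^tilt(v) = v1² − 2v0v2 ≥ 0, then the numerical ν-walls Ξ_{u,v} and Ξ_{u',v} are disjoint. -/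
noncomputable section

/-- The minor of `(δ₀₁, δ₀₂)` already detects linear independence: the Plücker-type relation
`v₀δ₁₂ = v₁δ₀₂ − v₂δ₀₁` determines the third coordinate when `v₀ ≠ 0`. -/
theorem minor_ne_zero_of_linearIndependent {a b c a' b' c' x y z : ℝ} (hx : x ≠ 0)
    (h : x * c = y * b - z * a) (h' : x * c' = y * b' - z * a')
    (hli : LinearIndependent ℝ ![![a, b, c], ![a', b', c']]) : a * b' - a' * b ≠ 0 := by
  intro hab
  rw [LinearIndependent.pair_iff] at hli
  have hac : a' * c - a * c' = 0 := by
    apply (mul_eq_zero.1 _).resolve_left hx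
    linear_combination a' * h - a * h' - y * hab
  have hbc : b' * c - b * c' = 0 := by
    apply (mul_eq_zero.1 _).resolve_left hx
    linear_combination b' * h - b * h' - z * hab
  have ha : a = 0 := neg_eq_zero.1 (hli a' (-a) (by
    ext i; fin_cases i <;> simp <;> linarith)).2
  have hb : b = 0 := neg_eq_zero.1 (hli b' (-b) (by
    ext i; fin_cases i <;> simp <;> linarith)).2
  have hc : c = 0 := by simpa [ha, hb, hx] using h
  exact one_ne_zero (hli 1 0 (by ext i; fin_cases i <;> simp [ha, hb, hc])).1

/-- `v₀ t_{u,v}` as a linear form in `δ₀₁` and `δ₀₂`. -/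
theorem mul_twall (u v : Fin 4 → ℝ) (α β : ℝ) :
    v 0 * twall u v α β =
      (u 0 * v 1 - u 1 * v 0) * (v 2 - v 0 * (α ^ 2 + β ^ 2) / 2) +
        (u 0 * v 2 - u 2 * v 0) * (v 0 * β - v 1) := by
  simp only [twall, rho]; ring

/-- Numerical ν-walls for `v` with linearly independent coefficient vectors
`(δ₀₁, δ₀₂, δ₁₂)` can only meet at the vertex point `β = v1/v0`,
`v0²α² = −(v1² − 2v0v2)`; in particular, when `v` satisfies the Bogomolov
inequality, the two ν-walls are disjoint. -/
theorem nu_walls_disjoint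
    (u u' v : Fin 4 → ℝ) (hv0 : v 0 ≠ 0)
    (hli : LinearIndependent ℝ
      ![![u 0 * v 1 - u 1 * v 0, u 0 * v 2 - u 2 * v 0, u 1 * v 2 - u 2 * v 1],
        ![u' 0 * v 1 - u' 1 * v 0, u' 0 * v 2 - u' 2 * v 0, u' 1 * v 2 - u' 2 * v 1]]) :
    (∀ α β : ℝ, 0 < α → twall u v α β = 0 → twall u' v α β = 0 →
        β = v 1 / v 0 ∧ v 0 ^ 2 * α ^ 2 = -(v 1 ^ 2 - 2 * v 0 * v 2)) ∧
      (v 1 ^ 2 - 2 * v 0 * v 2 ≥ 0 →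
        {p : ℝ × ℝ | 0 < p.1 ∧ twall u v p.1 p.2 = 0} ∩
          {p : ℝ × ℝ | 0 < p.1 ∧ twall u' v p.1 p.2 = 0} = ∅) := by
  have hmeet : ∀ α β : ℝ, 0 < α → twall u v α β = 0 → twall u' v α β = 0 →
      β = v 1 / v 0 ∧ v 0 ^ 2 * α ^ 2 = -(v 1 ^ 2 - 2 * v 0 * v 2) := by
    intro α β _ h h'
    have hD := minor_ne_zero_of_linearIndependent (x := v 0) (y := v 1) (z := v 2) hv0
      (by ring) (by ring) hli
    have e := mul_twall u v α β
    have e' := mul_twall u' v α β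
    rw [h, mul_zero] at e
    rw [h', mul_zero] at e'
    have hp : v 2 - v 0 * (α ^ 2 + β ^ 2) / 2 = 0 := by
      apply (mul_eq_zero.1 _).resolve_left hD
      linear_combination (u 0 * v 2 - u 2 * v 0) * e' - (u' 0 * v 2 - u' 2 * v 0) * e
    have hq : v 0 * β - v 1 = 0 := by
      apply (mul_eq_zero.1 _).resolve_left hD
      linear_combination (u' 0 * v 1 - u' 1 * v 0) * e - (u 0 * v 1 - u 1 * v 0) * e'
    refine ⟨(eq_div_iff hv0).2 (by linarith), ?_⟩
    linear_combination -2 * v 0 * hp - (v 0 * β + v 1) * hq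
  refine ⟨hmeet, fun hQ => Set.eq_empty_iff_forall_notMem.2 ?_⟩
  rintro ⟨α, β⟩ ⟨⟨hα, h⟩, -, h'⟩
  have hpos : 0 < v 0 ^ 2 * α ^ 2 := mul_pos (sq_pos_of_ne_zero hv0) (pow_pos hα 2)
  linarith [(hmeet α β hα h h').2]
end
end

section
/- Let v ∈ ℝ⁴ with v0 ≠ 0 and fix s > 0. Then there exists α0 > 0 such that for every α > α0, the cubic equation in β given by τ_{v,s}(α,β) = 0, equivalently v0β³ − 3v1β² + (6v2 − (6s+1)v0α²)β + ((6s+1)v1α² − 6v3) = 0, has exactly three distinct real solutions. -/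
noncomputable section

/-- A depressed cubic `x³ - p x + q` with `p > 1 + |q|` has exactly three real roots. -/
theorem exists_three_roots_depressed_cubic (p q : ℝ) (h : 1 + |q| < p) :
    ∃ a b c : ℝ, a ≠ b ∧ a ≠ c ∧ b ≠ c ∧ a ^ 3 - p * a + q = 0 ∧ b ^ 3 - p * b + q = 0 ∧
      c ^ 3 - p * c + q = 0 ∧ ∀ x : ℝ, x ^ 3 - p * x + q = 0 → x = a ∨ x = b ∨ x = c := by
  have hq1 := le_abs_self q
  have hq2 := neg_abs_le q
  have hp : 1 < p := by linarith [abs_nonneg q]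
  have hgrow : p - 1 < p ^ 2 * (p - 1) :=
    lt_mul_of_one_lt_left (by linarith) (one_lt_pow₀ hp two_ne_zero)
  have hcont : Continuous fun x : ℝ => x ^ 3 - p * x + q := by fun_prop
  obtain ⟨a, ⟨-, ha1⟩, ha⟩ := intermediate_value_Ioo (show -p ≤ -1 by linarith) hcont.continuousOn
    (show (0 : ℝ) ∈ Set.Ioo _ _ from ⟨by nlinarith, by linarith⟩)
  obtain ⟨b, ⟨hb1, hb2⟩, hb⟩ := intermediate_value_Ioo' (show (-1 : ℝ) ≤ 1 by norm_num)
    hcont.continuousOn (show (0 : ℝ) ∈ Set.Ioo _ _ from ⟨by linarith, by linarith⟩)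
  obtain ⟨c, ⟨hc1, -⟩, hc⟩ := intermediate_value_Ioo hp.le hcont.continuousOn
    (show (0 : ℝ) ∈ Set.Ioo _ _ from ⟨by linarith, by nlinarith⟩)
  dsimp only at ha hb hc
  have hab : a ≠ b := ne_of_lt (ha1.trans hb1)
  have hac : a ≠ c := ne_of_lt (by linarith)
  have hbc : b ≠ c := ne_of_lt (by linarith)
  have quot {x y : ℝ} (hxy : x ≠ y) (hx : x ^ 3 - p * x + q = 0) (hy : y ^ 3 - p * y + q = 0) :
      x ^ 2 + x * y + y ^ 2 = p := by
    apply mul_left_cancel₀ (sub_ne_zero.mpr hxy)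
    linear_combination hx - hy
  have hsum : a + b + c = 0 := by
    apply mul_left_cancel₀ (sub_ne_zero.mpr hbc)
    linear_combination quot hab ha hb - quot hac ha hc
  refine ⟨a, b, c, hab, hac, hbc, ha, hb, hc, fun x hx => ?_⟩
  by_cases hxa : x = a
  · exact Or.inl hxa
  have hprod : (x - b) * (x - c) = 0 := by
    linear_combination quot hxa hx ha - quot hab ha hb + (b - x) * hsum
  rcases mul_eq_zero.mp hprod with h | h
  · exact Or.inr (Or.inl (sub_eq_zero.mp h))
  · exact Or.inr (Or.inr (sub_eq_zero.mp h))

/-- Centring the cubic at `v1 / v0` depresses it, with constant term independent of `α`. -/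
theorem tau_add_div_eq_zero_iff (v : Fin 4 → ℝ) (hv0 : v 0 ≠ 0) (s α x : ℝ) :
    tau v s α (x + v 1 / v 0) = 0 ↔
      x ^ 3 - ((6 * s + 1) * α ^ 2 + 3 * (v 1 / v 0) ^ 2 - 6 * (v 2 / v 0)) * x +
        (6 * (v 2 / v 0) * (v 1 / v 0) - 2 * (v 1 / v 0) ^ 3 - 6 * (v 3 / v 0)) = 0 := by
  have key : tau v s α (x + v 1 / v 0) = -(v 0 / 6) *
      (x ^ 3 - ((6 * s + 1) * α ^ 2 + 3 * (v 1 / v 0) ^ 2 - 6 * (v 2 / v 0)) * x +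
        (6 * (v 2 / v 0) * (v 1 / v 0) - 2 * (v 1 / v 0) ^ 3 - 6 * (v 3 / v 0))) := by
    unfold tau
    field_simp
    ring
  rw [key, mul_eq_zero, or_iff_right]
  exact neg_ne_zero.mpr (div_ne_zero hv0 (by norm_num))

/-- For `v0 ≠ 0` and `s > 0`, for all sufficiently large `α` the cubic equation in `β`
given by `τ_{v,s}(α,β) = 0` has exactly three distinct real roots. -/
theorem Gamma_three_branches (v : Fin 4 → ℝ) (hv0 : v 0 ≠ 0) (s : ℝ) (hs : 0 < s) :
    ∃ α0 : ℝ, 0 < α0 ∧ ∀ α : ℝ, α0 < α →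
      ∃ β1 β2 β3 : ℝ, β1 ≠ β2 ∧ β1 ≠ β3 ∧ β2 ≠ β3 ∧
        tau v s α β1 = 0 ∧ tau v s α β2 = 0 ∧ tau v s α β3 = 0 ∧
        ∀ β : ℝ, tau v s α β = 0 → β = β1 ∨ β = β2 ∨ β = β3 := by
  set m := v 1 / v 0
  set q := 6 * (v 2 / v 0) * m - 2 * m ^ 3 - 6 * (v 3 / v 0)
  refine ⟨1 + |q| + |6 * (v 2 / v 0)|, by positivity, fun α hα => ?_⟩
  have hlarge : 1 + |q| < (6 * s + 1) * α ^ 2 + 3 * m ^ 2 - 6 * (v 2 / v 0) := by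
    have hα1 : 1 < α := by linarith [abs_nonneg q, abs_nonneg (6 * (v 2 / v 0))]
    have hsq : α < α ^ 2 := by nlinarith
    have hsα : 0 < s * α ^ 2 := by positivity
    linarith [le_abs_self (6 * (v 2 / v 0)), sq_nonneg m]
  obtain ⟨a, b, c, hab, hac, hbc, ha, hb, hc, huniq⟩ :=
    exists_three_roots_depressed_cubic _ q hlarge
  refine ⟨a + m, b + m, c + m, by simpa using hab, by simpa using hac, by simpa using hbc,
    (tau_add_div_eq_zero_iff v hv0 s α a).mpr ha, (tau_add_div_eq_zero_iff v hv0 s α b).mpr hb,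
    (tau_add_div_eq_zero_iff v hv0 s α c).mpr hc, fun β hβ => ?_⟩
  rw [← sub_add_cancel β m] at hβ
  simpa only [sub_eq_iff_eq_add] using huniq _ ((tau_add_div_eq_zero_iff v hv0 s α _).mp hβ)
end
end
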